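/- arXiv:1110.5888 — 2 statements merged into one kernel-verified Lean document; each statement's English description precedes it below -/
import Mathlib

section
/- Let n ≥ 1, k ≥ 3, and 0 < ε ≤ 1. If f : S_k^n → [k] is an SCF with D(f, NONMANIP(n,k)) ≥ ε, then P(σ ∈ M_4(f)) ≥ ε^15 / (10^39 · n^67 · k^166), where σ is chosen uniformly from S_k^n (in particular the same lower bound holds for P(σ ∈ M(f)), since M_4(f) ⊆ M(f)). -/
open Finset

/-- `a` is ranked above `b` in the ranking `τ` (a ranking maps positions to
alternatives; earlier positions are better). -/
def Above {k : ℕ} (τ : Equiv.Perm (Fin k)) (a b : Fin k) : Prop :=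
  τ.symm a < τ.symm b

/-- Uniform probability of an event over a finite type. -/
noncomputable def prob {Ω : Type*} [Fintype Ω] (p : Ω → Prop) : ℝ := by
  classical exact ((Finset.univ.filter p).card : ℝ) / (Fintype.card Ω : ℝ)

/-- Number of elements satisfying an event, as a real number. -/
noncomputable def count {Ω : Type*} [Fintype Ω] (p : Ω → Prop) : ℝ := by
  classical exact ((Finset.univ.filter p).card : ℝ)

/-- A ranking profile for `n` voters and `k` alternatives. -/
abbrev Profile (n k : ℕ) := Fin n → Equiv.Perm (Fin k)

/-- `(σ, σ')` is a manipulation pair for `f` at coordinate `i`: they differ exactly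
in coordinate `i` and voter `i` truly prefers `f σ'` to `f σ`. -/
def IsManipPairAt {n k : ℕ} (f : Profile n k → Fin k) (σ σ' : Profile n k) (i : Fin n) : Prop :=
  σ i ≠ σ' i ∧ (∀ j, j ≠ i → σ j = σ' j) ∧ Above (σ i) (f σ') (f σ)

/-- `σ` is a manipulation point of `f`, i.e. `σ ∈ M(f)`. -/
def IsManipPoint {n k : ℕ} (f : Profile n k → Fin k) (σ : Profile n k) : Prop :=
  ∃ σ' i, IsManipPairAt f σ σ' i

/-- `τ` and `τ'` agree outside a block of at most `r` consecutive positions. -/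
def AgreeOutsideBlock {k : ℕ} (r : ℕ) (τ τ' : Equiv.Perm (Fin k)) : Prop :=
  ∃ l : ℕ, ∀ p : Fin k, ((p : ℕ) < l ∨ l + r ≤ (p : ℕ)) → τ p = τ' p

/-- `σ` is an `r`-manipulation point of `f`, i.e. `σ ∈ M_r(f)`. -/
def IsManipPointR {n k : ℕ} (r : ℕ) (f : Profile n k → Fin k) (σ : Profile n k) : Prop :=
  ∃ σ' i, IsManipPairAt f σ σ' i ∧ AgreeOutsideBlock r (σ i) (σ' i)

/-- `f` always elects the top alternative of `H` according to voter `i`. -/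
def IsTopOn {n k : ℕ} (f : Profile n k → Fin k) (i : Fin n) (H : Finset (Fin k)) : Prop :=
  ∀ σ, f σ ∈ H ∧ ∀ b ∈ H, b ≠ f σ → Above (σ i) (f σ) b

/-- `f` takes exactly two values. -/
def TakesExactlyTwoValues {n k : ℕ} (f : Profile n k → Fin k) : Prop :=
  ∃ a b : Fin k, a ≠ b ∧ (∀ σ, f σ = a ∨ f σ = b) ∧ (∃ σ, f σ = a) ∧ (∃ σ, f σ = b)

/-- `f` is monotone: whenever `σ, σ'` differ in exactly one coordinate `i` and
`f σ ≠ f σ'`, voter `i` ranks `f σ'` above `f σ` in `σ' i`. -/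
def IsMonotone {n k : ℕ} (f : Profile n k → Fin k) : Prop :=
  ∀ (σ σ' : Profile n k) (i : Fin n),
    σ i ≠ σ' i → (∀ j, j ≠ i → σ j = σ' j) → f σ ≠ f σ' → Above (σ' i) (f σ') (f σ)

/-- The family `NONMANIP(n,k)` of nonmanipulable social choice functions. -/
def InNonManip {n k : ℕ} (f : Profile n k → Fin k) : Prop :=
  (∃ (i : Fin n) (H : Finset (Fin k)), H.Nonempty ∧ IsTopOn f i H) ∨
  (TakesExactlyTwoValues f ∧ IsMonotone f)

/-- The family `NONMANIP-bar`: functions depending on one coordinate only,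
or taking at most two values. -/
def InNonManipBar {n k : ℕ} (f : Profile n k → Fin k) : Prop :=
  (∃ i : Fin n, ∀ σ σ' : Profile n k, σ i = σ' i → f σ = f σ') ∨
  (∃ a b : Fin k, ∀ σ, f σ = a ∨ f σ = b)

/-- `σ` lies in the fiber `F(z^{a,b})`: `z i = true` iff voter `i` prefers `a` to `b`. -/
def InFiber {n k : ℕ} (a b : Fin k) (z : Fin n → Bool) (σ : Profile n k) : Prop :=
  ∀ i, Above (σ i) a b ↔ z i = true

/-- `σ` is on the boundary `B_i^{a,b}(f)`: `f σ = a` and some `σ'` differing from `σ`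
only in coordinate `i` has `f σ' = b`. -/
def OnBoundaryB {n k : ℕ} (f : Profile n k → Fin k) (i : Fin n) (a b : Fin k)
    (σ : Profile n k) : Prop :=
  f σ = a ∧ ∃ σ' : Profile n k, σ i ≠ σ' i ∧ (∀ j, j ≠ i → σ j = σ' j) ∧ f σ' = b

/-- `σ ∈ B_i(z^{a,b})`. -/
def InBFiber {n k : ℕ} (f : Profile n k → Fin k) (i : Fin n) (a b : Fin k)
    (z : Fin n → Bool) (σ : Profile n k) : Prop :=
  InFiber a b z σ ∧ OnBoundaryB f i a b σ

/-- The fiber `B_i(z^{a,b})` is large (for the parameter `ε`):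
`P(σ ∈ B_i(z^{a,b}) | σ ∈ F(z^{a,b})) ≥ 1 - ε^3/(4 n^3 k^9)`. -/
def IsLargeFiber {n k : ℕ} (f : Profile n k → Fin k) (ε : ℝ) (i : Fin n) (a b : Fin k)
    (z : Fin n → Bool) : Prop :=
  1 - ε ^ 3 / (4 * (n : ℝ) ^ 3 * (k : ℝ) ^ 9) ≤
    prob (fun σ : Profile n k => InBFiber f i a b z σ) /
      prob (fun σ : Profile n k => InFiber a b z σ)

/-- `σ ∈ Lg(B_i^{a,b})`, the union of the large fibers. -/
def InLg {n k : ℕ} (f : Profile n k → Fin k) (ε : ℝ) (i : Fin n) (a b : Fin k)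
    (σ : Profile n k) : Prop :=
  ∃ z, IsLargeFiber f ε i a b z ∧ InBFiber f i a b z σ

/-- `σ ∈ Sm(B_i^{a,b})`, the union of the small fibers. -/
def InSm {n k : ℕ} (f : Profile n k → Fin k) (ε : ℝ) (i : Fin n) (a b : Fin k)
    (σ : Profile n k) : Prop :=
  ∃ z, ¬ IsLargeFiber f ε i a b z ∧ InBFiber f i a b z σ

/-- Two profiles differ in exactly one coordinate. -/
def AdjOneCoord {n k : ℕ} (σ π : Profile n k) : Prop :=
  ∃ i, σ i ≠ π i ∧ ∀ j, j ≠ i → σ j = π j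

/-- `σ` belongs to the vertex boundary `∂(B_i(z^{a,b}))` of `B_i(z^{a,b})` inside the
fiber `F(z^{a,b})`. -/
def InFiberBdry {n k : ℕ} (f : Profile n k → Fin k) (i : Fin n) (a b : Fin k)
    (z : Fin n → Bool) (σ : Profile n k) : Prop :=
  InBFiber f i a b z σ ∧
    ∃ π, AdjOneCoord σ π ∧ InFiber a b z π ∧ ¬ InBFiber f i a b z π

/-- `σ₋ᵢ ∈ D_i(a,b)`: fixing all coordinates except `i` according to `σ`, the induced
one-voter SCF equals `top_H` for some `H ⊇ {a,b}` with `|H| ≥ 3`. -/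
def InD1 {n k : ℕ} (f : Profile n k → Fin k) (i : Fin n) (a b : Fin k)
    (σ : Profile n k) : Prop :=
  ∃ H : Finset (Fin k), a ∈ H ∧ b ∈ H ∧ 3 ≤ H.card ∧
    ∀ τ : Equiv.Perm (Fin k),
      f (Function.update σ i τ) ∈ H ∧
        ∀ c ∈ H, c ≠ f (Function.update σ i τ) → Above τ (f (Function.update σ i τ)) c



noncomputable def ind (P : Prop) : ℝ := by
  classical exact if P then 1 else 0

lemma ind_true {P : Prop} (h : P) : ind P = 1 := by simp [ind, h]
lemma ind_false {P : Prop} (h : ¬ P) : ind P = 0 := by simp [ind, h]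
lemma ind_nonneg (P : Prop) : 0 ≤ ind P := by
  by_cases h : P <;> simp [ind, h]
lemma ind_le_one (P : Prop) : ind P ≤ 1 := by
  by_cases h : P <;> simp [ind, h]
lemma ind_mono {P Q : Prop} (h : P → Q) : ind P ≤ ind Q := by
  by_cases hp : P
  · rw [ind_true hp, ind_true (h hp)]
  · rw [ind_false hp]; exact ind_nonneg _
lemma ind_and (P Q : Prop) : ind (P ∧ Q) = ind P * ind Q := by
  by_cases hp : P <;> by_cases hq : Q <;> simp [ind, hp, hq]
lemma ind_or_le (P Q : Prop) : ind (P ∨ Q) ≤ ind P + ind Q := by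
  by_cases hp : P <;> by_cases hq : Q <;> simp [ind, hp, hq]
lemma ind_not (P : Prop) : ind (¬ P) = 1 - ind P := by
  by_cases hp : P <;> simp [ind, hp]

section
variable {Ω Ω' : Type*} [Fintype Ω] [Fintype Ω']

/-- Uniform average. -/
noncomputable def avg (g : Ω → ℝ) : ℝ := (∑ x, g x) / (Fintype.card Ω : ℝ)

lemma prob_eq (p : Ω → Prop) : prob p = avg (fun x => ind (p x)) := by
  classical
  unfold prob avg ind
  congr 1
  rw [Finset.sum_boole]

lemma avg_mono {g h : Ω → ℝ} (H : ∀ x, g x ≤ h x) : avg g ≤ avg h := by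
  unfold avg; gcongr; exact H _

lemma avg_nonneg {g : Ω → ℝ} (H : ∀ x, 0 ≤ g x) : 0 ≤ avg g := by
  unfold avg; exact div_nonneg (Finset.sum_nonneg fun x _ => H x) (by positivity)

lemma avg_add (g h : Ω → ℝ) : avg (fun x => g x + h x) = avg g + avg h := by
  unfold avg; rw [Finset.sum_add_distrib, add_div]

lemma avg_mul_left (c : ℝ) (g : Ω → ℝ) : avg (fun x => c * g x) = c * avg g := by
  unfold avg; rw [← Finset.mul_sum, mul_div_assoc]

lemma avg_mul_right (c : ℝ) (g : Ω → ℝ) : avg (fun x => g x * c) = avg g * c := by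
  unfold avg; rw [← Finset.sum_mul]; ring

lemma avg_const [Nonempty Ω] (c : ℝ) : avg (fun _ : Ω => c) = c := by
  unfold avg
  have : (Fintype.card Ω : ℝ) ≠ 0 := by exact_mod_cast Fintype.card_ne_zero
  simp [this]

lemma avg_sum {ι : Type*} (s : Finset ι) (g : ι → Ω → ℝ) :
    avg (fun x => ∑ i ∈ s, g i x) = ∑ i ∈ s, avg (g i) := by
  unfold avg; rw [Finset.sum_comm, Finset.sum_div]

lemma avg_equiv (e : Ω ≃ Ω') (g : Ω' → ℝ) : avg (fun x => g (e x)) = avg g := by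
  unfold avg; rw [Equiv.sum_comp e g, Fintype.card_congr e]

lemma avg_prod (g : Ω × Ω' → ℝ) : avg g = avg (fun x => avg (fun y => g (x, y))) := by
  unfold avg
  rw [Fintype.sum_prod_type, Fintype.card_prod, ← Finset.sum_div]
  push_cast; rw [div_div, mul_comm]

lemma avg_prod' (g : Ω × Ω' → ℝ) : avg g = avg (fun y => avg (fun x => g (x, y))) := by
  rw [← avg_equiv (Equiv.prodComm Ω' Ω), avg_prod]; rfl

lemma exists_le_avg [Nonempty Ω] (g : Ω → ℝ) : ∃ x, g x ≤ avg g := by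
  by_contra h
  push Not at h
  have hc : (0:ℝ) < (Fintype.card Ω : ℝ) := by exact_mod_cast Fintype.card_pos
  have : ∑ _x : Ω, avg g < ∑ x, g x := Finset.sum_lt_sum_of_nonempty univ_nonempty (fun x _ => h x)
  simp only [Finset.sum_const, Finset.card_univ, nsmul_eq_mul] at this
  unfold avg at this
  rw [mul_div_cancel₀ _ hc.ne'] at this
  exact lt_irrefl _ this

lemma prob_nonneg (p : Ω → Prop) : 0 ≤ prob p := by
  rw [prob_eq]; exact avg_nonneg fun x => ind_nonneg _

lemma prob_mono {p q : Ω → Prop} (H : ∀ x, p x → q x) : prob p ≤ prob q := by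
  rw [prob_eq, prob_eq]; exact avg_mono fun x => ind_mono (H x)

lemma prob_congr {p q : Ω → Prop} (H : ∀ x, p x ↔ q x) : prob p = prob q :=
  le_antisymm (prob_mono fun x => (H x).1) (prob_mono fun x => (H x).2)

lemma prob_or_le (p q : Ω → Prop) : prob (fun x => p x ∨ q x) ≤ prob p + prob q := by
  rw [prob_eq, prob_eq, prob_eq, ← avg_add]; exact avg_mono fun x => ind_or_le _ _

lemma prob_le_add {p q r : Ω → Prop} (H : ∀ x, p x → q x ∨ r x) : prob p ≤ prob q + prob r :=
  (prob_mono H).trans (prob_or_le q r)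

lemma prob_exists_le {ι : Type*} (s : Finset ι) {p : Ω → Prop} {q : ι → Ω → Prop}
    (H : ∀ x, p x → ∃ i ∈ s, q i x) : prob p ≤ ∑ i ∈ s, prob (q i) := by
  simp only [prob_eq]
  rw [← avg_sum]
  apply avg_mono
  intro x
  by_cases hp : p x
  · obtain ⟨i, hi, hq⟩ := H x hp
    rw [ind_true hp, ← ind_true hq]
    exact Finset.single_le_sum (f := fun i => ind (q i x)) (fun i _ => ind_nonneg _) hi
  · rw [ind_false hp]; exact Finset.sum_nonneg fun i _ => ind_nonneg _

lemma prob_equiv (e : Ω ≃ Ω') (p : Ω' → Prop) : prob (fun x => p (e x)) = prob p := by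
  rw [prob_eq, prob_eq]; exact avg_equiv e (fun x => ind (p x))

lemma prob_invol (e : Ω → Ω) (he : Function.Involutive e) (p : Ω → Prop) :
    prob (fun x => p (e x)) = prob p := prob_equiv he.toPerm p

lemma prob_one [Nonempty Ω] {p : Ω → Prop} (h : ∀ x, p x) : prob p = 1 := by
  rw [prob_eq]; rw [show (fun x => ind (p x)) = fun _ => (1:ℝ) from funext fun x => ind_true (h x)]
  exact avg_const 1

lemma prob_zero {p : Ω → Prop} (h : ∀ x, ¬ p x) : prob p = 0 := by
  rw [prob_eq]; rw [show (fun x => ind (p x)) = fun _ => (0:ℝ) from funext fun x => ind_false (h x)]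
  simp [avg]

lemma prob_le_one [Nonempty Ω] (p : Ω → Prop) : prob p ≤ 1 := by
  rw [← prob_one (Ω := Ω) (p := fun _ => True) (fun _ => trivial)]
  exact prob_mono fun _ _ => trivial

lemma prob_not [Nonempty Ω] (p : Ω → Prop) : prob (fun x => ¬ p x) = 1 - prob p := by
  rw [prob_eq, prob_eq]
  have := avg_add (fun x => ind (¬ p x)) (fun x => ind (p x))
  rw [show (fun x => ind (¬ p x) + ind (p x)) = fun _ => (1:ℝ) from
    funext fun x => by rw [ind_not]; ring, avg_const] at this
  linarith

lemma prob_exists_of_pos {p : Ω → Prop} (h : 0 < prob p) : ∃ x, p x := by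
  by_contra hc
  push Not at hc
  rw [prob_zero hc] at h
  exact lt_irrefl _ h

lemma prob_prod (p : Ω × Ω' → Prop) : prob p = avg (fun x => prob (fun y => p (x, y))) := by
  rw [prob_eq, avg_prod]; simp only [prob_eq]

lemma prob_prod' (p : Ω × Ω' → Prop) : prob p = avg (fun y => prob (fun x => p (x, y))) := by
  rw [prob_eq, avg_prod']; simp only [prob_eq]

lemma prob_fst [Nonempty Ω'] (p : Ω → Prop) : prob (fun x : Ω × Ω' => p x.1) = prob p := by
  rw [prob_prod']; exact avg_const (prob p)

lemma prob_snd [Nonempty Ω] (p : Ω' → Prop) : prob (fun x : Ω × Ω' => p x.2) = prob p := by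
  rw [prob_prod]; exact avg_const (prob p)

lemma prob_exists_section [Nonempty Ω'] (p : Ω × Ω' → Prop) :
    ∃ y, prob (fun x => p (x, y)) ≤ prob p := by
  rw [prob_prod']; exact exists_le_avg _

lemma prob_and_ge (p : Ω → Prop) (q : Ω → Ω' → Prop) (c : ℝ)
    (hq : ∀ x, p x → c ≤ prob (q x)) :
    prob p * c ≤ prob (fun y : Ω × Ω' => p y.1 ∧ q y.1 y.2) := by
  rw [prob_prod, prob_eq, ← avg_mul_right]
  apply avg_mono
  intro x
  by_cases hp : p x
  · rw [ind_true hp, one_mul]; refine (hq x hp).trans (prob_mono fun y hy => ⟨hp, hy⟩)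
  · rw [ind_false hp, zero_mul]; exact prob_nonneg _

end

set_option linter.unusedSectionVars false

section
variable {n : ℕ} {X : Type*} [Fintype X]

/-- Exchange coordinate `i` of the profile with an outside ranking. -/
def exch (i : Fin n) (y : (Fin n → X) × X) : (Fin n → X) × X :=
  (Function.update y.1 i y.2, y.1 i)

lemma exch_invol (i : Fin n) : Function.Involutive (exch (X := X) i) := by
  rintro ⟨w, x⟩
  simp [exch]

lemma prob_update (i : Fin n) (p : (Fin n → X) → Prop) [Nonempty X] :
    prob (fun y : (Fin n → X) × X => p (Function.update y.1 i y.2)) = prob p := by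
  have := prob_invol (exch (X := X) i) (exch_invol i) (fun y => p y.1)
  rw [prob_fst] at this
  exact this

lemma prob_indep (i : Fin n) (E : (Fin n → X) → Prop) (P : X → Prop) [Nonempty X]
    (hE : ∀ w x, E (Function.update w i x) ↔ E w) :
    prob (fun w => E w ∧ P (w i)) = prob E * prob P := by
  have h1 := prob_update (X := X) i (fun w => E w ∧ P (w i))
  rw [← h1]
  simp only [hE, Function.update_self]
  rw [prob_prod, prob_eq E, ← avg_mul_right]
  congr 1; funext x
  by_cases hx : E x
  · rw [ind_true hx, one_mul]; exact prob_congr fun y => by simp [hx]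
  · rw [ind_false hx, zero_mul]; exact prob_zero fun y => by simp [hx]

lemma prob_map_coord (i : Fin n) (e : X → X) (he : Function.Involutive e)
    (p : (Fin n → X) → Prop) :
    prob (fun w : Fin n → X => p (Function.update w i (e (w i)))) = prob p := by
  have h : Function.Involutive (fun w : Fin n → X => Function.update w i (e (w i))) := by
    intro w
    simp [he (w i)]
  exact prob_invol _ h p

end


set_option linter.unusedSectionVars false

section
variable {n : ℕ} {X : Type*} [Fintype X]

/-- Apply an involution of `X × X` on the coordinates in `T`. -/
def mixBoth (Φ : X × X → X × X) (T : Finset (Fin n)) (y : (Fin n → X) × (Fin n → X)) :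
    (Fin n → X) × (Fin n → X) :=
  (fun l => if l ∈ T then (Φ (y.1 l, y.2 l)).1 else y.1 l,
   fun l => if l ∈ T then (Φ (y.1 l, y.2 l)).2 else y.2 l)

lemma mixBoth_invol (Φ : X × X → X × X) (hΦ : Function.Involutive Φ) (T : Finset (Fin n)) :
    Function.Involutive (mixBoth (n := n) Φ T) := by
  rintro ⟨u, v⟩
  apply Prod.ext
  · funext l
    by_cases h : l ∈ T
    · simp [mixBoth, h, hΦ (u l, v l)]
    · simp [mixBoth, h]
  · funext l
    by_cases h : l ∈ T
    · simp [mixBoth, h, hΦ (u l, v l)]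
    · simp [mixBoth, h]

lemma mixBoth_prob (Φ : X × X → X × X) (hΦ : Function.Involutive Φ) (T : Finset (Fin n))
    [Nonempty X] (p : (Fin n → X) → Prop) :
    prob (fun y => p (mixBoth Φ T y).1) = prob p := by
  rw [prob_invol (mixBoth Φ T) (mixBoth_invol Φ hΦ T) (fun y => p y.1)]
  exact prob_fst p

lemma prob_eval_snd [Nonempty X] (j : Fin n) (q : (Fin n → X) → X → Prop) :
    prob (fun y : (Fin n → X) × (Fin n → X) => q y.1 (y.2 j)) =
      prob (fun y : (Fin n → X) × X => q y.1 y.2) := by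
  rw [prob_prod, prob_prod]
  congr 1; funext x
  have := prob_indep (X := X) j (fun _ => True) (q x) (fun _ _ => Iff.rfl)
  simp only [true_and] at this
  rw [this, prob_one (fun _ => trivial), one_mul]

/-- Hybrid argument. -/
lemma hybrid [Nonempty X] (Φ : X × X → X × X) (hΦ : Function.Involutive Φ)
    (D : (Fin n → X) → (Fin n → X) → Prop) (hrefl : ∀ u, D u u)
    (htrans : ∀ u v w, D u v → D v w → D u w) (T : Finset (Fin n)) :
    prob (fun y : (Fin n → X) × (Fin n → X) => ¬ D y.1 (mixBoth Φ T y).1) ≤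
      ∑ j ∈ T, prob (fun y : (Fin n → X) × X =>
        ¬ D y.1 (Function.update y.1 j (Φ (y.1 j, y.2)).1)) := by
  classical
  induction T using Finset.induction_on with
  | empty =>
    rw [prob_zero]; · simp
    rintro ⟨u, v⟩; simp [mixBoth, hrefl]
  | insert j T hj ih =>
    rw [Finset.sum_insert hj]
    have h1 : prob (fun y : (Fin n → X) × (Fin n → X) =>
        ¬ D (mixBoth Φ T y).1 (mixBoth Φ (insert j T) y).1) =
        prob (fun y : (Fin n → X) × X =>
          ¬ D y.1 (Function.update y.1 j (Φ (y.1 j, y.2)).1)) := by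
      rw [← prob_eval_snd j (fun u x => ¬ D u (Function.update u j (Φ (u j, x)).1))]
      rw [← prob_invol (mixBoth Φ T) (mixBoth_invol Φ hΦ T)
        (fun y => ¬ D y.1 (Function.update y.1 j (Φ (y.1 j, y.2 j)).1))]
      apply prob_congr
      rintro ⟨u, v⟩
      have : (mixBoth Φ (insert j T) (u, v)).1 =
        Function.update (mixBoth Φ T (u, v)).1 j
          (Φ ((mixBoth Φ T (u, v)).1 j, (mixBoth Φ T (u, v)).2 j)).1 := by
        funext l
        by_cases hl : l = j
        · subst hl; simp [mixBoth, hj]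
        · simp [mixBoth, hl]
      rw [this]
    rw [← h1, add_comm]
    refine (prob_le_add ?_).trans (add_le_add_left ih _)
    intro y hy
    by_contra hc
    push Not at hc
    exact hy (htrans _ _ _ hc.1 hc.2)

end

section RH

lemma two_point (r a b c d : ℝ) (h1 : 1/8 ≤ r) (h2 : r ≤ 3/8) :
    ((a + b)/2)^2 * ((c+d)/2)^2 ≤
      r * (a^2*c^2 + b^2*d^2) + (1/2 - r) * (a^2*d^2 + b^2*c^2) := by
  have e1 : ((a + b)/2)^2 * ((c+d)/2)^2 ≤
      3/8 * (a^2*c^2 + b^2*d^2) + 1/8 * (a^2*d^2 + b^2*c^2) := by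
    linarith [sq_nonneg (a*c+b*d-a*d-b*c), sq_nonneg (a*c-b*d)]
  have e2 : ((a + b)/2)^2 * ((c+d)/2)^2 ≤
      1/8 * (a^2*c^2 + b^2*d^2) + 3/8 * (a^2*d^2 + b^2*c^2) := by
    linarith [sq_nonneg (a*c+b*d-a*d-b*c), sq_nonneg (a*d-b*c)]
  have k1 : 0 ≤ (r - 1/8) * (3/8 * (a^2*c^2 + b^2*d^2) + 1/8 * (a^2*d^2 + b^2*c^2)
      - ((a + b)/2)^2 * ((c+d)/2)^2) := mul_nonneg (by linarith) (by linarith)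
  have k2 : 0 ≤ (3/8 - r) * (1/8 * (a^2*c^2 + b^2*d^2) + 3/8 * (a^2*d^2 + b^2*c^2)
      - ((a + b)/2)^2 * ((c+d)/2)^2) := mul_nonneg (by linarith) (by linarith)
  linarith

variable {X : Type*} [Fintype X] [Nonempty X]

lemma avg_two (α β : X → Bool) (φ : Bool → Bool → ℝ) :
    avg (fun x => φ (α x) (β x)) =
      prob (fun x => α x = true ∧ β x = true) * φ true true +
      prob (fun x => α x = true ∧ ¬ β x = true) * φ true false +
      prob (fun x => ¬ α x = true ∧ β x = true) * φ false true +
      prob (fun x => ¬ α x = true ∧ ¬ β x = true) * φ false false := by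
  simp only [prob_eq]
  simp only [← avg_mul_right, ← avg_add]
  congr 1; funext x
  cases h1 : α x <;> cases h2 : β x <;> simp [ind]

lemma prob_split (p q : X → Prop) :
    prob (fun x => p x ∧ q x) + prob (fun x => p x ∧ ¬ q x) = prob p := by
  simp only [prob_eq]
  simp only [← avg_add]
  congr 1; funext x
  by_cases h1 : p x <;> by_cases h2 : q x <;> simp [ind, h1, h2]

lemma prob_split' (p q : X → Prop) :
    prob (fun x => p x ∧ q x) + prob (fun x => ¬ p x ∧ q x) = prob q := by
  rw [← prob_split q p]
  congr 1
  · exact prob_congr fun x => and_comm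
  · exact prob_congr fun x => and_comm

lemma avg_one (α : X → Bool) (hα : prob (fun x => α x = true) = 1/2) (φ : Bool → ℝ) :
    avg (fun x => φ (α x)) = (φ true + φ false) / 2 := by
  have h := avg_two α α (fun s _ => φ s)
  rw [h]
  have e1 : prob (fun x => α x = true ∧ α x = true) = 1/2 := by simp [hα]
  have e2 : prob (fun x => α x = true ∧ ¬ α x = true) = 0 := prob_zero (by simp)
  have e3 : prob (fun x => ¬ α x = true ∧ α x = true) = 0 := prob_zero (by simp)
  have e4 : prob (fun x => ¬ α x = true ∧ ¬ α x = true) = 1/2 := by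
    rw [prob_congr (q := fun x => ¬ α x = true) (by simp), prob_not, hα]; norm_num
  rw [e1, e2, e3, e4]; ring

/-- Reverse hypercontractivity (two-function form). -/
lemma rev_hyp (α β : X → Bool) (hα : prob (fun x => α x = true) = 1/2)
    (hβ : prob (fun x => β x = true) = 1/2)
    (h1 : 1/8 ≤ prob (fun x => α x = true ∧ β x = true))
    (h2 : prob (fun x => α x = true ∧ β x = true) ≤ 3/8) (n : ℕ) :
    ∀ (F G : (Fin n → Bool) → ℝ), 
      (avg (fun w : Fin n → X => F (α ∘ w)))^2 * (avg (fun w : Fin n → X => G (β ∘ w)))^2 ≤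
      avg (fun w : Fin n → X => (F (α ∘ w))^2 * (G (β ∘ w))^2) := by
  have ht : prob (fun x => α x = true ∧ ¬ β x = true) =
      1/2 - prob (fun x => α x = true ∧ β x = true) := by
    rw [← hα, ← prob_split (fun x => α x = true) (fun x => β x = true)]; ring
  have hf : prob (fun x => ¬ α x = true ∧ β x = true) =
      1/2 - prob (fun x => α x = true ∧ β x = true) := by
    rw [← hβ, ← prob_split' (fun x => α x = true) (fun x => β x = true)]; ring
  have hff : prob (fun x => ¬ α x = true ∧ ¬ β x = true) =
      prob (fun x => α x = true ∧ β x = true) := by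
    have := prob_split (fun x => ¬ α x = true) (fun x => β x = true)
    rw [prob_not, hα] at this
    linarith
  induction n with
  | zero =>
    intro F G
    have : ∀ (g : (Fin 0 → X) → ℝ), avg g = g (fun i => i.elim0) := by
      intro g
      have : g = fun _ => g (fun i => i.elim0) := by
        funext w; congr 1; funext i; exact i.elim0
      rw [this, avg_const]
    rw [this, this, this]
  | succ n ih =>
    intro F G
    have key : ∀ (g : (Fin (n+1) → X) → ℝ),
        avg g = avg (fun x => avg (fun y : Fin n → X => g (Fin.cons x y))) := by
      intro g
      rw [← avg_equiv (Fin.consEquiv (fun _ => X)) g, avg_prod]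
      rfl
    have cc : ∀ (γ : X → Bool) (x : X) (y : Fin n → X),
        γ ∘ (Fin.cons x y : Fin (n+1) → X) = Fin.cons (γ x) (γ ∘ y) := by
      intro γ x y
      funext l
      refine Fin.cases ?_ (fun l => ?_) l <;> simp
    rw [key, key, key]
    simp only [cc]
    have m1 := avg_one α hα (fun s => avg (fun y : Fin n → X => F (Fin.cons s (α ∘ y))))
    have m2 := avg_one β hβ (fun s => avg (fun y : Fin n → X => G (Fin.cons s (β ∘ y))))
    have m3 := avg_two α β (fun s t => avg (fun y : Fin n → X =>
      (F (Fin.cons s (α ∘ y)))^2 * (G (Fin.cons t (β ∘ y)))^2))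
    rw [m1, m2, m3, ht, hf, hff]
    have I := fun s t => ih (fun u => F (Fin.cons s u)) (fun u => G (Fin.cons t u))
    set r := prob (fun x => α x = true ∧ β x = true)
    refine (two_point r _ _ _ _ h1 h2).trans ?_
    have r1 : 0 ≤ r := by linarith
    have r2 : 0 ≤ 1/2 - r := by linarith
    have i1 := mul_le_mul_of_nonneg_left (I true true) r1
    have i2 := mul_le_mul_of_nonneg_left (I false false) r1
    have i3 := mul_le_mul_of_nonneg_left (I true false) r2
    have i4 := mul_le_mul_of_nonneg_left (I false true) r2
    linarith

lemma rev_hyp_set (α β : X → Bool) (hα : prob (fun x => α x = true) = 1/2)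
    (hβ : prob (fun x => β x = true) = 1/2)
    (h1 : 1/8 ≤ prob (fun x => α x = true ∧ β x = true))
    (h2 : prob (fun x => α x = true ∧ β x = true) ≤ 3/8) {n : ℕ}
    (A B : (Fin n → X) → Prop) (hA : ∀ u v, α ∘ u = α ∘ v → A u → A v)
    (hB : ∀ u v, β ∘ u = β ∘ v → B u → B v) :
    (prob A)^2 * (prob B)^2 ≤ prob (fun w => A w ∧ B w) := by
  have := rev_hyp α β hα hβ h1 h2 n (fun z => ind (∃ u, α ∘ u = z ∧ A u))
    (fun z => ind (∃ u, β ∘ u = z ∧ B u))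
  have eA : ∀ w : Fin n → X, (∃ u, α ∘ u = α ∘ w ∧ A u) ↔ A w := fun w =>
    ⟨fun ⟨u, h, hu⟩ => hA u w h hu, fun h => ⟨w, rfl, h⟩⟩
  have eB : ∀ w : Fin n → X, (∃ u, β ∘ u = β ∘ w ∧ B u) ↔ B w := fun w =>
    ⟨fun ⟨u, h, hu⟩ => hB u w h hu, fun h => ⟨w, rfl, h⟩⟩
  simp only [eA, eB] at this
  rw [prob_eq, prob_eq, prob_eq]
  refine this.trans (le_of_eq ?_)
  congr 1; funext w
  by_cases h1 : A w <;> by_cases h2 : B w <;> simp [ind, h1, h2]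

end RH


section
variable {Ω : Type*} [Fintype Ω]
lemma prob_pos_of {p : Ω → Prop} (x : Ω) (h : p x) : 0 < prob p := by
  classical
  have : Nonempty Ω := ⟨x⟩
  unfold prob
  apply div_pos
  · have : 0 < (Finset.univ.filter p).card := Finset.card_pos.mpr ⟨x, by simp [h]⟩
    exact_mod_cast this
  · exact_mod_cast Fintype.card_pos
end

set_option linter.unusedSectionVars false

section Sorting
variable {n : ℕ} {X : Type*} [Fintype X]

/-- Flip coordinate `j`. -/
def fl (s : X → X) (j : Fin n) (w : Fin n → X) : Fin n → X := Function.update w j (s (w j))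

def viol (s : X → X) (z : X → Prop) (j : Fin n) (u : (Fin n → X) → Prop) (w : Fin n → X) : Prop :=
  ¬ z (w j) ∧ u w ∧ ¬ u (fl s j w)

def sortc (s : X → X) (z : X → Prop) (j : Fin n) (u : (Fin n → X) → Prop) (w : Fin n → X) : Prop :=
  (z (w j) ∧ (u w ∨ u (fl s j w))) ∨ (¬ z (w j) ∧ u w ∧ u (fl s j w))


lemma fl_fl (s : X → X) (hs : Function.Involutive s)
    (j : Fin n) (w : Fin n → X) : fl s j (fl s j w) = w := by
  simp [fl, hs (w j)]

lemma fl_comm (s : X → X)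
    {i j : Fin n} (h : i ≠ j) (w : Fin n → X) :
    fl s i (fl s j w) = fl s j (fl s i w) := by
  unfold fl
  rw [Function.update_of_ne h, Function.update_of_ne h.symm, Function.update_comm h]

lemma fl_self (s : X → X)
    (j : Fin n) (w : Fin n → X) : fl s j w j = s (w j) := by simp [fl]
lemma fl_ne (s : X → X)
    {i j : Fin n} (h : i ≠ j) (w : Fin n → X) : fl s j w i = w i := by simp [fl, h]

lemma prob_fl (s : X → X) (hs : Function.Involutive s)
    (j : Fin n) (p : (Fin n → X) → Prop) : prob (fun w => p (fl s j w)) = prob p :=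
  prob_map_coord j s hs p

lemma viol_sort_self (s : X → X) (z : X → Prop) (hs : Function.Involutive s) (hz : ∀ x, z (s x) ↔ ¬ z x)
    (j : Fin n) (u : (Fin n → X) → Prop) (w : Fin n → X) :
    ¬ viol s z j (sortc s z j u) w := by
  unfold viol sortc
  rw [fl_fl s hs, fl_self, hz]
  tauto

lemma viol_sort_other (s : X → X) (z : X → Prop) (hs : Function.Involutive s) (hz : ∀ x, z (s x) ↔ ¬ z x)
    {i j : Fin n} (h : i ≠ j) (u : (Fin n → X) → Prop) :
    prob (viol s z j (sortc s z i u)) ≤ prob (viol s z j u) := by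
  have e1 := prob_fl s hs i (viol s z j (sortc s z i u))
  have e2 := prob_fl s hs i (viol s z j u)
  have : prob (viol s z j (sortc s z i u)) + prob (fun w => viol s z j (sortc s z i u) (fl s i w)) ≤
      prob (viol s z j u) + prob (fun w => viol s z j u (fl s i w)) := by
    rw [prob_eq, prob_eq, prob_eq, prob_eq, ← avg_add, ← avg_add]
    apply avg_mono
    intro w
    unfold viol sortc
    have c1 : fl s i (fl s i w) = w := fl_fl s hs i w
    have c2 : fl s j (fl s i w) = fl s i (fl s j w) := (fl_comm s h w).symm
    have c3 : fl s i (fl s i (fl s j w)) = fl s j w := fl_fl s hs i _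
    have c4 : fl s i w i = s (w i) := fl_self s i w
    have c5 : fl s i w j = w j := fl_ne s h.symm w
    have c6 : fl s j w i = w i := fl_ne s h w
    have c7 : fl s i (fl s j w) i = s (w i) := by rw [fl_self, c6]
    simp only [c1, c2, c3, c4, c5, c6, c7, hz]
    by_cases a1 : z (w i) <;> by_cases a2 : z (w j) <;> by_cases a3 : u w <;>
    by_cases a4 : u (fl s i w) <;> by_cases a5 : u (fl s j w) <;>
    by_cases a6 : u (fl s i (fl s j w)) <;> simp [ind, a1, a2, a3, a4, a5, a6]
  linarith

lemma sort_dist (s : X → X) (z : X → Prop) (hs : Function.Involutive s) (hz : ∀ x, z (s x) ↔ ¬ z x)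
    (j : Fin n) (u : (Fin n → X) → Prop) :
    prob (fun w => ¬ (u w ↔ sortc s z j u w)) ≤ 2 * prob (viol s z j u) := by
  have e := prob_fl s hs j (viol s z j u)
  have : prob (fun w => ¬ (u w ↔ sortc s z j u w)) ≤
      prob (viol s z j u) + prob (fun w => viol s z j u (fl s j w)) := by
    apply prob_le_add
    intro w hw
    unfold viol sortc at *
    rw [fl_fl s hs, fl_self, hz]
    tauto
  linarith

lemma sort_dep (s : X → X) (z : X → Prop) (hz : ∀ x, z (s x) ↔ ¬ z x)
    (j : Fin n) (u : (Fin n → X) → Prop)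
    (hu : ∀ v w, (∀ l, z (v l) ↔ z (w l)) → (u v ↔ u w)) :
    ∀ v w, (∀ l, z (v l) ↔ z (w l)) → (sortc s z j u v ↔ sortc s z j u w) := by
  intro v w h
  unfold sortc
  have : u (fl s j v) ↔ u (fl s j w) := by
    apply hu
    intro l
    by_cases hl : l = j
    · subst hl; rw [fl_self, fl_self, hz, hz, h]
    · rw [fl_ne s hl, fl_ne s hl, h]
  rw [this, hu v w h, h j]

lemma sort_all (s : X → X) (z : X → Prop) (hs : Function.Involutive s) (hz : ∀ x, z (s x) ↔ ¬ z x)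
    (u : (Fin n → X) → Prop)
    (hu : ∀ v w, (∀ l, z (v l) ↔ z (w l)) → (u v ↔ u w)) :
    ∃ u' : (Fin n → X) → Prop, (∀ v w, (∀ l, z (v l) ↔ z (w l)) → (u' v ↔ u' w)) ∧
      (∀ j w, ¬ viol s z j u' w) ∧
      prob (fun w => ¬ (u w ↔ u' w)) ≤ 2 * ∑ j, prob (viol s z j u) := by
  classical
  have main : ∀ T : Finset (Fin n), ∃ u' : (Fin n → X) → Prop,
      (∀ v w, (∀ l, z (v l) ↔ z (w l)) → (u' v ↔ u' w)) ∧
      (∀ j ∈ T, prob (viol s z j u') ≤ 0) ∧ (∀ j, prob (viol s z j u') ≤ prob (viol s z j u)) ∧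
      prob (fun w => ¬ (u w ↔ u' w)) ≤ 2 * ∑ j ∈ T, prob (viol s z j u) := by
    intro T
    induction T using Finset.induction_on with
    | empty =>
      refine ⟨u, hu, by simp, fun j => le_rfl, ?_⟩
      rw [prob_zero (by simp)]; simp
    | insert j T hj ih =>
      obtain ⟨u', h1, h2, h3, h4⟩ := ih
      refine ⟨sortc s z j u', sort_dep s z hz j u' h1, ?_, ?_, ?_⟩
      · intro l hl
        by_cases h : l = j
        · subst h; rw [prob_zero (viol_sort_self s z hs hz l u')]
        · exact (viol_sort_other s z hs hz (Ne.symm h) u').trans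
            (h2 l ((Finset.mem_insert.1 hl).resolve_left h))
      · intro l
        by_cases h : l = j
        · subst h; rw [prob_zero (viol_sort_self s z hs hz l u')]; exact prob_nonneg _
        · exact (viol_sort_other s z hs hz (Ne.symm h) u').trans (h3 l)
      · rw [Finset.sum_insert hj]
        have := sort_dist s z hs hz j u'
        have h3j := h3 j
        have : prob (fun w => ¬ (u w ↔ sortc s z j u' w)) ≤
          prob (fun w => ¬ (u w ↔ u' w)) + prob (fun w => ¬ (u' w ↔ sortc s z j u' w)) := by
          apply prob_le_add
          intro w hw
          tauto
        linarith
  obtain ⟨u', h1, h2, -, h4⟩ := main univ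
  refine ⟨u', h1, fun j w hv => ?_, h4⟩
  have := prob_pos_of w hv
  linarith [h2 j (mem_univ _)]
end Sorting


section
variable {k : ℕ}

lemma above_irrefl (τ : Equiv.Perm (Fin k)) (a : Fin k) : ¬ Above τ a a := lt_irrefl _
lemma above_asymm {τ : Equiv.Perm (Fin k)} {a b : Fin k} (h : Above τ a b) : ¬ Above τ b a :=
  lt_asymm h
lemma above_trans {τ : Equiv.Perm (Fin k)} {a b c : Fin k} (h : Above τ a b) (h' : Above τ b c) :
    Above τ a c := lt_trans h h'
lemma above_total (τ : Equiv.Perm (Fin k)) {a b : Fin k} (h : a ≠ b) : Above τ a b ∨ Above τ b a := by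
  rcases lt_trichotomy (τ.symm a) (τ.symm b) with h1 | h1 | h1
  · exact Or.inl h1
  · exact absurd (τ.symm.injective h1) h
  · exact Or.inr h1
lemma not_above {τ : Equiv.Perm (Fin k)} {a b : Fin k} (h : a ≠ b) : ¬ Above τ a b ↔ Above τ b a :=
  ⟨fun h1 => (above_total τ h).resolve_left h1, fun h1 => above_asymm h1⟩

lemma above_mul (g τ : Equiv.Perm (Fin k)) (a b : Fin k) :
    Above (g * τ) (g a) (g b) ↔ Above τ a b := by
  unfold Above
  have : ∀ x, (g * τ).symm (g x) = τ.symm x := by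
    intro x; rw [Equiv.symm_apply_eq]; simp
  rw [this, this]

/-- Relabel two alternatives. -/
def sw (a b : Fin k) (τ : Equiv.Perm (Fin k)) : Equiv.Perm (Fin k) := Equiv.swap a b * τ

lemma sw_invol (a b : Fin k) : Function.Involutive (sw a b) := by
  intro τ; simp [sw]

lemma above_sw (a b : Fin k) (τ : Equiv.Perm (Fin k)) (c d : Fin k) :
    Above (sw a b τ) c d ↔ Above τ (Equiv.swap a b c) (Equiv.swap a b d) := by
  have := above_mul (Equiv.swap a b) τ (Equiv.swap a b c) (Equiv.swap a b d)
  simpa [sw] using this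

lemma above_sw_self {a b : Fin k} (h : a ≠ b) (τ : Equiv.Perm (Fin k)) :
    Above (sw a b τ) a b ↔ ¬ Above τ a b := by
  rw [above_sw, not_above h]; simp

/-- The first three alternatives of `τ` are `a, b, c` in this order. -/
def pat3 (a b c : Fin k) (τ : Equiv.Perm (Fin k)) : Prop :=
  (∀ x, x ≠ a → Above τ a x) ∧ (∀ x, x ≠ a → x ≠ b → Above τ b x) ∧
    (∀ x, x ≠ a → x ≠ b → x ≠ c → Above τ c x)

lemma pat3_mul (g τ : Equiv.Perm (Fin k)) (a b c : Fin k) (h : pat3 a b c τ) :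
    pat3 (g a) (g b) (g c) (g * τ) := by
  obtain ⟨h1, h2, h3⟩ := h
  have key : ∀ x, ∃ y, x = g y := fun x => ⟨g.symm x, by simp⟩
  refine ⟨fun x hx => ?_, fun x hx hx' => ?_, fun x hx hx' hx'' => ?_⟩
  all_goals
    obtain ⟨y, rfl⟩ := key x
    rw [above_mul]
    simp only [ne_eq, EmbeddingLike.apply_eq_iff_eq] at *
    tauto

lemma pat3_sw (u v a b c : Fin k) (τ : Equiv.Perm (Fin k)) (h : pat3 a b c τ) :
    pat3 (Equiv.swap u v a) (Equiv.swap u v b) (Equiv.swap u v c) (sw u v τ) :=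
  pat3_mul _ τ a b c h

lemma pat3_exists (hk : 3 ≤ k) (τ : Equiv.Perm (Fin k)) :
    ∃ a b c, (a ≠ b ∧ a ≠ c ∧ b ≠ c) ∧ pat3 a b c τ := by
  refine ⟨τ ⟨0, by omega⟩, τ ⟨1, by omega⟩, τ ⟨2, by omega⟩, ?_, ?_⟩
  · simp
  · have key : ∀ x, ∃ y, x = τ y := fun x => ⟨τ.symm x, by simp⟩
    refine ⟨fun x hx => ?_, fun x hx hx' => ?_, fun x hx hx' hx'' => ?_⟩
    all_goals
      obtain ⟨⟨y, hy⟩, rfl⟩ := key x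
      simp [Above, Fin.ext_iff] at *
      omega

lemma pat3_eq (hk : 3 ≤ k) {a b c a' b' c' : Fin k} (h : a ≠ b ∧ a ≠ c ∧ b ≠ c)
    (h' : a' ≠ b' ∧ a' ≠ c' ∧ b' ≠ c') : prob (pat3 a b c) ≤ prob (pat3 a' b' c') := by
  have inj : ∀ {a b c : Fin k}, (a ≠ b ∧ a ≠ c ∧ b ≠ c) → Function.Injective ![a, b, c] := by
    rintro a b c ⟨h1, h2, h3⟩ x y hxy
    fin_cases x <;> fin_cases y <;> simp_all
  obtain ⟨g, hg⟩ := (Equiv.Perm.isMultiplyPretransitive (Fin k) 3).exists_smul_eq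
    ⟨![a, b, c], inj h⟩ ⟨![a', b', c'], inj h'⟩
  have e0 : g a = a' := by simpa using congrArg (fun f => f 0) hg
  have e1 : g b = b' := by simpa using congrArg (fun f => f 1) hg
  have e2 : g c = c' := by simpa using congrArg (fun f => f 2) hg
  rw [← prob_equiv (Equiv.mulLeft g) (pat3 a' b' c')]
  apply prob_mono
  intro τ hτ
  have := pat3_mul g τ a b c hτ
  rw [e0, e1, e2] at this
  exact this

lemma pat3_prob (hk : 3 ≤ k) {a b c : Fin k} (h : a ≠ b ∧ a ≠ c ∧ b ≠ c) :
    1 / (k:ℝ)^3 ≤ prob (pat3 a b c) := by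
  have hk0 : (0:ℝ) < k := by exact_mod_cast (by omega : 0 < k)
  have h1 : (1:ℝ) ≤ ∑ t : Fin k × Fin k × Fin k,
      prob (fun τ => (t.1 ≠ t.2.1 ∧ t.1 ≠ t.2.2 ∧ t.2.1 ≠ t.2.2) ∧ pat3 t.1 t.2.1 t.2.2 τ) := by
    rw [← prob_one (Ω := Equiv.Perm (Fin k)) (p := fun _ => True) (fun _ => trivial)]
    apply prob_exists_le
    intro τ _
    obtain ⟨a, b, c, h⟩ := pat3_exists hk τ
    exact ⟨(a, b, c), mem_univ _, h⟩
  have h2 : ∀ t : Fin k × Fin k × Fin k,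
      prob (fun τ => (t.1 ≠ t.2.1 ∧ t.1 ≠ t.2.2 ∧ t.2.1 ≠ t.2.2) ∧ pat3 t.1 t.2.1 t.2.2 τ) ≤
      prob (pat3 a b c) := by
    rintro ⟨x, y, z⟩
    by_cases hd : x ≠ y ∧ x ≠ z ∧ y ≠ z
    · exact (prob_mono fun τ hτ => hτ.2).trans (pat3_eq hk hd h)
    · rw [prob_zero (fun τ hτ => hd hτ.1)]; exact prob_nonneg _
  have h3 := h1.trans (Finset.sum_le_sum fun t _ => h2 t)
  simp at h3
  rw [div_le_iff₀ (by positivity)]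
  linarith

lemma top_prob (hk : 3 ≤ k) (a : Fin k) :
    1 / (k:ℝ) ≤ prob (fun τ : Equiv.Perm (Fin k) => τ ⟨0, by omega⟩ = a) := by
  have hk0 : (0:ℝ) < k := by exact_mod_cast (by omega : 0 < k)
  have h1 : (1:ℝ) ≤ ∑ t : Fin k, prob (fun τ : Equiv.Perm (Fin k) => τ ⟨0, by omega⟩ = t) := by
    rw [← prob_one (Ω := Equiv.Perm (Fin k)) (p := fun _ => True) (fun _ => trivial)]
    apply prob_exists_le
    intro τ _
    exact ⟨_, mem_univ _, rfl⟩
  have h2 : ∀ t : Fin k, prob (fun τ : Equiv.Perm (Fin k) => τ ⟨0, by omega⟩ = t) ≤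
      prob (fun τ : Equiv.Perm (Fin k) => τ ⟨0, by omega⟩ = a) := by
    intro t
    rw [← prob_equiv (Equiv.mulLeft (Equiv.swap t a))
      (fun τ : Equiv.Perm (Fin k) => τ ⟨0, by omega⟩ = a)]
    apply prob_mono
    intro τ hτ
    simp [hτ]
  have h3 := h1.trans (Finset.sum_le_sum fun t _ => h2 t)
  simp at h3
  rw [div_le_iff₀ (by positivity)]
  linarith

lemma above_half {a b : Fin k} (h : a ≠ b) :
    prob (fun τ : Equiv.Perm (Fin k) => Above τ a b) = 1/2 := by
  have h1 := prob_invol (sw a b) (sw_invol a b) (fun τ => Above τ a b)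
  rw [prob_congr (above_sw_self h), prob_not] at h1
  linarith

lemma above_quarter {a b c d : Fin k} (hab : a ≠ b) (hcd : c ≠ d) (h1 : a ≠ c) (h2 : a ≠ d)
    (h3 : b ≠ c) (h4 : b ≠ d) :
    prob (fun τ : Equiv.Perm (Fin k) => Above τ a b ∧ Above τ c d) = 1/4 := by
  have e1 := prob_invol (sw a b) (sw_invol a b) (fun τ => Above τ a b ∧ Above τ c d)
  have e2 : ∀ τ : Equiv.Perm (Fin k), (Above (sw a b τ) a b ∧ Above (sw a b τ) c d) ↔
      (¬ Above τ a b ∧ Above τ c d) := by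
    intro τ
    rw [above_sw_self hab, above_sw, Equiv.swap_apply_of_ne_of_ne h1.symm h3.symm,
      Equiv.swap_apply_of_ne_of_ne h2.symm h4.symm]
  rw [prob_congr e2] at e1
  have e3 := prob_split' (fun τ : Equiv.Perm (Fin k) => Above τ a b) (fun τ => Above τ c d)
  rw [above_half hcd] at e3
  linarith

lemma above_third {a b c : Fin k} (hab : a ≠ b) (hac : a ≠ c) (hbc : b ≠ c) :
    prob (fun τ : Equiv.Perm (Fin k) => Above τ a b ∧ Above τ a c) = 1/3 := by
  have e1 := prob_invol (sw a b) (sw_invol a b) (fun τ => Above τ a b ∧ Above τ a c)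
  have e2 := prob_invol (sw a c) (sw_invol a c) (fun τ => Above τ a b ∧ Above τ a c)
  simp only [above_sw, Equiv.swap_apply_left, Equiv.swap_apply_right,
    Equiv.swap_apply_of_ne_of_ne hac.symm hbc.symm, Equiv.swap_apply_of_ne_of_ne hab.symm hbc] at e1 e2
  have e3 : prob (fun τ : Equiv.Perm (Fin k) => Above τ a b ∧ Above τ a c) +
      (prob (fun τ : Equiv.Perm (Fin k) => Above τ b a ∧ Above τ b c) +
      prob (fun τ : Equiv.Perm (Fin k) => Above τ c b ∧ Above τ c a)) = 1 := by
    rw [prob_eq, prob_eq, prob_eq, ← avg_add, ← avg_add]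
    rw [← avg_const (Ω := Equiv.Perm (Fin k)) 1]
    congr 1; funext τ
    have n1 := not_above (τ := τ) hab
    have n2 := not_above (τ := τ) hac
    have n3 := not_above (τ := τ) hbc
    have t1 := @above_trans k τ a b c
    have t2 := @above_trans k τ c b a
    by_cases x1 : Above τ a b <;> by_cases x2 : Above τ a c <;> by_cases x3 : Above τ b c <;>
      simp_all [ind]
  linarith
end


section
variable {k : ℕ}

/-- `y` is the top alternative of `H` in `τ`. -/
def Tp (H : Finset (Fin k)) (τ : Equiv.Perm (Fin k)) (y : Fin k) : Prop :=
  y ∈ H ∧ ∀ b ∈ H, b ≠ y → Above τ y b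

/-- One-voter manipulation point by an adjacent swap. -/
def Mp (h : Equiv.Perm (Fin k) → Fin k) (τ : Equiv.Perm (Fin k)) : Prop :=
  ∃ p q : Fin k, q.val = p.val + 1 ∧ Above τ (h (τ * Equiv.swap p q)) (h τ)

variable (h : Equiv.Perm (Fin k) → Fin k)

lemma edge {τ : Equiv.Perm (Fin k)} {p q : Fin k} (hpq : q.val = p.val + 1)
    (h1 : ¬ Mp h τ) (h2 : ¬ Mp h (τ * Equiv.swap p q)) (hne : h τ ≠ h (τ * Equiv.swap p q)) :
    h τ = τ p ∧ h (τ * Equiv.swap p q) = τ q := by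
  have a1 : ¬ Above τ (h (τ * Equiv.swap p q)) (h τ) := fun hh => h1 ⟨p, q, hpq, hh⟩
  have a2 : ¬ Above (τ * Equiv.swap p q) (h τ) (h (τ * Equiv.swap p q)) := fun hh =>
    h2 ⟨p, q, hpq, by rw [mul_assoc, Equiv.swap_mul_self, mul_one]; exact hh⟩
  rw [not_above hne.symm] at a1
  rw [not_above hne] at a2
  generalize h (τ * Equiv.swap p q) = w at *
  generalize h τ = y at *
  obtain ⟨P, rfl⟩ : ∃ P, y = τ P := ⟨τ.symm y, by simp⟩
  obtain ⟨Q, rfl⟩ : ∃ Q, w = τ Q := ⟨τ.symm w, by simp⟩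
  have e : ∀ R, (τ * Equiv.swap p q).symm (τ R) = Equiv.swap p q R := by
    intro R; rw [Equiv.symm_apply_eq]; simp
  unfold Above at a1 a2
  rw [e, e] at a2
  simp only [Equiv.symm_apply_apply] at a1
  rw [Equiv.swap_apply_def, Equiv.swap_apply_def] at a2
  have : P = p ∧ Q = q := by
    split_ifs at a2 <;> simp only [Fin.ext_iff, Fin.lt_def] at * <;> omega
  rw [this.1, this.2]; exact ⟨rfl, rfl⟩

lemma mp_two (p q : Fin k) :
    prob (fun τ => Mp h τ ∨ Mp h (τ * Equiv.swap p q)) ≤ 2 * prob (Mp h) := by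
  refine (prob_or_le _ _).trans ?_
  have := prob_equiv (Equiv.mulRight (Equiv.swap p q)) (Mp h)
  simp only [Equiv.coe_mulRight] at this
  linarith

/-- Instability of the event `h = a` under right multiplication, when `a` is on top. -/
noncomputable def psi (o a : Fin k) (π : Equiv.Perm (Fin k)) : ℝ :=
  prob (fun τ : Equiv.Perm (Fin k) => τ o = a ∧ ¬ (h τ = a ↔ h (τ * π) = a))

lemma psi_mul (o a : Fin k) (π₁ π₂ : Equiv.Perm (Fin k)) (h1 : π₁ o = o) :
    psi h o a (π₁ * π₂) ≤ psi h o a π₁ + psi h o a π₂ := by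
  have e : psi h o a π₂ = prob (fun τ : Equiv.Perm (Fin k) => τ o = a ∧
      ¬ (h (τ * π₁) = a ↔ h (τ * π₁ * π₂) = a)) := by
    unfold psi
    rw [← prob_equiv (Equiv.mulRight π₁)]
    apply prob_congr
    intro τ
    simp [h1]
  rw [e]
  apply prob_le_add
  intro τ
  rw [← mul_assoc]
  tauto

lemma psi_adj (o a p q : Fin k) (hpq : q.val = p.val + 1) (hp : p ≠ o) (hq : q ≠ o) :
    psi h o a (Equiv.swap p q) ≤ 2 * prob (Mp h) := by
  refine le_trans (prob_mono ?_) (mp_two h p q)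
  rintro τ ⟨h1, h2⟩
  by_contra hc
  push Not at hc
  have := edge h hpq hc.1 hc.2 (fun hh => h2 (by rw [hh]))
  rw [this.1, this.2, ← h1] at h2
  simp [hp, hq] at h2

lemma psi_swap (a : Fin k) (o : Fin k) (ho : o.val = 0) (d : ℕ) : ∀ (x y : Fin k), x ≠ o → 
    y.val = x.val + 1 + d → psi h o a (Equiv.swap x y) ≤ (2 * d + 1) * (2 * prob (Mp h)) := by
  induction d with
  | zero =>
    intro x y hx hy
    have := psi_adj h o a x y hy hx (by rw [Ne, Fin.ext_iff]; omega)
    simpa using this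
  | succ d ih =>
    intro x y hx hy
    let y' : Fin k := ⟨x.val + 1 + d, by have := y.2; omega⟩
    have i1 := ih x y' hx rfl
    have hx0 : x.val ≠ 0 := fun hh => hx (Fin.ext (by omega))
    have hy'o : y' ≠ o := by rw [Ne, Fin.ext_iff]; simp [y']; omega
    have hyo : y ≠ o := by rw [Ne, Fin.ext_iff]; omega
    have i2 := psi_adj h o a y' y (by simp [y']; omega) hy'o hyo
    have hxy' : x ≠ y' := by rw [Ne, Fin.ext_iff]; simp [y']; omega
    have hxy : x ≠ y := by rw [Ne, Fin.ext_iff]; omega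
    have e : Equiv.swap x y = Equiv.swap y' y * (Equiv.swap x y' * Equiv.swap y' y) := by
      ext t
      simp only [Equiv.Perm.mul_apply, Equiv.swap_apply_def]
      split_ifs <;> simp_all
    rw [e]
    have j1 := psi_mul h o a (Equiv.swap y' y) (Equiv.swap x y' * Equiv.swap y' y)
      (Equiv.swap_apply_of_ne_of_ne hy'o.symm hyo.symm)
    have j2 := psi_mul h o a (Equiv.swap x y') (Equiv.swap y' y)
      (Equiv.swap_apply_of_ne_of_ne hx.symm hy'o.symm)
    push_cast
    linarith

lemma psi_swap' (a : Fin k) (o : Fin k) (ho : o.val = 0) (x y : Fin k) (hx : x ≠ o) (hy : y ≠ o)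
    (hxy : x ≠ y) : psi h o a (Equiv.swap x y) ≤ 4 * k * prob (Mp h) := by
  wlog hlt : x < y generalizing x y
  · rw [Equiv.swap_comm]
    exact this y x hy hx hxy.symm (lt_of_le_of_ne (not_lt.1 hlt) hxy.symm)
  have := psi_swap h a o ho (y.val - (x.val + 1)) x y hx (by rw [Fin.lt_def] at hlt; omega)
  refine this.trans ?_
  have e : 2 * ((y.val - (x.val + 1) : ℕ) : ℝ) + 1 ≤ 2 * k := by
    have : 2 * (y.val - (x.val + 1)) + 1 ≤ 2 * k := by have := y.2; omega
    exact_mod_cast this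
  have := prob_nonneg (Mp h)
  nlinarith

lemma psi_all (a : Fin k) (o : Fin k) (ho : o.val = 0) (m : ℕ) : ∀ π : Equiv.Perm (Fin k),
    π o = o → π.support.card ≤ m → psi h o a π ≤ m * (4 * k * prob (Mp h)) := by
  induction m with
  | zero =>
    intro π _ hm
    have : π = 1 := by
      rw [← Equiv.Perm.support_eq_empty_iff]; exact Finset.card_eq_zero.1 (by omega)
    subst this
    unfold psi
    rw [prob_zero (by simp)]; simp
  | succ m ih =>
    intro π ho' hm
    by_cases h1 : π = 1
    · subst h1
      unfold psi
      rw [prob_zero (by simp)]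
      have := prob_nonneg (Mp h)
      positivity
    · obtain ⟨x, hx⟩ : ∃ x, π x ≠ x := by
        by_contra hc; push Not at hc; exact h1 (Equiv.ext hc)
      have hlt := Equiv.Perm.card_support_swap_mul hx
      have hxo : x ≠ o := fun hh => hx (by rw [hh, ho'])
      have hpo : π x ≠ o := fun hh => hxo (π.injective (by rw [hh, ho']))
      have so : Equiv.swap x (π x) o = o := Equiv.swap_apply_of_ne_of_ne hxo.symm hpo.symm
      have i1 := ih (Equiv.swap x (π x) * π) (by simp [ho', so]) (by omega)
      have i2 := psi_swap' h a o ho x (π x) hxo hpo hx.symm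
      have e : π = Equiv.swap x (π x) * (Equiv.swap x (π x) * π) := by simp
      have i3 := psi_mul h o a (Equiv.swap x (π x)) (Equiv.swap x (π x) * π) so
      rw [← e] at i3
      push_cast
      linarith

lemma zero_one (a o : Fin k) (ho : o.val = 0) :
    prob (fun τ : Equiv.Perm (Fin k) => τ o = a ∧ h τ = a) *
      prob (fun τ : Equiv.Perm (Fin k) => τ o = a ∧ h τ ≠ a) ≤ 4 * k^2 * prob (Mp h) := by
  have hp := prob_nonneg (Mp h)
  have e1 : prob (fun τ : Equiv.Perm (Fin k) => τ o = a ∧ h τ = a) *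
      prob (fun τ : Equiv.Perm (Fin k) => τ o = a ∧ h τ ≠ a) ≤
      prob (fun y : Equiv.Perm (Fin k) × Equiv.Perm (Fin k) => (y.1 o = a ∧ h y.1 = a) ∧
        ((y.1 * y.2) o = a ∧ h (y.1 * y.2) ≠ a)) := by
    apply prob_and_ge (fun τ => τ o = a ∧ h τ = a)
      (fun τ π => (τ * π) o = a ∧ h (τ * π) ≠ a)
    intro τ _
    exact (prob_equiv (Equiv.mulLeft τ) (fun τ => τ o = a ∧ h τ ≠ a)).ge
  refine e1.trans ?_
  rw [prob_prod', ← avg_const (Ω := Equiv.Perm (Fin k)) (4 * k^2 * prob (Mp h))]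
  apply avg_mono
  intro π
  by_cases hπ : π o = o
  · have := psi_all h a o ho k π hπ (by simpa using Finset.card_le_univ π.support)
    refine le_trans (prob_mono ?_) (this.trans (le_of_eq (by ring)))
    rintro τ ⟨⟨h1, h2⟩, h3, h4⟩
    refine ⟨h1, ?_⟩
    simp [h2, h4]
  · rw [prob_zero]
    · positivity
    · rintro τ ⟨⟨h1, h2⟩, h3, h4⟩
      apply hπ
      apply τ.injective
      simp only [Equiv.Perm.mul_apply] at h3
      rw [h1, h3]

lemma raise_self (a o : Fin k) (ho : o.val = 0) (m : ℕ) : ∀ (q : Fin k), q.val = m →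
    prob (fun τ : Equiv.Perm (Fin k) => τ q = a ∧ h τ = a) ≤
      prob (fun τ : Equiv.Perm (Fin k) => τ o = a ∧ h τ = a) + m * (2 * prob (Mp h)) := by
  induction m with
  | zero => intro q hq; rw [show q = o from Fin.ext (by omega)]; simp
  | succ m ih =>
    intro q hq
    let p : Fin k := ⟨m, by have := q.2; omega⟩
    have i1 := ih p rfl
    have i2 := mp_two h p q
    have e := prob_equiv (Equiv.mulRight (Equiv.swap p q))
      (fun τ : Equiv.Perm (Fin k) => τ p = a ∧ h τ = a)
    have : prob (fun τ : Equiv.Perm (Fin k) => τ q = a ∧ h τ = a) ≤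
      prob (fun τ => Mp h τ ∨ Mp h (τ * Equiv.swap p q)) +
      prob (fun τ : Equiv.Perm (Fin k) => (Equiv.mulRight (Equiv.swap p q) τ) p = a ∧
        h (Equiv.mulRight (Equiv.swap p q) τ) = a) := by
      apply prob_le_add
      rintro τ ⟨h1, h2⟩
      by_contra hc
      push Not at hc
      obtain ⟨⟨c1, c2⟩, c3⟩ := hc
      have c4 := c3 (by simp [h1])
      simp only [Equiv.coe_mulRight] at c4
      have := edge h (p := p) (q := q) (by simp [p, hq]) c1 c2 (by rw [h2]; exact c4.symm)
      rw [h2, ← h1] at this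
      have := τ.injective this.1
      rw [Fin.ext_iff] at this; simp [p] at this; omega
    push_cast
    linarith

lemma raise_other (a b o : Fin k) (ho : o.val = 0) (m : ℕ) : ∀ (q : Fin k), q.val = m →
    prob (fun τ : Equiv.Perm (Fin k) => τ q = a ∧ h τ = b ∧ Above τ a b) ≤
      prob (fun τ : Equiv.Perm (Fin k) => τ o = a ∧ h τ = b ∧ Above τ a b) +
        m * (2 * prob (Mp h)) := by
  induction m with
  | zero => intro q hq; rw [show q = o from Fin.ext (by omega)]; simp
  | succ m ih =>
    intro q hq
    let p : Fin k := ⟨m, by have := q.2; omega⟩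
    have i1 := ih p rfl
    have i2 := mp_two h p q
    have e := prob_equiv (Equiv.mulRight (Equiv.swap p q))
      (fun τ : Equiv.Perm (Fin k) => τ p = a ∧ h τ = b ∧ Above τ a b)
    have : prob (fun τ : Equiv.Perm (Fin k) => τ q = a ∧ h τ = b ∧ Above τ a b) ≤
      prob (fun τ => Mp h τ ∨ Mp h (τ * Equiv.swap p q)) +
      prob (fun τ : Equiv.Perm (Fin k) => (Equiv.mulRight (Equiv.swap p q) τ) p = a ∧
        h (Equiv.mulRight (Equiv.swap p q) τ) = b ∧
        Above (Equiv.mulRight (Equiv.swap p q) τ) a b) := by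
      apply prob_le_add
      rintro τ ⟨h1, h2, h3⟩
      by_cases hc : Mp h τ ∨ Mp h (τ * Equiv.swap p q)
      · exact Or.inl hc
      right
      push Not at hc
      obtain ⟨c1, c2⟩ := hc
      simp only [Equiv.coe_mulRight]
      obtain ⟨Q, rfl⟩ : ∃ Q, b = τ Q := ⟨τ.symm b, by simp⟩
      subst h1
      have hqQ : q < Q := by simpa [Above] using h3
      have hQp : Q ≠ p := by rw [Ne, Fin.ext_iff]; rw [Fin.lt_def] at hqQ; simp [p]; omega
      refine ⟨by simp, ?_, ?_⟩
      · by_contra hne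
        have := edge h (p := p) (q := q) (by simp [p, hq]) c1 c2 (by rw [h2]; exact Ne.symm hne)
        rw [h2] at this
        exact hQp (τ.injective this.1)
      · have e : ∀ R, (τ * Equiv.swap p q).symm (τ R) = Equiv.swap p q R := by
          intro R; rw [Equiv.symm_apply_eq]; simp
        unfold Above
        rw [e, e, Equiv.swap_apply_right, Equiv.swap_apply_of_ne_of_ne hQp hqQ.ne']
        rw [Fin.lt_def] at *; simp [p]; omega
    push_cast
    linarith

theorem one_voter (hk : 3 ≤ k) :
    ∃ H : Finset (Fin k), prob (fun τ => ¬ Tp H τ (h τ)) ≤ 20 * k^6 * prob (Mp h) := by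
  classical
  have hk0 : (0:ℝ) < k := by exact_mod_cast (by omega : 0 < k)
  have hk1 : (1:ℝ) ≤ k := by exact_mod_cast (by omega : 1 ≤ k)
  have hp := prob_nonneg (Mp h)
  set p := prob (Mp h)
  let o : Fin k := ⟨0, by omega⟩
  have ho : o.val = 0 := rfl
  let α : Fin k → ℝ := fun a => prob (fun τ : Equiv.Perm (Fin k) => τ o = a ∧ h τ = a)
  let β : Fin k → ℝ := fun a => prob (fun τ : Equiv.Perm (Fin k) => τ o = a ∧ h τ ≠ a)
  have hα : ∀ a, 0 ≤ α a := fun a => prob_nonneg _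
  have hβ : ∀ a, 0 ≤ β a := fun a => prob_nonneg _
  have hab : ∀ a, 1 / (k:ℝ) ≤ α a + β a := by
    intro a
    have := prob_split (fun τ : Equiv.Perm (Fin k) => τ o = a) (fun τ => h τ = a)
    have t := top_prob hk a
    simp only [α, β, ne_eq]
    rw [this]; exact t
  have hprod : ∀ a, α a * β a ≤ 4 * k^2 * p := fun a => zero_one h a o ho
  have small : ∀ x y : ℝ, 0 ≤ x → 0 ≤ y → 1/(k:ℝ) ≤ x + y → x * y ≤ 4 * k^2 * p → x ≤ y →
      x ≤ 8 * k^3 * p := by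
    intro x y hx hy h1 h2 h3
    have h4 : 1 / (k:ℝ) ≤ 2 * y := by linarith
    rw [div_le_iff₀ hk0] at h4
    have h5 : x ≤ x * (2 * y * k) := le_mul_of_one_le_right hx h4
    have h6 : 2 * k * (x * y) ≤ 2 * k * (4 * k^2 * p) := by gcongr
    linarith
  let H : Finset (Fin k) := univ.filter (fun a => β a ≤ α a)
  have hH : ∀ a ∈ H, β a ≤ 8 * k^3 * p := by
    intro a ha
    have : β a ≤ α a := by simpa [H] using ha
    exact small _ _ (hβ a) (hα a) (by linarith [hab a]) (by linarith [hprod a]) this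
  have hH' : ∀ a, a ∉ H → α a ≤ 8 * k^3 * p := by
    intro a ha
    have : α a < β a := by simpa [H] using ha
    exact small _ _ (hα a) (hβ a) (hab a) (hprod a) this.le
  have mk : ∀ q : Fin k, (q.val : ℝ) * (2 * p) ≤ k * (2 * p) := by
    intro q
    have : (q.val : ℝ) ≤ k := by exact_mod_cast q.2.le
    gcongr
  have big : k * (8 * k^3 * p + k * (2 * p)) ≤ 10 * k^4 * p := by
    have : (k:ℝ)^2 * p ≤ k^4 * p := by gcongr <;> norm_num [hk1]
    nlinarith
  have A1 : ∀ b, b ∉ H → prob (fun τ => h τ = b) ≤ 10 * k^4 * p := by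
    intro b hb
    refine le_trans ?_ big
    have : prob (fun τ => h τ = b) ≤
        ∑ q : Fin k, prob (fun τ : Equiv.Perm (Fin k) => τ q = b ∧ h τ = b) :=
      prob_exists_le _ fun τ hτ => ⟨τ.symm b, mem_univ _, by simp [hτ]⟩
    refine this.trans ?_
    have : ∀ q ∈ (univ : Finset (Fin k)),
        prob (fun τ : Equiv.Perm (Fin k) => τ q = b ∧ h τ = b) ≤ 8 * k^3 * p + k * (2 * p) := by
      intro q _
      have := raise_self h b o ho q.val q rfl
      linarith [hH' b hb, mk q]
    refine (Finset.sum_le_sum this).trans (le_of_eq ?_)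
    simp
    ring
  have A2 : ∀ a b, a ∈ H → a ≠ b → prob (fun τ => h τ = b ∧ Above τ a b) ≤ 10 * k^4 * p := by
    intro a b ha hne
    refine le_trans ?_ big
    have : prob (fun τ => h τ = b ∧ Above τ a b) ≤
        ∑ q : Fin k, prob (fun τ : Equiv.Perm (Fin k) => τ q = a ∧ h τ = b ∧ Above τ a b) :=
      prob_exists_le _ fun τ hτ => ⟨τ.symm a, mem_univ _, by simp [hτ.1, hτ.2]⟩
    refine this.trans ?_
    have : ∀ q ∈ (univ : Finset (Fin k)),
        prob (fun τ : Equiv.Perm (Fin k) => τ q = a ∧ h τ = b ∧ Above τ a b)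
          ≤ 8 * k^3 * p + k * (2 * p) := by
      intro q _
      have := raise_other h a b o ho q.val q rfl
      have e : prob (fun τ : Equiv.Perm (Fin k) => τ o = a ∧ h τ = b ∧ Above τ a b) ≤ β a :=
        prob_mono fun τ hτ => ⟨hτ.1, by rw [hτ.2.1]; exact hne.symm⟩
      linarith [hH a ha, mk q]
    refine (Finset.sum_le_sum this).trans (le_of_eq ?_)
    simp
    ring
  refine ⟨H, ?_⟩
  have B1 : prob (fun τ => ¬ Tp H τ (h τ)) ≤ prob (fun τ => h τ ∉ H) +
      prob (fun τ => ∃ a ∈ H, a ≠ h τ ∧ Above τ a (h τ)) := by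
    apply prob_le_add
    intro τ hτ
    unfold Tp at hτ
    by_cases h1 : h τ ∈ H
    · right
      push Not at hτ
      obtain ⟨a, ha, hne, h2⟩ := hτ h1
      exact ⟨a, ha, hne, (not_above hne.symm).1 h2⟩
    · exact Or.inl h1
  have B2 : prob (fun τ => h τ ∉ H) ≤ ∑ b : Fin k, 10 * k^4 * p := by
    refine (prob_exists_le (univ.filter (fun b => b ∉ H)) (q := fun b τ => h τ = b) ?_).trans ?_
    · intro τ hτ; exact ⟨h τ, by simp [hτ], rfl⟩
    · refine (Finset.sum_le_sum (fun b hb => A1 b (by simpa using hb))).trans ?_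
      exact Finset.sum_le_sum_of_subset_of_nonneg (Finset.filter_subset _ _)
        (fun _ _ _ => by positivity)
  have B3 : prob (fun τ => ∃ a ∈ H, a ≠ h τ ∧ Above τ a (h τ)) ≤
      ∑ t : Fin k × Fin k, 10 * k^4 * p := by
    refine (prob_exists_le (univ.filter (fun t : Fin k × Fin k => t.1 ∈ H ∧ t.1 ≠ t.2))
      (q := fun t τ => h τ = t.2 ∧ Above τ t.1 t.2) ?_).trans ?_
    · rintro τ ⟨a, ha, hne, h2⟩; exact ⟨(a, h τ), by simp [ha, hne], rfl, h2⟩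
    · refine (Finset.sum_le_sum (fun t ht => ?_)).trans
        (Finset.sum_le_sum_of_subset_of_nonneg (Finset.filter_subset _ _)
        (fun _ _ _ => by positivity))
      simp at ht
      exact A2 t.1 t.2 ht.1 ht.2
  simp at B2 B3
  have : (k:ℝ)^5 * p ≤ k^6 * p := by gcongr <;> norm_num [hk1]
  nlinarith
end


set_option linter.unusedSectionVars false

section
variable {n k : ℕ}

/-- Choice of the one-voter structure in every section. -/
lemma sections_exist (f : Profile n k → Fin k) (hk : 3 ≤ k) :
    ∃ H : Fin n → Profile n k → Finset (Fin k),
      (∀ i ω τ, H i (Function.update ω i τ) = H i ω) ∧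
      ∀ i, prob (fun ω : Profile n k => ¬ Tp (H i ω) (ω i) (f ω)) ≤
        20 * k^6 * prob (fun σ : Profile n k => IsManipPointR 4 f σ) := by
  choose Hof hHof using fun h : Equiv.Perm (Fin k) → Fin k => one_voter h hk
  refine ⟨fun i ω => Hof (fun τ => f (Function.update ω i τ)), ?_, ?_⟩
  · intro i ω τ
    simp only [Function.update_idem]
  · intro i
    rw [← prob_update (X := Equiv.Perm (Fin k)) i
      (fun ω : Profile n k => ¬ Tp (Hof (fun τ => f (Function.update ω i τ))) (ω i) (f ω))]
    rw [← prob_update (X := Equiv.Perm (Fin k)) i (fun σ : Profile n k => IsManipPointR 4 f σ)]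
    rw [prob_prod, prob_prod (fun y : Profile n k × Equiv.Perm (Fin k) =>
      IsManipPointR 4 f (Function.update y.1 i y.2)), ← avg_mul_left]
    apply avg_mono
    intro ω
    simp only [Function.update_idem, Function.update_self]
    refine (hHof _).trans ?_
    have hk0 : (0:ℝ) ≤ 20 * k^6 := by positivity
    refine mul_le_mul_of_nonneg_left ?_ hk0
    apply prob_mono
    rintro τ ⟨p, q, hpq, hab⟩
    refine ⟨Function.update ω i (τ * Equiv.swap p q), i, ⟨?_, ?_, ?_⟩, ?_⟩
    · simp only [Function.update_self]
      intro h
      rw [← h] at hab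
      exact above_irrefl _ _ hab
    · intro j hj
      simp [hj]
    · simpa using hab
    · refine ⟨p.val, fun r hr => ?_⟩
      simp only [Function.update_self, Equiv.Perm.mul_apply]
      rw [Equiv.swap_apply_of_ne_of_ne]
      · rintro rfl; omega
      · rintro rfl; omega

/-- `b` is first; and `x` beats everything except `b`. -/
def top2 (b x : Fin k) (τ : Equiv.Perm (Fin k)) : Prop :=
  (∀ y, y ≠ b → Above τ b y) ∧ (∀ y, y ≠ b → y ≠ x → Above τ x y)

lemma exists_third (hk : 3 ≤ k) (a b : Fin k) : ∃ c, c ≠ a ∧ c ≠ b := by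
  have : ∃ c ∈ (univ : Finset (Fin k)), c ∉ ({a, b} : Finset (Fin k)) := by
    apply Finset.exists_mem_notMem_of_card_lt_card
    have := Finset.card_le_two (a := a) (b := b)
    simp; omega
  obtain ⟨c, _, hc⟩ := this
  simp at hc
  exact ⟨c, hc⟩

lemma top2_prob (hk : 3 ≤ k) (b x : Fin k) : 1 / (k:ℝ)^3 ≤ prob (top2 b x) := by
  by_cases h : x = b
  · obtain ⟨c, hc, _⟩ := exists_third hk b b
    obtain ⟨d, hd, hd'⟩ := exists_third hk b c
    refine (pat3_prob hk (a := b) (b := c) (c := d) ⟨hc.symm, hd.symm, hd'.symm⟩).trans ?_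
    apply prob_mono
    rintro τ ⟨h1, h2, h3⟩
    subst h
    exact ⟨h1, fun y hy _ => h1 y hy⟩
  · obtain ⟨d, hd, hd'⟩ := exists_third hk b x
    refine (pat3_prob hk (a := b) (b := x) (c := d) ⟨Ne.symm h, hd.symm, hd'.symm⟩).trans ?_
    apply prob_mono
    rintro τ ⟨h1, h2, h3⟩
    exact ⟨h1, h2⟩

lemma prob_13 {A B C : Type*} [Fintype A] [Fintype B] [Fintype C] [Nonempty B]
    (q : A × C → Prop) : prob (fun y : (A × B) × C => q (y.1.1, y.2)) = prob q := by
  rw [prob_prod, prob_prod, avg_prod]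
  congr 1; funext x
  exact avg_const (Ω := B) (prob fun y => q (x, y))

lemma prob_indep_pair {X Y : Type*} [Fintype X] [Fintype Y] [Nonempty X] (i : Fin n)
    (E : (Fin n → X) × Y → Prop) (P : X → Prop)
    (hE : ∀ w x y, E (Function.update w i x, y) ↔ E (w, y)) :
    prob (fun w : (Fin n → X) × Y => E w ∧ P (w.1 i)) = prob E * prob P := by
  rw [prob_prod', prob_prod' E, ← avg_mul_right]
  congr 1; funext y
  exact prob_indep i (fun w => E (w, y)) P (fun w x => hE w x y)

section core
variable (f : Profile n k → Fin k) (H : Fin n → Profile n k → Finset (Fin k))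

/-- Good point for voter `i`. -/
def Ok (i : Fin n) (ω : Profile n k) : Prop := Tp (H i ω) (ω i) (f ω)

/-- Apply a map to the ranking of voter `i`. -/
def app (i : Fin n) (g : Equiv.Perm (Fin k) → Equiv.Perm (Fin k)) (ω : Profile n k) :
    Profile n k := Function.update ω i (g (ω i))

/-- Bad points. -/
def Bad (i j : Fin n) (a b : Fin k) (ω : Profile n k) : Prop :=
  (¬ Ok f H i ω ∨ ¬ Ok f H j ω) ∨ (¬ Ok f H i (app i (sw a b) ω) ∨ ¬ Ok f H j (app i (sw a b) ω))

lemma bad_prob {f : Profile n k → Fin k} {H : Fin n → Profile n k → Finset (Fin k)} {e : ℝ}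
    (he : ∀ i, prob (fun ω => ¬ Ok f H i ω) ≤ e) (i j : Fin n) (a b : Fin k) :
    prob (Bad f H i j a b) ≤ 4 * e := by
  have h1 := prob_or_le (fun ω => ¬ Ok f H i ω ∨ ¬ Ok f H j ω)
    (fun ω => ¬ Ok f H i (app i (sw a b) ω) ∨ ¬ Ok f H j (app i (sw a b) ω))
  have h2 := prob_or_le (fun ω => ¬ Ok f H i ω) (fun ω => ¬ Ok f H j ω)
  have h3 := prob_or_le (fun ω => ¬ Ok f H i (app i (sw a b) ω))
    (fun ω => ¬ Ok f H j (app i (sw a b) ω))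
  have h4 := prob_map_coord i (sw a b) (sw_invol a b) (fun ω => ¬ Ok f H i ω)
  have h5 := prob_map_coord i (sw a b) (sw_invol a b) (fun ω => ¬ Ok f H j ω)
  have := he i
  have := he j
  unfold Bad
  unfold app at *
  linarith

/-- Both `a` and `b` are in the menu of voter `i`. -/
def Wp (i : Fin n) (a b : Fin k) (ω : Profile n k) : Prop := a ∈ H i ω ∧ b ∈ H i ω

variable {f H}

lemma Ok.eq_of_top {i : Fin n} {ω : Profile n k} {a : Fin k} (h : Ok f H i ω) (ha : a ∈ H i ω)
    (ht : ∀ y ∈ H i ω, y ≠ a → Above (ω i) a y) : f ω = a := by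
  by_contra hne
  exact above_asymm (h.2 a ha (Ne.symm hne)) (ht _ h.1 hne)

lemma Ok.above {i : Fin n} {ω : Profile n k} {a : Fin k} (h : Ok f H i ω) (ha : a ∈ H i ω)
    (hne : a ≠ f ω) : Above (ω i) (f ω) a := h.2 a ha hne

lemma above_sw_of_ne {a b c d : Fin k} (τ : Equiv.Perm (Fin k)) (h1 : c ≠ a) (h2 : c ≠ b)
    (h3 : d ≠ a) (h4 : d ≠ b) : Above (sw a b τ) c d ↔ Above τ c d := by
  rw [above_sw, Equiv.swap_apply_of_ne_of_ne h1 h2, Equiv.swap_apply_of_ne_of_ne h3 h4]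

lemma top2_sw {a b : Fin k} {τ : Equiv.Perm (Fin k)} (hab : a ≠ b) (h : top2 a b τ) :
    top2 b a (sw a b τ) := by
  obtain ⟨h1, h2⟩ := h
  constructor
  · intro y hy
    rw [above_sw]
    simp only [Equiv.swap_apply_right]
    apply h1
    intro h
    rw [Equiv.swap_apply_eq_iff] at h
    simp at h; exact hy h
  · intro y hy hy'
    rw [above_sw, Equiv.swap_apply_of_ne_of_ne hy' hy, Equiv.swap_apply_left]
    exact h2 y hy' hy

lemma W_core (hH : ∀ i ω τ, H i (Function.update ω i τ) = H i ω) {i j : Fin n} (hij : i ≠ j)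
    {a b : Fin k} (hab : a ≠ b) (ω : Profile n k) (τ τ' : Equiv.Perm (Fin k))
    (hW : Wp H i a b ω) (hW' : ¬ Wp H i a b (Function.update ω j τ))
    (o1 : Above (ω j) b a) (o2 : Above τ b a) (hi : top2 a b (ω i))
    (ht : top2 b (f (Function.update ω j τ)) τ') :
    Bad f H i j a b ω ∨ Bad f H i j a b (Function.update ω j τ) ∨
      Bad f H i j a b (Function.update ω j τ') := by
  by_contra hbad
  unfold Bad at hbad
  push Not at hbad
  obtain ⟨⟨⟨p1i, p1j⟩, q1i, q1j⟩, ⟨⟨p2i, p2j⟩, q2i, q2j⟩, ⟨⟨p3i, p3j⟩, q3i, q3j⟩⟩ := hbad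
  have hi' := top2_sw hab hi
  -- invariance facts
  have Hi1 : H i (app i (sw a b) ω) = H i ω := hH _ _ _
  have Hi2 : H i (app i (sw a b) (Function.update ω j τ)) = H i (Function.update ω j τ) := hH _ _ _
  have Hi3 : H i (app i (sw a b) (Function.update ω j τ')) = H i (Function.update ω j τ') := hH _ _ _
  have Hj2 : H j (Function.update ω j τ) = H j ω := hH _ _ _
  have Hj3 : H j (Function.update ω j τ') = H j ω := hH _ _ _
  have comm : ∀ t, app i (sw a b) (Function.update ω j t) =
      Function.update (app i (sw a b) ω) j t := by
    intro t
    unfold app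
    rw [Function.update_of_ne hij, Function.update_comm hij]
  have HQ2 : H j (app i (sw a b) (Function.update ω j τ)) = H j (app i (sw a b) ω) := by
    rw [comm]; exact hH _ _ _
  have HQ3 : H j (app i (sw a b) (Function.update ω j τ')) = H j (app i (sw a b) ω) := by
    rw [comm]; exact hH _ _ _
  have vj : app i (sw a b) ω j = ω j := by simp [app, Ne.symm hij]
  have vi : app i (sw a b) ω i = sw a b (ω i) := by simp [app]
  have vi2 : Function.update ω j τ i = ω i := by simp [hij]
  have vi3 : Function.update ω j τ' i = ω i := by simp [hij]
  have wi2 : app i (sw a b) (Function.update ω j τ) i = sw a b (ω i) := by simp [app, hij]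
  have wj2 : app i (sw a b) (Function.update ω j τ) j = τ := by simp [app, Ne.symm hij]
  have wi3 : app i (sw a b) (Function.update ω j τ') i = sw a b (ω i) := by simp [app, hij]
  have wj3 : app i (sw a b) (Function.update ω j τ') j = τ' := by simp [app, Ne.symm hij]
  set P2 := Function.update ω j τ with hP2
  set P3 := Function.update ω j τ' with hP3
  have vj2 : P2 j = τ := by simp [hP2]
  have vj3 : P3 j = τ' := by simp [hP3]
  obtain ⟨ha, hb⟩ := hW
  have f1 : f ω = a := p1i.eq_of_top ha fun y _ hy => hi.1 y hy
  have g1 : f (app i (sw a b) ω) = b := q1i.eq_of_top (by rw [Hi1]; exact hb)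
    fun y _ hy => by rw [vi]; exact hi'.1 y hy
  have bnj : b ∉ H j ω := fun h => by
    have := p1j.above h (by rw [f1]; exact hab.symm)
    rw [f1] at this
    exact above_asymm o1 this
  have bj : b ∈ H j (app i (sw a b) ω) := by have := q1j.1; rwa [g1] at this
  have xj : f P2 ∈ H j ω := by rw [← Hj2]; exact p2j.1
  have xb : f P2 ≠ b := fun h => bnj (h ▸ xj)
  by_cases hai : a ∈ H i P2
  · have hbi : b ∉ H i P2 := fun h => hW' ⟨hai, h⟩
    have g2 : f (app i (sw a b) P2) = a := q2i.eq_of_top (by rw [Hi2]; exact hai)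
      fun y hy hya => by
        rw [wi2]
        refine hi'.2 y ?_ hya
        rintro rfl
        rw [Hi2] at hy
        exact hbi hy
    have := q2j.above (a := b) (by rw [HQ2]; exact bj) (by rw [g2]; exact hab.symm)
    rw [g2, wj2] at this
    exact above_asymm o2 this
  · have xa : f P2 ≠ a := fun h => hai (h ▸ p2i.1)
    have hbi : b ∉ H i P2 := fun h => by
      apply xb
      refine p2i.eq_of_top h fun y hy hyb => ?_
      rw [vi2]
      refine hi.2 y ?_ hyb
      rintro rfl
      exact hai hy
    have g2 : f (app i (sw a b) P2) = f P2 := by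
      refine q2i.eq_of_top (by rw [Hi2]; exact p2i.1) fun y hy hne => ?_
      rw [Hi2] at hy
      have := p2i.above hy hne
      rw [wi2]
      rw [vi2] at this
      rwa [above_sw_of_ne _ xa xb]
      · rintro rfl; exact hai hy
      · rintro rfl; exact hbi hy
    have xQ : f P2 ∈ H j (app i (sw a b) ω) := by rw [← HQ2, ← g2]; exact q2j.1
    have f3 : f P3 = f P2 := p3j.eq_of_top (by rw [Hj3]; exact xj) fun y hy hne => by
      rw [vj3]
      refine ht.2 y ?_ hne
      rintro rfl
      rw [Hj3] at hy
      exact bnj hy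
    have g3 : f (app i (sw a b) P3) = b := q3j.eq_of_top (by rw [HQ3]; exact bj) fun y _ hne => by
      rw [wj3]
      exact ht.1 y hne
    have b3 : b ∈ H i P3 := by have := q3i.1; rwa [g3, Hi3] at this
    have := p3i.above b3 (by rw [f3]; exact xb.symm)
    rw [f3, vi3] at this
    exact above_asymm this (hi.2 _ xa xb)

lemma Wp_inv (hH : ∀ i ω τ, H i (Function.update ω i τ) = H i ω) (i : Fin n) (a b : Fin k)
    (ω : Profile n k) (τ : Equiv.Perm (Fin k)) :
    Wp H i a b (Function.update ω i τ) ↔ Wp H i a b ω := by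
  unfold Wp; rw [hH]

lemma W_step (hk : 3 ≤ k) (hH : ∀ i ω τ, H i (Function.update ω i τ) = H i ω) {e : ℝ}
    (he : ∀ i, prob (fun ω => ¬ Ok f H i ω) ≤ e) {i j : Fin n} (hij : i ≠ j)
    {a b : Fin k} (hab : a ≠ b) :
    prob (fun y : Profile n k × Equiv.Perm (Fin k) =>
      Wp H i a b y.1 ∧ ¬ Wp H i a b (Function.update y.1 j y.2) ∧ Above (y.1 j) b a ∧
        Above y.2 b a) ≤ 12 * k^6 * e := by
  have hk0 : (0:ℝ) < k := by exact_mod_cast (by omega : 0 < k)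
  set E : Profile n k × Equiv.Perm (Fin k) → Prop := fun y =>
      Wp H i a b y.1 ∧ ¬ Wp H i a b (Function.update y.1 j y.2) ∧ Above (y.1 j) b a ∧
        Above y.2 b a with hE
  have h1 := prob_indep_pair i E (top2 a b) (by
    intro w x y
    simp only [hE]
    rw [Wp_inv hH, Function.update_comm hij, Wp_inv hH, Function.update_of_ne hij.symm])
  have h2 := prob_and_ge (fun y : Profile n k × Equiv.Perm (Fin k) => E y ∧ top2 a b (y.1 i))
    (fun y τ' => top2 b (f (Function.update y.1 j y.2)) τ') (1 / (k:ℝ)^3)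
    (fun y _ => top2_prob hk _ _)
  have h3 : prob (fun y : (Profile n k × Equiv.Perm (Fin k)) × Equiv.Perm (Fin k) =>
      (E y.1 ∧ top2 a b (y.1.1 i)) ∧ top2 b (f (Function.update y.1.1 j y.1.2)) y.2) ≤
      prob (fun y : (Profile n k × Equiv.Perm (Fin k)) × Equiv.Perm (Fin k) =>
        Bad f H i j a b y.1.1) +
      (prob (fun y : (Profile n k × Equiv.Perm (Fin k)) × Equiv.Perm (Fin k) =>
        Bad f H i j a b (Function.update y.1.1 j y.1.2)) +
      prob (fun y : (Profile n k × Equiv.Perm (Fin k)) × Equiv.Perm (Fin k) =>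
        Bad f H i j a b (Function.update y.1.1 j y.2))) := by
    refine (prob_le_add fun y hy => ?_).trans (add_le_add_right (prob_or_le _ _) _)
    obtain ⟨⟨⟨hW, hW', o1, o2⟩, hi⟩, ht⟩ := hy
    exact W_core hH hij hab y.1.1 y.1.2 y.2 hW hW' o1 o2 hi ht
  have hb := bad_prob he i j a b
  have e1 : prob (fun y : (Profile n k × Equiv.Perm (Fin k)) × Equiv.Perm (Fin k) =>
        Bad f H i j a b y.1.1) = prob (Bad f H i j a b) :=
    (prob_fst (fun y : Profile n k × Equiv.Perm (Fin k) => Bad f H i j a b y.1)).trans (prob_fst _)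
  have e2 : prob (fun y : (Profile n k × Equiv.Perm (Fin k)) × Equiv.Perm (Fin k) =>
        Bad f H i j a b (Function.update y.1.1 j y.1.2)) = prob (Bad f H i j a b) :=
    (prob_fst (fun y : Profile n k × Equiv.Perm (Fin k) =>
      Bad f H i j a b (Function.update y.1 j y.2))).trans (prob_update _ _)
  have e3 : prob (fun y : (Profile n k × Equiv.Perm (Fin k)) × Equiv.Perm (Fin k) =>
        Bad f H i j a b (Function.update y.1.1 j y.2)) = prob (Bad f H i j a b) :=
    (prob_13 (fun y : Profile n k × Equiv.Perm (Fin k) =>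
      Bad f H i j a b (Function.update y.1 j y.2))).trans (prob_update _ _)
  have h4 : prob E * (1 / (k:ℝ)^3) * (1 / (k:ℝ)^3) ≤ 12 * e := by
    have h5 : prob E * (1 / (k:ℝ)^3) ≤ prob E * prob (top2 a b) :=
      mul_le_mul_of_nonneg_left (top2_prob hk a b) (prob_nonneg _)
    have h6 := mul_le_mul_of_nonneg_right (h5.trans h1.ge) (show (0:ℝ) ≤ 1 / (k:ℝ)^3 by positivity)
    linarith
  calc prob E = (prob E * (1 / (k:ℝ)^3) * (1 / (k:ℝ)^3)) * k^6 := by field_simp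
    _ ≤ 12 * e * k^6 := mul_le_mul_of_nonneg_right h4 (by positivity)
    _ = _ := by ring

end core
end


set_option linter.unusedSectionVars false

section
variable {n k : ℕ}

open Classical in
/-- Exchange two rankings while keeping the `a,b` order in place. -/
noncomputable def cEx (a b : Fin k) (p : Equiv.Perm (Fin k) × Equiv.Perm (Fin k)) :
    Equiv.Perm (Fin k) × Equiv.Perm (Fin k) :=
  if (Above p.1 a b ↔ Above p.2 a b) then (p.2, p.1) else (sw a b p.2, sw a b p.1)

lemma cEx_invol {a b : Fin k} (hab : a ≠ b) : Function.Involutive (cEx a b) := by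
  rintro ⟨x, y⟩
  by_cases h : (Above x a b ↔ Above y a b)
  · have h' : (Above y a b ↔ Above x a b) := h.symm
    simp [cEx, h]
  · have h1 := above_sw_self hab x
    have h2 := above_sw_self hab y
    have h' : ¬ (Above (sw a b y) a b ↔ Above (sw a b x) a b) := by tauto
    have e1 : cEx a b (x, y) = (sw a b y, sw a b x) := if_neg h
    have e2 : cEx a b (sw a b y, sw a b x) = (sw a b (sw a b x), sw a b (sw a b y)) := if_neg h'
    rw [e1, e2, sw_invol, sw_invol]

lemma cEx_above {a b : Fin k} (hab : a ≠ b) (x y : Equiv.Perm (Fin k)) :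
    Above (cEx a b (x, y)).1 a b ↔ Above x a b := by
  by_cases h : (Above x a b ↔ Above y a b)
  · simp [cEx, h]
  · have h2 := above_sw_self hab y
    simp only [cEx, if_neg h]
    tauto

lemma cEx_congr {a b : Fin k} {x x' : Equiv.Perm (Fin k)} (y : Equiv.Perm (Fin k))
    (h : Above x a b ↔ Above x' a b) : (cEx a b (x, y)).1 = (cEx a b (x', y)).1 := by
  unfold cEx
  simp only
  split_ifs <;> first | rfl | tauto

lemma cEx_prob {a b : Fin k} (hab : a ≠ b) (j : Fin n) (D : Profile n k → Profile n k → Prop) :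
    prob (fun y : Profile n k × Equiv.Perm (Fin k) =>
      ¬ D y.1 (Function.update y.1 j (cEx a b (y.1 j, y.2)).1)) ≤
    2 * prob (fun y : Profile n k × Equiv.Perm (Fin k) =>
      ¬ D y.1 (Function.update y.1 j y.2) ∧ (Above (y.1 j) a b ↔ Above y.2 a b)) := by
  have hinv : Function.Involutive (fun y : Profile n k × Equiv.Perm (Fin k) =>
      (y.1, sw a b y.2)) := by
    rintro ⟨u, v⟩
    simp [sw_invol a b v]
  have h1 := prob_invol _ hinv (fun y : Profile n k × Equiv.Perm (Fin k) =>
      ¬ D y.1 (Function.update y.1 j y.2) ∧ (Above (y.1 j) a b ↔ Above y.2 a b))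
  rw [two_mul]
  nth_rewrite 1 [← h1]
  apply prob_le_add
  rintro ⟨u, v⟩ h
  by_cases hz : (Above (u j) a b ↔ Above v a b)
  · right
    refine ⟨?_, hz⟩
    simpa [cEx, hz] using h
  · left
    simp only [cEx, if_neg hz] at h
    refine ⟨h, ?_⟩
    have := above_sw_self hab v
    simp only
    tauto

lemma mix_congr {a b : Fin k} (T : Finset (Fin n)) (u v w : Profile n k)
    (hT : ∀ l, l ∈ T)
    (h : ∀ l, Above (u l) a b ↔ Above (v l) a b) :
    (mixBoth (cEx a b) T (u, w)).1 = (mixBoth (cEx a b) T (v, w)).1 := by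
  funext l
  simp only [mixBoth, hT l, if_true]
  exact cEx_congr _ (h l)

variable {f : Profile n k → Fin k} {H : Fin n → Profile n k → Finset (Fin k)}

lemma Wp_symm (i : Fin n) (a b : Fin k) (ω : Profile n k) : Wp H i a b ω ↔ Wp H i b a ω := by
  unfold Wp; tauto

lemma W_change (hk : 3 ≤ k) (hH : ∀ i ω τ, H i (Function.update ω i τ) = H i ω) {e : ℝ}
    (he : ∀ i, prob (fun ω => ¬ Ok f H i ω) ≤ e) {i j : Fin n} (hij : i ≠ j)
    {a b : Fin k} (hab : a ≠ b) :
    prob (fun y : Profile n k × Equiv.Perm (Fin k) =>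
      ¬ (Wp H i a b y.1 ↔ Wp H i a b (Function.update y.1 j y.2)) ∧
        (Above (y.1 j) a b ↔ Above y.2 a b)) ≤ 48 * k^6 * e := by
  have s1 := W_step hk hH he hij hab
  have s2 := W_step hk hH he hij hab.symm
  have s3 := s1
  have s4 := s2
  rw [← prob_invol _ (exch_invol j)] at s3 s4
  set p1 := fun y : Profile n k × Equiv.Perm (Fin k) =>
      Wp H i a b y.1 ∧ ¬ Wp H i a b (Function.update y.1 j y.2) ∧ Above (y.1 j) b a ∧
        Above y.2 b a
  set p2 := fun y : Profile n k × Equiv.Perm (Fin k) =>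
      Wp H i b a y.1 ∧ ¬ Wp H i b a (Function.update y.1 j y.2) ∧ Above (y.1 j) a b ∧
        Above y.2 a b
  have key : prob (fun y : Profile n k × Equiv.Perm (Fin k) =>
      ¬ (Wp H i a b y.1 ↔ Wp H i a b (Function.update y.1 j y.2)) ∧
        (Above (y.1 j) a b ↔ Above y.2 a b)) ≤
      (prob p1 + prob p2) + (prob (fun y => p1 (exch j y)) + prob (fun y => p2 (exch j y))) := by
    refine (prob_le_add (q := fun y => p1 y ∨ p2 y)
      (r := fun y => p1 (exch j y) ∨ p2 (exch j y)) ?_).trans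
      (add_le_add (prob_or_le _ _) (prob_or_le _ _))
    rintro ⟨u, v⟩ ⟨h1, h2⟩
    simp only [p1, p2, exch, Function.update_idem, Function.update_self, Function.update_eq_self]
    simp only at h1 h2
    rw [Wp_symm i b a, Wp_symm i b a, ← not_above hab, ← not_above hab]
    tauto
  linarith

lemma W_resample (hk : 3 ≤ k) (hH : ∀ i ω τ, H i (Function.update ω i τ) = H i ω) {e : ℝ}
    (he0 : 0 ≤ e)
    (he : ∀ i, prob (fun ω => ¬ Ok f H i ω) ≤ e) (i : Fin n)
    {a b : Fin k} (hab : a ≠ b) :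
    ∃ A : Profile n k → Prop,
      (∀ v w, (∀ l, Above (v l) a b ↔ Above (w l) a b) → (A v ↔ A w)) ∧
      (∀ ω τ, A (Function.update ω i τ) ↔ A ω) ∧
      prob (fun ω => ¬ (Wp H i a b ω ↔ A ω)) ≤ n * (96 * k^6 * e) := by
  have hyb := hybrid (n := n) (cEx a b) (cEx_invol hab)
    (fun u v => (Wp H i a b u ↔ Wp H i a b v)) (fun _ => Iff.rfl)
    (fun _ _ _ h h' => h.trans h') univ
  have hsum : ∑ j ∈ (univ : Finset (Fin n)), prob (fun y : Profile n k × Equiv.Perm (Fin k) =>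
      ¬ (Wp H i a b y.1 ↔ Wp H i a b (Function.update y.1 j (cEx a b (y.1 j, y.2)).1))) ≤
      ∑ j ∈ (univ : Finset (Fin n)), (96 * k^6 * e) := by
    apply Finset.sum_le_sum
    intro j _
    by_cases hij : i = j
    · subst hij
      rw [prob_zero]
      · positivity
      · intro y h
        exact h (Wp_inv hH i a b _ _).symm
    · have h1 := cEx_prob hab j (fun u v => (Wp H i a b u ↔ Wp H i a b v))
      have h2 := W_change hk hH he hij hab
      linarith
  obtain ⟨τ, hτ⟩ := prob_exists_section (fun y : Profile n k × Profile n k =>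
    ¬ (Wp H i a b y.1 ↔ Wp H i a b (mixBoth (cEx a b) univ y).1))
  refine ⟨fun ω => Wp H i a b (mixBoth (cEx a b) univ (ω, τ)).1, ?_, ?_, ?_⟩
  · intro v w h
    simp only
    rw [mix_congr univ v w τ (fun l => mem_univ l) h]
  · intro ω x
    simp only
    have : (mixBoth (cEx a b) univ (Function.update ω i x, τ)).1 =
        Function.update (mixBoth (cEx a b) univ (ω, τ)).1 i (cEx a b (x, τ i)).1 := by
      funext l
      by_cases hl : l = i
      · subst hl; simp [mixBoth]
      · simp [mixBoth, hl]
    rw [this, Wp_inv hH]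
  · refine hτ.trans (hyb.trans (hsum.trans (le_of_eq ?_)))
    simp

end


set_option linter.unusedSectionVars false

section
variable {n k : ℕ}

lemma exists_ge_avg {Ω : Type*} [Fintype Ω] [Nonempty Ω] (g : Ω → ℝ) : ∃ x, avg g ≤ g x := by
  obtain ⟨x, hx⟩ := exists_le_avg (fun x => -1 * g x)
  rw [avg_mul_left] at hx
  exact ⟨x, by linarith⟩

lemma prob_fix {X : Type*} [Fintype X] [Nonempty X] (i : Fin n) (A : (Fin n → X) → Prop) :
    ∃ x, prob A ≤ prob (fun w => A (Function.update w i x)) := by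
  rw [← prob_update i A, prob_prod']
  exact exists_ge_avg _

variable {f : Profile n k → Fin k} {H : Fin n → Profile n k → Finset (Fin k)}

/-- All is well at the point `π`. -/
def Good (f : Profile n k → Fin k) (H : Fin n → Profile n k → Finset (Fin k)) (i j : Fin n)
    (a b c d : Fin k) (π : Profile n k) : Prop :=
  (Ok f H i π ∧ Ok f H j π) ∧ (Wp H i a b π ∧ Wp H j c d π)

set_option maxHeartbeats 800000 in
lemma conflict_gen (hk : 3 ≤ k) (hH : ∀ i ω τ, H i (Function.update ω i τ) = H i ω) {e : ℝ}
    (he0 : 0 ≤ e)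
    (he : ∀ i, prob (fun ω => ¬ Ok f H i ω) ≤ e) {i j : Fin n} (hij : i ≠ j)
    {a b c d : Fin k} (hab : a ≠ b) (hcd : c ≠ d)
    (h1 : 1/8 ≤ prob (fun τ : Equiv.Perm (Fin k) => Above τ a b ∧ Above τ c d))
    (h2 : prob (fun τ : Equiv.Perm (Fin k) => Above τ a b ∧ Above τ c d) ≤ 3/8)
    {δ : ℝ} (hδ : 0 < δ) (hη : n * (96 * k^6 * e) ≤ δ / 2)
    (hbig : 8 * (e + n * (96 * k^6 * e)) < (δ/2)^4 / k^6)
    (hw1 : δ ≤ prob (Wp H i a b)) (hw2 : δ ≤ prob (Wp H j c d)) :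
    ∃ x y : Equiv.Perm (Fin k), ∀ (P Q : Equiv.Perm (Fin k) → Prop)
      (g h : Equiv.Perm (Fin k) → Equiv.Perm (Fin k)),
      Function.Involutive g → Function.Involutive h →
      1 / (k:ℝ)^3 ≤ prob P → 1 / (k:ℝ)^3 ≤ prob Q →
      (∀ τ, P τ → (Above τ c d ↔ Above y c d) ∧ (Above (g τ) c d ↔ Above y c d)) →
      (∀ τ, Q τ → (Above τ a b ↔ Above x a b) ∧ (Above (h τ) a b ↔ Above x a b)) →
      ∃ ω : Profile n k, P (ω i) ∧ Q (ω j) ∧ Good f H i j a b c d ω ∧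
        Good f H i j a b c d (app i g ω) ∧ Good f H i j a b c d (app j h ω) ∧
        Good f H i j a b c d (app i g (app j h ω)) := by
  classical
  have hk0 : (0:ℝ) < k := by exact_mod_cast (by omega : 0 < k)
  obtain ⟨A, Am, Ai, Ap⟩ := W_resample hk hH he0 he i hab
  obtain ⟨B, Bm, Bj, Bp⟩ := W_resample hk hH he0 he j hcd
  set η : ℝ := n * (96 * k^6 * e) with hηd
  have hA : δ / 2 ≤ prob A := by
    have : prob (Wp H i a b) ≤ prob (fun ω => ¬ (Wp H i a b ω ↔ A ω)) + prob A :=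
      prob_le_add fun ω h => by tauto
    linarith
  have hB : δ / 2 ≤ prob B := by
    have : prob (Wp H j c d) ≤ prob (fun ω => ¬ (Wp H j c d ω ↔ B ω)) + prob B :=
      prob_le_add fun ω h => by tauto
    linarith
  obtain ⟨x, hx⟩ := prob_fix j A
  obtain ⟨y, hy⟩ := prob_fix i B
  set A' : Profile n k → Prop := fun w => A (Function.update w j x) with hA'
  set B' : Profile n k → Prop := fun w => B (Function.update w i y) with hB'
  have A'i : ∀ w t, A' (Function.update w i t) ↔ A' w := by
    intro w t
    simp only [hA']
    rw [Function.update_comm hij, Ai]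
  have A'j : ∀ w t, A' (Function.update w j t) ↔ A' w := by
    intro w t
    simp only [hA', Function.update_idem]
  have B'j : ∀ w t, B' (Function.update w j t) ↔ B' w := by
    intro w t
    simp only [hB']
    rw [Function.update_comm hij.symm, Bj]
  have B'i : ∀ w t, B' (Function.update w i t) ↔ B' w := by
    intro w t
    simp only [hB', Function.update_idem]
  have A'A : ∀ w, A' w → (Above (w j) a b ↔ Above x a b) → A w := by
    intro w h1 h2
    refine (Am _ _ fun l => ?_).1 h1
    by_cases hl : l = j
    · subst hl; simp [h2]
    · simp [hl]
  have B'B : ∀ w, B' w → (Above (w i) c d ↔ Above y c d) → B w := by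
    intro w h1 h2
    refine (Bm _ _ fun l => ?_).1 h1
    by_cases hl : l = i
    · subst hl; simp [h2]
    · simp [hl]
  have hAB : (δ/2)^4 ≤ prob (fun w => A' w ∧ B' w) := by
    have key := rev_hyp_set (X := Equiv.Perm (Fin k)) (fun τ => decide (Above τ a b))
      (fun τ => decide (Above τ c d)) (by simpa using above_half hab)
      (by simpa using above_half hcd) (by simpa using h1) (by simpa using h2) A' B'
      (by
        intro u v huv
        refine (Am _ _ fun l => ?_).1
        by_cases hl : l = j
        · subst hl; simp
        · have := congrFun huv l
          simpa [hl] using this)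
      (by
        intro u v huv
        refine (Bm _ _ fun l => ?_).1
        by_cases hl : l = i
        · subst hl; simp
        · have := congrFun huv l
          simpa [hl] using this)
    refine le_trans ?_ key
    have q1 : (δ/2)^2 ≤ (prob A')^2 := by gcongr; exact hA.trans hx
    have q2 : (δ/2)^2 ≤ (prob B')^2 := by gcongr; exact hB.trans hy
    calc (δ/2)^4 = (δ/2)^2 * (δ/2)^2 := by ring
      _ ≤ _ := by gcongr
  refine ⟨x, y, fun P Q g h hg hh hP hQ hPo hQo => ?_⟩
  have i1 := prob_indep i (fun w => A' w ∧ B' w) P (fun w t => by simp only [A'i, B'i])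
  have i2 := prob_indep j (fun w => (A' w ∧ B' w) ∧ P (w i)) Q
    (fun w t => by simp only [A'j, B'j, Function.update_of_ne hij])
  rw [i1] at i2
  have low : (δ/2)^4 / k^6 ≤ prob (fun w : Profile n k => ((A' w ∧ B' w) ∧ P (w i)) ∧ Q (w j)) := by
    rw [i2]
    calc (δ/2)^4 / k^6 = (δ/2)^4 * (1/(k:ℝ)^3) * (1/(k:ℝ)^3) := by field_simp
      _ ≤ _ := by
        apply mul_le_mul _ hQ (by positivity)
        · exact mul_nonneg (prob_nonneg _) (prob_nonneg _)
        · exact mul_le_mul hAB hP (by positivity) (prob_nonneg _)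
  set Bd : Profile n k → Prop := fun π => (¬ Ok f H i π ∨ ¬ Ok f H j π) ∨
    (¬ (Wp H i a b π ↔ A π) ∨ ¬ (Wp H j c d π ↔ B π)) with hBd
  have pBd : prob Bd ≤ 2 * (e + η) := by
    have t1 := prob_or_le (fun π => ¬ Ok f H i π ∨ ¬ Ok f H j π)
      (fun π => ¬ (Wp H i a b π ↔ A π) ∨ ¬ (Wp H j c d π ↔ B π))
    have t2 := prob_or_le (fun π => ¬ Ok f H i π) (fun π => ¬ Ok f H j π)
    have t3 := prob_or_le (fun π => ¬ (Wp H i a b π ↔ A π)) (fun π => ¬ (Wp H j c d π ↔ B π))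
    have := he i
    have := he j
    linarith
  have b2 : prob (fun ω => Bd (app i g ω)) = prob Bd := prob_map_coord i g hg Bd
  have b3 : prob (fun ω => Bd (app j h ω)) = prob Bd := prob_map_coord j h hh Bd
  have b4 : prob (fun ω => Bd (app i g (app j h ω))) = prob Bd :=
    (prob_map_coord j h hh (fun ω => Bd (app i g ω))).trans b2
  by_contra hno
  push Not at hno
  have up : prob (fun w : Profile n k => ((A' w ∧ B' w) ∧ P (w i)) ∧ Q (w j)) ≤
      (prob Bd + prob (fun ω => Bd (app i g ω))) +
      (prob (fun ω => Bd (app j h ω)) + prob (fun ω => Bd (app i g (app j h ω)))) := by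
    refine (prob_le_add (q := fun ω => Bd ω ∨ Bd (app i g ω))
      (r := fun ω => Bd (app j h ω) ∨ Bd (app i g (app j h ω))) ?_).trans
      (add_le_add (prob_or_le _ _) (prob_or_le _ _))
    rintro ω ⟨⟨⟨hA1, hB1⟩, hP1⟩, hQ1⟩
    by_contra hc
    push Not at hc
    obtain ⟨⟨n1, n2⟩, n3, n4⟩ := hc
    have fin : ∀ π : Profile n k, ¬ Bd π → A' π → B' π → (Above (π j) a b ↔ Above x a b) →
        (Above (π i) c d ↔ Above y c d) → Good f H i j a b c d π := by
      intro π hb ha' hb' o1 o2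
      have hA2 := A'A π ha' o1
      have hB2 := B'B π hb' o2
      simp only [hBd] at hb
      rw [not_or, not_or, not_or, not_not, not_not, not_not, not_not] at hb
      exact ⟨hb.1, hb.2.1.2 hA2, hb.2.2.2 hB2⟩
    have vj : app i g ω j = ω j := by simp [app, hij.symm]
    have vi : app j h ω i = ω i := by simp [app, hij]
    refine hno ω hP1 hQ1 ?_ ?_ ?_ ?_
    · exact fin _ n1 hA1 hB1 (hQo _ hQ1).1 (hPo _ hP1).1
    · refine fin _ n2 ((A'i _ _).2 hA1) ((B'i _ _).2 hB1) ?_ ?_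
      · rw [vj]; exact (hQo _ hQ1).1
      · simpa [app] using (hPo _ hP1).2
    · refine fin _ n3 ((A'j _ _).2 hA1) ((B'j _ _).2 hB1) ?_ ?_
      · simpa [app] using (hQo _ hQ1).2
      · rw [vi]; exact (hPo _ hP1).1
    · refine fin _ n4 ((A'i _ _).2 ((A'j _ _).2 hA1)) ((B'i _ _).2 ((B'j _ _).2 hB1)) ?_ ?_
      · simpa [app, hij.symm] using (hQo _ hQ1).2
      · simpa [app, hij] using (hPo _ hP1).2
  rw [b2, b3, b4] at up
  linarith

end


set_option linter.unusedSectionVars false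

section
variable {n k : ℕ}
variable {f : Profile n k → Fin k} {H : Fin n → Profile n k → Finset (Fin k)}

lemma pat3_12 {a b c : Fin k} {τ : Equiv.Perm (Fin k)} (h : pat3 a b c τ) (hab : a ≠ b) :
    Above τ a b := h.1 _ hab.symm
lemma pat3_13 {a b c : Fin k} {τ : Equiv.Perm (Fin k)} (h : pat3 a b c τ) (hac : a ≠ c) :
    Above τ a c := h.1 _ hac.symm
lemma pat3_23 {a b c : Fin k} {τ : Equiv.Perm (Fin k)} (h : pat3 a b c τ) (hac : a ≠ c)
    (hbc : b ≠ c) : Above τ b c := h.2.1 _ hac.symm hbc.symm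

/-- If the first alternative of the pattern is in the menu then it wins. -/
lemma Ok.first {i : Fin n} {ω : Profile n k} {a b c : Fin k} (h : Ok f H i ω) (ha : a ∈ H i ω)
    (hp : pat3 a b c (ω i)) : f ω = a := h.eq_of_top ha fun y _ hy => hp.1 y hy

lemma Ok.second {i : Fin n} {ω : Profile n k} {a b c : Fin k} (h : Ok f H i ω) (hb : b ∈ H i ω)
    (hp : pat3 a b c (ω i)) : f ω = a ∨ f ω = b := by
  by_cases ha : a ∈ H i ω
  · exact Or.inl (h.first ha hp)
  · right
    refine h.eq_of_top hb fun y hy hne => hp.2.1 y ?_ hne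
    rintro rfl
    exact ha hy

lemma iff_tt {p q : Prop} (h1 : p) (h2 : q) : p ↔ q := ⟨fun _ => h2, fun _ => h1⟩
lemma iff_ff {p q : Prop} (h1 : ¬ p) (h2 : ¬ q) : p ↔ q :=
  ⟨fun h => absurd h h1, fun h => absurd h h2⟩

lemma conflict_disjoint (hk : 3 ≤ k) (hH : ∀ i ω τ, H i (Function.update ω i τ) = H i ω) {e : ℝ}
    (he0 : 0 ≤ e)
    (he : ∀ i, prob (fun ω => ¬ Ok f H i ω) ≤ e) {i j : Fin n} (hij : i ≠ j)
    {a b c d : Fin k} (hab : a ≠ b) (hcd : c ≠ d) (hac : a ≠ c) (had : a ≠ d) (hbc : b ≠ c)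
    (hbd : b ≠ d)
    {δ : ℝ} (hδ : 0 < δ) (hη : n * (96 * k^6 * e) ≤ δ / 2)
    (hbig : 8 * (e + n * (96 * k^6 * e)) < (δ/2)^4 / k^6)
    (hw1 : δ ≤ prob (Wp H i a b)) (hw2 : δ ≤ prob (Wp H j c d)) : False := by
  have hq := above_quarter hab hcd hac had hbc hbd
  obtain ⟨x, y, hxy⟩ := conflict_gen hk hH he0 he hij hab hcd (by rw [hq]; norm_num)
    (by rw [hq]; norm_num) hδ hη hbig hw1 hw2
  have idi : Function.Involutive (id : Equiv.Perm (Fin k) → Equiv.Perm (Fin k)) := fun _ => rfl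
  have cP : ∃ u, a ≠ u ∧ b ≠ u ∧ ∀ τ, pat3 a b u τ → (Above τ c d ↔ Above y c d) := by
    by_cases hy : Above y c d
    · exact ⟨c, hac, hbc, fun τ h => iff_tt (h.2.2 d had.symm hbd.symm hcd.symm) hy⟩
    · exact ⟨d, had, hbd, fun τ h => iff_ff
        (above_asymm (h.2.2 c hac.symm hbc.symm hcd)) hy⟩
  have cQ : ∃ v, c ≠ v ∧ d ≠ v ∧ ∀ τ, pat3 c d v τ → (Above τ a b ↔ Above x a b) := by
    by_cases hx : Above x a b
    · exact ⟨a, hac.symm, had.symm, fun τ h => iff_tt (h.2.2 b hbc hbd hab.symm) hx⟩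
    · exact ⟨b, hbc.symm, hbd.symm, fun τ h => iff_ff
        (above_asymm (h.2.2 a hac had hab)) hx⟩
  obtain ⟨u, hau, hbu, hu⟩ := cP
  obtain ⟨v, hcv, hdv, hv⟩ := cQ
  obtain ⟨ω, hP, hQ, ⟨⟨o1, o2⟩, w1, w2⟩, _⟩ := hxy (pat3 a b u) (pat3 c d v) id id idi idi
    (pat3_prob hk ⟨hab, hau, hbu⟩) (pat3_prob hk ⟨hcd, hcv, hdv⟩)
    (fun τ h => ⟨hu τ h, hu τ h⟩) (fun τ h => ⟨hv τ h, hv τ h⟩)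
  have f1 := o1.first w1.1 hP
  have f2 := o2.first w2.1 hQ
  exact hac (f1.symm.trans f2)

lemma conflict_overlap (hk : 3 ≤ k) (hH : ∀ i ω τ, H i (Function.update ω i τ) = H i ω) {e : ℝ}
    (he0 : 0 ≤ e)
    (he : ∀ i, prob (fun ω => ¬ Ok f H i ω) ≤ e) {i j : Fin n} (hij : i ≠ j)
    {a b c : Fin k} (hab : a ≠ b) (hac : a ≠ c) (hbc : b ≠ c)
    {δ : ℝ} (hδ : 0 < δ) (hη : n * (96 * k^6 * e) ≤ δ / 2)
    (hbig : 8 * (e + n * (96 * k^6 * e)) < (δ/2)^4 / k^6)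
    (hw1 : δ ≤ prob (Wp H i a b)) (hw2 : δ ≤ prob (Wp H j a c)) : False := by
  have hq := above_third hab hac hbc
  obtain ⟨x, y, hxy⟩ := conflict_gen hk hH he0 he hij hab hac (by rw [hq]; norm_num)
    (by rw [hq]; norm_num) hδ hη hbig hw1 hw2
  have idi : Function.Involutive (id : Equiv.Perm (Fin k) → Equiv.Perm (Fin k)) := fun _ => rfl
  by_cases hx : Above x a b <;> by_cases hy : Above y a c
  · obtain ⟨ω, hP, hQ, ⟨⟨o1, o2⟩, w1, w2⟩, _⟩ := hxy (pat3 b a c) (pat3 c a b) id id idi idi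
      (pat3_prob hk ⟨hab.symm, hbc, hac⟩) (pat3_prob hk ⟨hac.symm, hbc.symm, hab⟩)
      (fun τ h => ⟨iff_tt (pat3_23 h hbc hac) hy, iff_tt (pat3_23 h hbc hac) hy⟩)
      (fun τ h => ⟨iff_tt (pat3_23 h hbc.symm hab) hx, iff_tt (pat3_23 h hbc.symm hab) hx⟩)
    have f1 := o1.first w1.2 hP
    have f2 := o2.first w2.2 hQ
    exact hbc (f1.symm.trans f2)
  · obtain ⟨ω, hP, hQ, ⟨⟨o1, o2⟩, w1, w2⟩, _⟩ := hxy (pat3 c b a) (pat3 a c b) id id idi idi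
      (pat3_prob hk ⟨hbc.symm, hac.symm, hab.symm⟩) (pat3_prob hk ⟨hac, hab, hbc.symm⟩)
      (fun τ h => ⟨iff_ff (above_asymm (pat3_13 h hac.symm)) hy,
        iff_ff (above_asymm (pat3_13 h hac.symm)) hy⟩)
      (fun τ h => ⟨iff_tt (pat3_13 h hab) hx, iff_tt (pat3_13 h hab) hx⟩)
    have f1 := o1.second w1.2 hP
    have f2 := o2.first w2.1 hQ
    rw [f2] at f1
    exact f1.elim hac hab
  · obtain ⟨ω, hP, hQ, ⟨⟨o1, o2⟩, w1, w2⟩, _⟩ := hxy (pat3 a b c) (pat3 b c a) id id idi idi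
      (pat3_prob hk ⟨hab, hac, hbc⟩) (pat3_prob hk ⟨hbc, hab.symm, hac.symm⟩)
      (fun τ h => ⟨iff_tt (pat3_13 h hac) hy, iff_tt (pat3_13 h hac) hy⟩)
      (fun τ h => ⟨iff_ff (above_asymm (pat3_13 h hab.symm)) hx,
        iff_ff (above_asymm (pat3_13 h hab.symm)) hx⟩)
    have f1 := o1.first w1.1 hP
    have f2 := o2.second w2.2 hQ
    rw [f1] at f2
    exact f2.elim hab hac
  · have pg : ∀ τ, pat3 c a b τ → pat3 c b a (sw a b τ) := by
      intro τ h
      have := pat3_sw a b c a b τ h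
      rwa [Equiv.swap_apply_of_ne_of_ne hac.symm hbc.symm, Equiv.swap_apply_left,
        Equiv.swap_apply_right] at this
    have ph : ∀ τ, pat3 b a c τ → pat3 b c a (sw a c τ) := by
      intro τ h
      have := pat3_sw a c b a c τ h
      rwa [Equiv.swap_apply_of_ne_of_ne hab.symm hbc, Equiv.swap_apply_left,
        Equiv.swap_apply_right] at this
    obtain ⟨ω, hP, hQ, ⟨⟨o1, o2⟩, w1, w2⟩, ⟨⟨p1, p2⟩, v1, v2⟩, ⟨⟨q1, q2⟩, u1, u2⟩,
        ⟨⟨r1, r2⟩, t1, t2⟩⟩ :=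
      hxy (pat3 c a b) (pat3 b a c) (sw a b) (sw a c) (sw_invol a b) (sw_invol a c)
      (pat3_prob hk ⟨hac.symm, hbc.symm, hab⟩) (pat3_prob hk ⟨hab.symm, hbc, hac⟩)
      (fun τ h => ⟨iff_ff (above_asymm (pat3_12 h hac.symm)) hy,
        iff_ff (above_asymm (pat3_13 (pg τ h) hac.symm)) hy⟩)
      (fun τ h => ⟨iff_ff (above_asymm (pat3_12 h hab.symm)) hx,
        iff_ff (above_asymm (pat3_13 (ph τ h) hab.symm)) hx⟩)
    set g := sw a b with hg
    set h := sw a c with hh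
    have comm : app i g (app j h ω) = app j h (app i g ω) := by
      unfold app
      rw [Function.update_of_ne hij, Function.update_of_ne hij.symm, Function.update_comm hij]
    have gi : app i g ω i = g (ω i) := by simp [app]
    have gj : app i g ω j = ω j := by simp [app, hij.symm]
    have hj : app j h ω j = h (ω j) := by simp [app]
    have hi : app j h ω i = ω i := by simp [app, hij]
    have ti : app i g (app j h ω) i = g (ω i) := by simp [app, hij]
    have tj : app i g (app j h ω) j = h (ω j) := by simp [app, hij.symm]
    have H1 : H i (app i g ω) = H i ω := hH _ _ _
    have H2 : H j (app j h ω) = H j ω := hH _ _ _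
    have H3 : H i (app i g (app j h ω)) = H i (app j h ω) := hH _ _ _
    have H4 : H j (app i g (app j h ω)) = H j (app i g ω) := by rw [comm]; exact hH _ _ _
    have f0 : f ω = a := by
      rcases o1.second w1.1 hP with h1 | h1
      · rcases o2.second w2.1 hQ with h2 | h2
        · exact absurd (h2.symm.trans h1) hbc
        · exact h2
      · exact h1
    have c0 : c ∉ H i ω := fun hc => hac (f0.symm.trans (o1.first hc hP))
    have b0 : b ∉ H j ω := fun hb => hab (f0.symm.trans (o2.first hb hQ))
    have f1 : f (app i g ω) = b := by
      rcases p1.second v1.2 (by rw [gi]; exact pg _ hP) with h1 | h1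
      · have := p1.1
        rw [h1, H1] at this
        exact absurd this c0
      · exact h1
    have f2 : f (app j h ω) = c := by
      rcases q2.second u2.2 (by rw [hj]; exact ph _ hQ) with h1 | h1
      · have := q2.1
        rw [h1, H2] at this
        exact absurd this b0
      · exact h1
    have b1 : b ∈ H j (app i g ω) := by have := p2.1; rwa [f1] at this
    have c1 : c ∈ H i (app j h ω) := by have := q1.1; rwa [f2] at this
    have F1 := r1.first (by rw [H3]; exact c1) (by rw [ti]; exact pg _ hP)
    have F2 := r2.first (by rw [H4]; exact b1) (by rw [tj]; exact ph _ hQ)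
    exact hbc (F2.symm.trans F1)

lemma conflict (hk : 3 ≤ k) (hH : ∀ i ω τ, H i (Function.update ω i τ) = H i ω) {e : ℝ}
    (he0 : 0 ≤ e)
    (he : ∀ i, prob (fun ω => ¬ Ok f H i ω) ≤ e) {i j : Fin n} (hij : i ≠ j)
    {a b c d : Fin k} (hab : a ≠ b) (hcd : c ≠ d) (hne1 : ¬ (a = c ∧ b = d))
    (hne2 : ¬ (a = d ∧ b = c))
    {δ : ℝ} (hδ : 0 < δ) (hη : n * (96 * k^6 * e) ≤ δ / 2)
    (hbig : 8 * (e + n * (96 * k^6 * e)) < (δ/2)^4 / k^6)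
    (hw1 : δ ≤ prob (Wp H i a b)) (hw2 : δ ≤ prob (Wp H j c d)) : False := by
  have sy : ∀ i (a b : Fin k), prob (Wp H i a b) = prob (Wp H i b a) :=
    fun i a b => prob_congr fun ω => Wp_symm i a b ω
  have ov : ∀ {a b c : Fin k}, a ≠ b → a ≠ c → b ≠ c → δ ≤ prob (Wp H i a b) →
      δ ≤ prob (Wp H j a c) → False := fun h1 h2 h3 h4 h5 =>
    conflict_overlap hk hH he0 he hij h1 h2 h3 hδ hη hbig h4 h5
  have hw1' := hw1
  have hw2' := hw2
  rw [sy] at hw1' hw2'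
  by_cases hac : a = c
  · subst hac
    exact ov hab hcd (fun h => hne1 ⟨rfl, h⟩) hw1 hw2
  by_cases had : a = d
  · subst had
    exact ov hab hac (fun h => hne2 ⟨rfl, h⟩) hw1 hw2'
  by_cases hbc : b = c
  · subst hbc
    exact ov hab.symm hcd had hw1' hw2
  by_cases hbd : b = d
  · subst hbd
    exact ov hab.symm hbc hac hw1' hw2'
  exact conflict_disjoint hk hH he0 he hij hab hcd hac had hbc hbd hδ hη hbig hw1 hw2

end


set_option linter.unusedSectionVars false

section
variable {n k : ℕ}
variable {f : Profile n k → Fin k} {H : Fin n → Profile n k → Finset (Fin k)}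

lemma no_conflict (w : Fin n → Fin k → Fin k → Prop) (hn : 1 ≤ n)
    (hc : ∀ i j, i ≠ j → ∀ a b c d, a ≠ b → c ≠ d → ¬ (a = c ∧ b = d) → ¬ (a = d ∧ b = c) →
      w i a b → w j c d → False) :
    (∃ i, ∀ j, j ≠ i → ∀ c d, c ≠ d → ¬ w j c d) ∨
    (∃ a b, a ≠ b ∧ ∀ j c d, c ≠ d → ¬ (c = a ∧ d = b) → ¬ (c = b ∧ d = a) → ¬ w j c d) := by
  by_cases h : ∃ i, ∀ j, j ≠ i → ∀ c d, c ≠ d → ¬ w j c d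
  · exact Or.inl h
  · right
    push Not at h
    obtain ⟨j, _, a, b, hab, hw⟩ := h ⟨0, by omega⟩
    obtain ⟨j', hj', c, d, hcd, hw'⟩ := h j
    refine ⟨a, b, hab, fun l x y hxy h1 h2 hwl => ?_⟩
    by_cases hl : l = j
    · subst hl
      by_cases e1 : c = x ∧ d = y
      · obtain ⟨rfl, rfl⟩ := e1
        exact hc _ _ hj' _ _ _ _ hcd hab h1 h2 hw' hw
      by_cases e2 : c = y ∧ d = x
      · obtain ⟨rfl, rfl⟩ := e2
        exact hc _ _ hj' _ _ _ _ hcd hab (fun h => h2 h.symm) (fun h => h1 h.symm) hw' hw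
      exact hc _ _ hj' _ _ _ _ hcd hxy e1 e2 hw' hwl
    · exact hc _ _ hl _ _ _ _ hxy hab h1 h2 hwl hw

lemma change (hH : ∀ i ω τ, H i (Function.update ω i τ) = H i ω) {e : ℝ}
    (he : ∀ i, prob (fun ω => ¬ Ok f H i ω) ≤ e) (j : Fin n) (G : Fin k → Fin k → Prop) {δ : ℝ}
    (hδ : 0 ≤ δ) (hG : ∀ c d, c ≠ d → G c d → prob (Wp H j c d) ≤ δ) :
    prob (fun y : Profile n k × Equiv.Perm (Fin k) =>
      f y.1 ≠ f (Function.update y.1 j y.2) ∧ G (f y.1) (f (Function.update y.1 j y.2))) ≤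
      2 * e + k^2 * δ := by
  have h1 : prob (fun y : Profile n k × Equiv.Perm (Fin k) =>
      f y.1 ≠ f (Function.update y.1 j y.2) ∧ G (f y.1) (f (Function.update y.1 j y.2))) ≤
      (prob (fun y : Profile n k × Equiv.Perm (Fin k) => ¬ Ok f H j y.1) +
      prob (fun y : Profile n k × Equiv.Perm (Fin k) => ¬ Ok f H j (Function.update y.1 j y.2))) +
      prob (fun y : Profile n k × Equiv.Perm (Fin k) =>
        ∃ t : Fin k × Fin k, (t.1 ≠ t.2 ∧ G t.1 t.2) ∧ Wp H j t.1 t.2 y.1) := by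
    refine le_trans (prob_le_add (q := fun y : Profile n k × Equiv.Perm (Fin k) =>
        ¬ Ok f H j y.1 ∨ ¬ Ok f H j (Function.update y.1 j y.2))
      (r := fun y => ∃ t : Fin k × Fin k, (t.1 ≠ t.2 ∧ G t.1 t.2) ∧ Wp H j t.1 t.2 y.1)
      ?_) (add_le_add (prob_or_le _ _) le_rfl)
    rintro ⟨ω, τ⟩ ⟨hne, hg⟩
    by_cases o1 : Ok f H j ω
    · by_cases o2 : Ok f H j (Function.update ω j τ)
      · right
        refine ⟨(f ω, f (Function.update ω j τ)), ⟨hne, hg⟩, o1.1, ?_⟩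
        have := o2.1
        rwa [hH] at this
      · exact Or.inl (Or.inr o2)
    · exact Or.inl (Or.inl o1)
  have h2 : prob (fun y : Profile n k × Equiv.Perm (Fin k) =>
        ∃ t : Fin k × Fin k, (t.1 ≠ t.2 ∧ G t.1 t.2) ∧ Wp H j t.1 t.2 y.1) ≤
      ∑ t : Fin k × Fin k, prob (fun y : Profile n k × Equiv.Perm (Fin k) =>
        (t.1 ≠ t.2 ∧ G t.1 t.2) ∧ Wp H j t.1 t.2 y.1) :=
    prob_exists_le univ fun y ⟨t, ht⟩ => ⟨t, mem_univ _, ht⟩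
  have h3 : ∑ t : Fin k × Fin k, prob (fun y : Profile n k × Equiv.Perm (Fin k) =>
        (t.1 ≠ t.2 ∧ G t.1 t.2) ∧ Wp H j t.1 t.2 y.1) ≤ ∑ t : Fin k × Fin k, δ := by
    apply Finset.sum_le_sum
    rintro ⟨c, d⟩ _
    by_cases hcd : c ≠ d ∧ G c d
    · refine (prob_mono (q := fun y => Wp H j c d y.1) fun y hy => hy.2).trans ?_
      rw [prob_fst]
      exact hG c d hcd.1 hcd.2
    · rw [prob_zero fun y hy => hcd hy.1]
      exact hδ
  have h4 : ∑ t : Fin k × Fin k, δ = k^2 * δ := by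
    simp [sq]
  have e1 : prob (fun y : Profile n k × Equiv.Perm (Fin k) => ¬ Ok f H j y.1) ≤ e := by
    rw [prob_fst (fun ω => ¬ Ok f H j ω)]; exact he j
  have e2 : prob (fun y : Profile n k × Equiv.Perm (Fin k) =>
      ¬ Ok f H j (Function.update y.1 j y.2)) ≤ e := by
    rw [prob_update j (fun ω => ¬ Ok f H j ω)]; exact he j
  linarith

lemma tp_exists {S : Finset (Fin k)} (hS : S.Nonempty) (τ : Equiv.Perm (Fin k)) :
    ∃ y, Tp S τ y := by
  obtain ⟨y, hy, hmin⟩ := Finset.exists_min_image S (fun c => τ.symm c) hS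
  refine ⟨y, hy, fun b hb hne => ?_⟩
  refine lt_of_le_of_ne (hmin b hb) fun h => hne (τ.symm.injective h).symm

lemma tp_unique {S : Finset (Fin k)} {τ : Equiv.Perm (Fin k)} {x y : Fin k} (hx : Tp S τ x)
    (hy : Tp S τ y) : x = y := by
  by_contra hne
  exact above_asymm (hx.2 y hy.1 (Ne.symm hne)) (hy.2 x hx.1 hne)

lemma const_nonmanip (hn : 1 ≤ n) (c : Fin k) : InNonManip (fun _ : Profile n k => c) := by
  left
  refine ⟨⟨0, by omega⟩, {c}, by simp, fun σ => ⟨by simp, fun b hb hne => ?_⟩⟩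
  simp at hb
  exact absurd hb hne

lemma swap_invol {X : Type*} : Function.Involutive (Prod.swap : X × X → X × X) := fun _ => rfl

lemma case_V_sum (hH : ∀ i ω τ, H i (Function.update ω i τ) = H i ω) {e : ℝ}
    (he0 : 0 ≤ e)
    (he : ∀ i, prob (fun ω => ¬ Ok f H i ω) ≤ e) {δ : ℝ} (hδ : 0 ≤ δ) (T : Finset (Fin n))
    (hi : ∀ j ∈ T, ∀ c d, c ≠ d → prob (Wp H j c d) ≤ δ) :
    prob (fun y : Profile n k × Profile n k => ¬ (f y.1 = f (mixBoth Prod.swap T y).1)) ≤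
      n * (2 * e + k^2 * δ) := by
  have hyb := hybrid (n := n) (X := Equiv.Perm (Fin k)) Prod.swap swap_invol
    (fun u v => f u = f v) (fun _ => rfl)
    (fun _ _ _ h h' => h.trans h') T
  refine hyb.trans ?_
  have h1 : ∀ j ∈ T, prob (fun y : Profile n k × Equiv.Perm (Fin k) =>
      ¬ (f y.1 = f (Function.update y.1 j (Prod.swap (y.1 j, y.2)).1))) ≤ 2 * e + k^2 * δ := by
    intro j hj
    refine le_trans (prob_mono ?_) (change hH he j (fun _ _ => True) hδ (fun c d hcd _ => hi j hj c d hcd))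
    intro y hy
    exact ⟨hy, trivial⟩
  refine (Finset.sum_le_sum h1).trans ?_
  rw [Finset.sum_const, nsmul_eq_mul]
  refine mul_le_mul_of_nonneg_right ?_ (by positivity)
  have := Finset.card_le_univ T
  rw [Fintype.card_fin] at this
  exact_mod_cast this

lemma case_V_tot (hH : ∀ i ω τ, H i (Function.update ω i τ) = H i ω) {e : ℝ}
    (he0 : 0 ≤ e)
    (he : ∀ i, prob (fun ω => ¬ Ok f H i ω) ≤ e) {δ : ℝ} (hδ : 0 ≤ δ) (i : Fin n)
    (hi : ∀ j, j ≠ i → ∀ c d, c ≠ d → prob (Wp H j c d) ≤ δ) :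
    prob (fun y : Profile n k × Profile n k => ¬ Tp (H i y.2) (y.1 i) (f y.1)) ≤
      n * (2 * e + k^2 * δ) + e := by
  have hyb := case_V_sum hH he0 he hδ (univ.erase i) (fun j hj => hi j (Finset.ne_of_mem_erase hj))
  have hok := mixBoth_prob (X := Equiv.Perm (Fin k)) Prod.swap swap_invol (univ.erase i)
    (fun ω : Profile n k => ¬ Ok f H i ω)
  have hmix : ∀ y : Profile n k × Profile n k,
      (mixBoth Prod.swap (univ.erase i) y).1 = Function.update y.2 i (y.1 i) := by
    intro y
    funext l
    by_cases hl : l = i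
    · subst hl; simp [mixBoth]
    · simp [mixBoth, hl]
  refine le_trans (prob_le_add (q := fun y : Profile n k × Profile n k =>
      ¬ (f y.1 = f (mixBoth Prod.swap (univ.erase i) y).1))
      (r := fun y => ¬ Ok f H i (mixBoth Prod.swap (univ.erase i) y).1) ?_)
      (add_le_add hyb (hok.le.trans (he i)))
  intro y hy
  by_contra hc
  push Not at hc
  obtain ⟨h1, h2⟩ := hc
  apply hy
  unfold Ok at h2
  rw [← h1, hmix, hH, Function.update_self] at h2
  exact h2

lemma case_V (hH : ∀ i ω τ, H i (Function.update ω i τ) = H i ω) {e : ℝ}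
    (he0 : 0 ≤ e)
    (he : ∀ i, prob (fun ω => ¬ Ok f H i ω) ≤ e) {δ : ℝ} (hδ : 0 ≤ δ) (i : Fin n)
    (hi : ∀ j, j ≠ i → ∀ c d, c ≠ d → prob (Wp H j c d) ≤ δ)
    (hlt : n * (2 * e + k^2 * δ) + e < 1) :
    ∃ g : Profile n k → Fin k, InNonManip g ∧
      prob (fun σ => f σ ≠ g σ) ≤ n * (2 * e + k^2 * δ) + e := by
  have tot := case_V_tot hH he0 he hδ i hi
  obtain ⟨τ, hτ⟩ := prob_exists_section
    (fun y : Profile n k × Profile n k => ¬ Tp (H i y.2) (y.1 i) (f y.1))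
  have hτ' : prob (fun ω : Profile n k => ¬ Tp (H i τ) (ω i) (f ω)) ≤ _ := hτ.trans tot
  have hne : (H i τ).Nonempty := by
    have h1 := prob_not (fun ω : Profile n k => Tp (H i τ) (ω i) (f ω))
    obtain ⟨ω, hω⟩ := prob_exists_of_pos (p := fun ω : Profile n k => Tp (H i τ) (ω i) (f ω))
      (by linarith)
    exact ⟨_, hω.1⟩
  obtain ⟨tp, htp⟩ : ∃ tp : Equiv.Perm (Fin k) → Fin k, ∀ x, Tp (H i τ) x (tp x) :=
    ⟨fun x => (tp_exists hne x).choose, fun x => (tp_exists hne x).choose_spec⟩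
  have hlast : ∀ σ : Profile n k, f σ ≠ tp (σ i) → ¬ Tp (H i τ) (σ i) (f σ) :=
    fun σ hσ h => hσ (tp_unique h (htp _))
  have hfin := (prob_mono hlast).trans hτ'
  refine ⟨fun σ => tp (σ i), Or.inl ⟨i, H i τ, hne, ?_⟩, hfin⟩
  intro σ
  exact htp (σ i)

end


set_option linter.unusedSectionVars false

section
variable {n k : ℕ}
variable {f : Profile n k → Fin k} {H : Fin n → Profile n k → Finset (Fin k)}

lemma sum_bound (F : Fin n → ℝ) (c : ℝ) (h : ∀ j, F j ≤ c) : ∑ j, F j ≤ n * c := by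
  refine (Finset.sum_le_sum fun j _ => h j).trans (le_of_eq ?_)
  simp

/-- Either close to constant or mostly inside `{a,b}`. -/
lemma case_P_one (hH : ∀ i ω τ, H i (Function.update ω i τ) = H i ω) {e : ℝ}
    (he : ∀ i, prob (fun ω => ¬ Ok f H i ω) ≤ e) {δ : ℝ} (hδ : 0 ≤ δ) (a b : Fin k)
    (hi : ∀ j c d, c ≠ d → ¬ (c = a ∧ d = b) → ¬ (c = b ∧ d = a) → prob (Wp H j c d) ≤ δ) :
    (∃ c, prob (fun ω : Profile n k => f ω ≠ c) ≤ n * (2 * e + k^2 * δ)) ∨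
      prob (fun ω : Profile n k => ¬ (f ω = a ∨ f ω = b)) ≤ n * (2 * e + k^2 * δ) := by
  have hyb := hybrid (n := n) (X := Equiv.Perm (Fin k)) Prod.swap swap_invol
    (fun u v => f u = f v ∨ ((f u = a ∨ f u = b) ∧ (f v = a ∨ f v = b))) (fun _ => Or.inl rfl)
    (fun u v w h h' => by
      rcases h with h | h
      · rw [h]; exact h'
      · rcases h' with h' | h'
        · rw [← h']; exact Or.inr h
        · exact Or.inr ⟨h.1, h'.2⟩) univ
  have h1 : ∀ j, prob (fun y : Profile n k × Equiv.Perm (Fin k) =>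
      ¬ (f y.1 = f (Function.update y.1 j (Prod.swap (y.1 j, y.2)).1) ∨
        ((f y.1 = a ∨ f y.1 = b) ∧ (f (Function.update y.1 j (Prod.swap (y.1 j, y.2)).1) = a ∨
          f (Function.update y.1 j (Prod.swap (y.1 j, y.2)).1) = b)))) ≤ 2 * e + k^2 * δ := by
    intro j
    refine le_trans (prob_mono ?_) (change hH he j
      (fun c d => ¬ (c = a ∧ d = b) ∧ ¬ (c = b ∧ d = a)) hδ
      (fun c d hcd hG => hi j c d hcd hG.1 hG.2))
    intro y hy
    rw [not_or] at hy
    refine ⟨hy.1, fun h => hy.2 ⟨Or.inl h.1, Or.inr h.2⟩, fun h => hy.2 ⟨Or.inr h.1, Or.inl h.2⟩⟩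
  have h2 := hyb.trans (sum_bound _ _ h1)
  obtain ⟨τ, hτ⟩ := prob_exists_section (fun y : Profile n k × Profile n k =>
    ¬ (f y.1 = f (mixBoth Prod.swap univ y).1 ∨ ((f y.1 = a ∨ f y.1 = b) ∧
      (f (mixBoth Prod.swap univ y).1 = a ∨ f (mixBoth Prod.swap univ y).1 = b))))
  have h3 := hτ.trans h2
  have hm : ∀ ω : Profile n k, (mixBoth Prod.swap univ (ω, τ)).1 = τ := by
    intro ω; funext l; simp [mixBoth]
  by_cases hab : f τ = a ∨ f τ = b
  · right
    refine le_trans (prob_mono ?_) h3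
    intro ω hω
    rw [hm, not_or]
    refine ⟨fun h => hω (by rw [h]; exact hab), fun h => hω h.1⟩
  · left
    refine ⟨f τ, le_trans (prob_mono ?_) h3⟩
    intro ω hω
    rw [hm, not_or]
    exact ⟨hω, fun h => hab h.2⟩

/-- `f` is close to a function of the `a,b` orders. -/
lemma case_P_two (hH : ∀ i ω τ, H i (Function.update ω i τ) = H i ω) {e : ℝ}
    (he : ∀ i, prob (fun ω => ¬ Ok f H i ω) ≤ e) {δ : ℝ} (hδ : 0 ≤ δ) {a b : Fin k} (hab : a ≠ b)
    (hi : ∀ j c d, c ≠ d → ¬ (c = a ∧ d = b) → ¬ (c = b ∧ d = a) → prob (Wp H j c d) ≤ δ) :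
    ∃ F : Profile n k → Fin k,
      (∀ v w, (∀ l, Above (v l) a b ↔ Above (w l) a b) → F v = F w) ∧
      prob (fun ω : Profile n k => f ω ≠ F ω) ≤ n * (2 * (4 * e + k^2 * δ)) := by
  have hyb := hybrid (n := n) (cEx a b) (cEx_invol hab)
    (fun u v => f u = f v) (fun _ => rfl)
    (fun _ _ _ h h' => h.trans h') univ
  have h1 : ∀ j, prob (fun y : Profile n k × Equiv.Perm (Fin k) =>
      ¬ (f y.1 = f (Function.update y.1 j (cEx a b (y.1 j, y.2)).1))) ≤
        2 * (4 * e + k^2 * δ) := by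
    intro j
    refine (cEx_prob hab j (fun u v => f u = f v)).trans ?_
    have c1 := change hH he j
      (fun c d => ¬ (c = a ∧ d = b) ∧ ¬ (c = b ∧ d = a)) hδ
      (fun c d hcd hG => hi j c d hcd hG.1 hG.2)
    have e1 : prob (fun y : Profile n k × Equiv.Perm (Fin k) => ¬ Ok f H j y.1) ≤ e := by
      rw [prob_fst (fun ω => ¬ Ok f H j ω)]; exact he j
    have e2 : prob (fun y : Profile n k × Equiv.Perm (Fin k) =>
        ¬ Ok f H j (Function.update y.1 j y.2)) ≤ e := by
      rw [prob_update j (fun ω => ¬ Ok f H j ω)]; exact he j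
    have e3 := prob_or_le (fun y : Profile n k × Equiv.Perm (Fin k) => ¬ Ok f H j y.1)
      (fun y => ¬ Ok f H j (Function.update y.1 j y.2))
    have key : ∀ y : Profile n k × Equiv.Perm (Fin k),
        (¬ (f y.1 = f (Function.update y.1 j y.2)) ∧ (Above (y.1 j) a b ↔ Above y.2 a b)) →
        (f y.1 ≠ f (Function.update y.1 j y.2) ∧
          (¬ (f y.1 = a ∧ f (Function.update y.1 j y.2) = b) ∧
            ¬ (f y.1 = b ∧ f (Function.update y.1 j y.2) = a))) ∨
        (¬ Ok f H j y.1 ∨ ¬ Ok f H j (Function.update y.1 j y.2)) := by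
      rintro ⟨ω, τ⟩ ⟨hne, hz⟩
      by_contra hc
      rw [not_or, not_or, not_not, not_not] at hc
      obtain ⟨hc, o1, o2⟩ := hc
      have m1 : f (Function.update ω j τ) ∈ H j ω := by
        have := o2.1
        rwa [hH] at this
      have m2 : f ω ∈ H j (Function.update ω j τ) := by
        rw [hH]; exact o1.1
      have a1 := o1.above m1 (Ne.symm hne)
      have a2 := o2.above m2 hne
      simp only [Function.update_self] at a2 hz a1
      apply hc
      refine ⟨hne, fun h => ?_, fun h => ?_⟩
      · simp only at h
        rw [h.1, h.2] at a1 a2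
        exact above_asymm a2 (hz.1 a1)
      · simp only at h
        rw [h.1, h.2] at a1 a2
        exact above_asymm a1 (hz.2 a2)
    have := prob_le_add key
    linarith
  have h2 := hyb.trans (sum_bound _ _ h1)
  obtain ⟨τ, hτ⟩ := prob_exists_section (fun y : Profile n k × Profile n k =>
    ¬ (f y.1 = f (mixBoth (cEx a b) univ y).1))
  refine ⟨fun ω => f (mixBoth (cEx a b) univ (ω, τ)).1, ?_, hτ.trans h2⟩
  intro v w h
  simp only
  rw [mix_congr univ v w τ (fun l => mem_univ l) h]

lemma mono_nonmanip (hn : 1 ≤ n) {a b : Fin k} (hab : a ≠ b) (u : Profile n k → Prop)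
    (hu : ∀ v w, (∀ l, Above (v l) b a ↔ Above (w l) b a) → (u v ↔ u w))
    (hv : ∀ j w, ¬ viol (sw a b) (fun x => Above x b a) j u w)
    (g : Profile n k → Fin k) (hg1 : ∀ w, u w → g w = b) (hg0 : ∀ w, ¬ u w → g w = a) :
    InNonManip g := by
  have zs : ∀ x : Equiv.Perm (Fin k), Above (sw a b x) b a ↔ ¬ Above x b a := by
    intro x
    rw [not_above hab.symm, above_sw]; simp
  by_cases hall : ∀ w, u w
  · have : g = fun _ => b := funext fun w => hg1 w (hall w)
    rw [this]; exact const_nonmanip hn b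
  by_cases hnone : ∀ w, ¬ u w
  · have : g = fun _ => a := funext fun w => hg0 w (hnone w)
    rw [this]; exact const_nonmanip hn a
  push Not at hall hnone
  obtain ⟨w0, hw0⟩ := hall
  obtain ⟨w1, hw1⟩ := hnone
  right
  refine ⟨⟨a, b, hab, fun σ => ?_, ⟨w0, hg0 _ hw0⟩, ⟨w1, hg1 _ hw1⟩⟩, ?_⟩
  · by_cases h : u σ
    · exact Or.inr (hg1 _ h)
    · exact Or.inl (hg0 _ h)
  -- monotonicity
  have key : ∀ (σ σ' : Profile n k) (i : Fin n), (∀ j, j ≠ i → σ j = σ' j) → u σ → ¬ u σ' →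
      Above (σ i) b a ∧ ¬ Above (σ' i) b a := by
    intro σ σ' i hj h h'
    by_cases z1 : Above (σ i) b a
    · by_cases z2 : Above (σ' i) b a
      · exfalso
        refine h' ((hu σ σ' fun l => ?_).1 h)
        by_cases hl : l = i
        · subst hl; exact iff_tt z1 z2
        · rw [hj l hl]
      · exact ⟨z1, z2⟩
    · by_cases z2 : Above (σ' i) b a
      · exfalso
        refine hv i σ ⟨z1, h, fun h2 => h' ?_⟩
        refine (hu (fl (sw a b) i σ) σ' fun l => ?_).1 h2
        by_cases hl : l = i
        · subst hl
          simp only [fl, Function.update_self]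
          exact iff_tt ((zs _).2 z1) z2
        · simp only [fl, Function.update_of_ne hl]
          rw [hj l hl]
      · exfalso
        refine h' ((hu σ σ' fun l => ?_).1 h)
        by_cases hl : l = i
        · subst hl; exact iff_ff z1 z2
        · rw [hj l hl]
  intro σ σ' i _ hj hne
  by_cases h : u σ <;> by_cases h' : u σ'
  · exact absurd ((hg1 _ h).trans (hg1 _ h').symm) hne
  · rw [hg1 _ h, hg0 _ h']
    exact (not_above hab.symm).1 (key σ σ' i hj h h').2
  · rw [hg0 _ h, hg1 _ h']
    exact (key σ' σ i (fun j hji => (hj j hji).symm) h' h).1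
  · exact absurd ((hg0 _ h).trans (hg0 _ h').symm) hne

lemma case_P (hn : 1 ≤ n) (hH : ∀ i ω τ, H i (Function.update ω i τ) = H i ω) {e : ℝ}
    (he0 : 0 ≤ e)
    (he : ∀ i, prob (fun ω => ¬ Ok f H i ω) ≤ e) {δ : ℝ} (hδ : 0 ≤ δ) {a b : Fin k} (hab : a ≠ b)
    (hi : ∀ j c d, c ≠ d → ¬ (c = a ∧ d = b) → ¬ (c = b ∧ d = a) → prob (Wp H j c d) ≤ δ) :
    ∃ g : Profile n k → Fin k, InNonManip g ∧
      prob (fun σ => f σ ≠ g σ) ≤ 15 * n^2 * (4 * e + k^2 * δ) := by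
  classical
  have hn1 : (1:ℝ) ≤ n := by exact_mod_cast hn
  set E : ℝ := 4 * e + k^2 * δ with hE
  have hE0 : 0 ≤ E := by positivity
  have hkδ : 0 ≤ (k:ℝ)^2 * δ := by positivity
  have heE : 2 * e ≤ E := by linarith
  have hnE : n * (2 * e + k^2 * δ) ≤ n * E := by gcongr; linarith
  have hnn : n * E ≤ n^2 * E := by
    have : (n:ℝ) * 1 ≤ n * n := by gcongr
    nlinarith
  have hE1 : E ≤ n * E := by nlinarith
  rcases case_P_one hH he hδ a b hi with ⟨c, hc⟩ | hab2
  · refine ⟨fun _ => c, const_nonmanip hn c, hc.trans ?_⟩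
    nlinarith [mul_nonneg (sq_nonneg (n:ℝ)) hE0]
  · obtain ⟨F, hF, hFp⟩ := case_P_two hH he hδ hab hi
    have zs : ∀ x : Equiv.Perm (Fin k), Above (sw a b x) b a ↔ ¬ Above x b a := by
      intro x
      rw [not_above hab.symm, above_sw]; simp
    obtain ⟨u', hu', hv', hp'⟩ := sort_all (n := n) (sw a b) (fun x => Above x b a) (sw_invol a b)
      zs (fun ω => F ω = b) (by
        intro v w h
        rw [hF v w]
        intro l
        have := h l
        rw [← not_above hab.symm, ← not_above hab.symm]
        exact not_congr this)
    have viol_le : ∀ j, prob (viol (sw a b) (fun x => Above x b a) j (fun ω => F ω = b)) ≤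
        6 * (n * E) := by
      intro j
      have key : ∀ w : Profile n k, viol (sw a b) (fun x => Above x b a) j (fun ω => F ω = b) w →
          ((f w ≠ F w ∨ ¬ Ok f H j w) ∨
          (f (fl (sw a b) j w) ≠ F (fl (sw a b) j w) ∨ ¬ Ok f H j (fl (sw a b) j w))) ∨
          ¬ (f (fl (sw a b) j w) = a ∨ f (fl (sw a b) j w) = b) := by
        rintro w ⟨hz, h1, h2⟩
        by_contra hc
        simp only [not_or, not_not, ne_eq] at hc
        obtain ⟨⟨⟨f1, o1⟩, f2, o2⟩, h3⟩ := hc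
        have fw : f w = b := f1.trans h1
        have fa : f (fl (sw a b) j w) = a := by
          have : f (fl (sw a b) j w) ≠ b := fun h => h2 (f2.symm.trans h)
          tauto
        have m : a ∈ H j w := by
          have := o2.1
          rwa [fa, fl, hH] at this
        have := o1.above m (by rw [fw]; exact hab)
        rw [fw] at this
        exact hz this
      have s1 := prob_le_add key
      have s2 := prob_or_le (fun w : Profile n k => f w ≠ F w ∨ ¬ Ok f H j w)
        (fun w => f (fl (sw a b) j w) ≠ F (fl (sw a b) j w) ∨ ¬ Ok f H j (fl (sw a b) j w))
      have s3 := prob_or_le (fun w : Profile n k => f w ≠ F w) (fun w => ¬ Ok f H j w)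
      have s4 := prob_fl (sw a b) (sw_invol a b) j
        (fun w : Profile n k => f w ≠ F w ∨ ¬ Ok f H j w)
      have s5 := prob_fl (sw a b) (sw_invol a b) j
        (fun w : Profile n k => ¬ (f w = a ∨ f w = b))
      have := he j
      linarith
    have vs := sum_bound _ _ viol_le
    refine ⟨fun ω => if u' ω then b else a,
      mono_nonmanip hn hab u' hu' hv' _ (fun w h => if_pos h) (fun w h => if_neg h), ?_⟩
    have key : ∀ w : Profile n k, f w ≠ (if u' w then b else a) →
        (¬ (f w = a ∨ f w = b) ∨ f w ≠ F w) ∨ ¬ (F w = b ↔ u' w) := by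
      intro w hw
      by_contra hc
      simp only [not_or, not_not, ne_eq] at hc
      obtain ⟨⟨h1, h2⟩, h3⟩ := hc
      apply hw
      by_cases hu : u' w
      · rw [if_pos hu, h2]; exact h3.2 hu
      · rw [if_neg hu]
        have : f w ≠ b := fun h => hu (h3.1 (h2.symm.trans h))
        tauto
    have s1 := prob_le_add key
    have s2 := prob_or_le (fun w : Profile n k => ¬ (f w = a ∨ f w = b)) (fun w => f w ≠ F w)
    nlinarith
end


lemma final_arith {N K ε p : ℝ} (hN : 1 ≤ N) (hK : 1 ≤ K) (hε0 : 0 < ε) (hε1 : ε ≤ 1)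
    (hp0 : 0 ≤ p) (hp : p < ε ^ 15 / (10 ^ 39 * N ^ 67 * K ^ 166)) :
    N * (96 * K ^ 6 * (20 * K ^ 6 * p)) ≤ ε / (60 * N ^ 2 * K ^ 2) / 2 ∧
    8 * (20 * K ^ 6 * p + N * (96 * K ^ 6 * (20 * K ^ 6 * p)))
      < (ε / (60 * N ^ 2 * K ^ 2) / 2) ^ 4 / K ^ 6 ∧
    15 * N ^ 2 * (4 * (20 * K ^ 6 * p) + K ^ 2 * (ε / (60 * N ^ 2 * K ^ 2))) < ε := by
  have hN0 : 0 < N := by linarith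
  have hK0 : 0 < K := by linarith
  set e := 20 * K ^ 6 * p with he
  have he0 : 0 ≤ e := by positivity
  -- key inequality
  have key : e * (N ^ 9 * K ^ 20) * (5 * 10 ^ 12) < ε ^ 4 := by
    have h1 : p * (10 ^ 39 * N ^ 67 * K ^ 166) < ε ^ 15 := by
      rwa [lt_div_iff₀ (by positivity)] at hp
    have h2 : ε ^ 15 ≤ ε ^ 4 := pow_le_pow_of_le_one hε0.le hε1 (by norm_num)
    have h3 : N ^ 9 ≤ N ^ 67 := pow_le_pow_right₀ hN (by norm_num)
    have h4 : K ^ 26 ≤ K ^ 166 := pow_le_pow_right₀ hK (by norm_num)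
    have h5 : p * (10 ^ 14 * N ^ 9 * K ^ 26) ≤ p * (10 ^ 39 * N ^ 67 * K ^ 166) := by
      gcongr <;> norm_num
    have h6 : e * (N ^ 9 * K ^ 20) * (5 * 10 ^ 12) = p * (10 ^ 14 * N ^ 9 * K ^ 26) := by
      rw [he]; ring
    linarith
  have hε4 : ε ^ 4 ≤ ε := by
    simpa using pow_le_pow_of_le_one hε0.le hε1 (show 1 ≤ 4 by norm_num)
  refine ⟨?_, ?_, ?_⟩
  · rw [div_div, le_div_iff₀ (by positivity)]
    have h : e * (N ^ 3 * K ^ 8) ≤ e * (N ^ 9 * K ^ 20) := by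
      gcongr <;> first | assumption | norm_num
    have h0 : 0 ≤ e * (N ^ 3 * K ^ 8) := by positivity
    have : N * (96 * K ^ 6 * e) * (60 * N ^ 2 * K ^ 2 * 2) = 11520 * (e * (N ^ 3 * K ^ 8)) := by ring
    rw [this]; linarith
  · have hr : (ε / (60 * N ^ 2 * K ^ 2) / 2) ^ 4 / K ^ 6 = ε ^ 4 / (120 ^ 4 * N ^ 8 * K ^ 14) := by
      field_simp; ring
    rw [hr, lt_div_iff₀ (by positivity)]
    have h : e * (N ^ 8 * K ^ 14) ≤ e * (N ^ 9 * K ^ 20) := by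
      gcongr <;> first | assumption | norm_num
    have h0 : 0 ≤ e * (N ^ 8 * K ^ 14) := by positivity
    have : 8 * (e + N * (96 * K ^ 6 * e)) * (120 ^ 4 * N ^ 8 * K ^ 14)
        = (8 * 120 ^ 4) * (e * (N ^ 8 * K ^ 14)) + (768 * 120 ^ 4) * (e * (N ^ 9 * K ^ 20)) := by
      ring
    rw [this]; linarith
  · have h : e * (N ^ 2 * 1) ≤ e * (N ^ 9 * K ^ 20) := by
      gcongr
      · norm_num
      · exact one_le_pow₀ hK
    have h0 : 0 ≤ e * (N ^ 2 * 1) := by positivity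
    have : 15 * N ^ 2 * (4 * e + K ^ 2 * (ε / (60 * N ^ 2 * K ^ 2)))
        = 60 * (e * (N ^ 2 * 1)) + ε / 4 := by
      field_simp; ring
    rw [this]; linarith

theorem stmt0 (n k : ℕ) (hn : 1 ≤ n) (hk : 3 ≤ k)
    (ε : ℝ) (hε0 : 0 < ε) (hε1 : ε ≤ 1)
    (f : Profile n k → Fin k)
    (hD : ∀ g : Profile n k → Fin k, InNonManip g →
      ε ≤ prob (fun σ : Profile n k => f σ ≠ g σ)) :
    ε ^ 15 / (10 ^ 39 * (n : ℝ) ^ 67 * (k : ℝ) ^ 166) ≤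
        prob (fun σ : Profile n k => IsManipPointR 4 f σ) ∧
      ε ^ 15 / (10 ^ 39 * (n : ℝ) ^ 67 * (k : ℝ) ^ 166) ≤
        prob (fun σ : Profile n k => IsManipPoint f σ) := by
  have main : ε ^ 15 / (10 ^ 39 * (n : ℝ) ^ 67 * (k : ℝ) ^ 166) ≤
        prob (fun σ : Profile n k => IsManipPointR 4 f σ) := by
    by_contra hcon
    push Not at hcon
    have hp0 := prob_nonneg (fun σ : Profile n k => IsManipPointR 4 f σ)
    have hN : (1 : ℝ) ≤ n := by exact_mod_cast hn
    have hK : (1 : ℝ) ≤ k := by exact_mod_cast (by omega : 1 ≤ k)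
    obtain ⟨h1, h2, h3⟩ := final_arith hN hK hε0 hε1 hp0 hcon
    obtain ⟨H, hH, he⟩ := sections_exist f hk
    set e : ℝ := 20 * (k : ℝ) ^ 6 * prob (fun σ : Profile n k => IsManipPointR 4 f σ) with hedef
    set δ : ℝ := ε / (60 * (n : ℝ) ^ 2 * (k : ℝ) ^ 2) with hδdef
    have he0 : 0 ≤ e := by positivity
    have hδ : 0 < δ := by positivity
    have he' : ∀ i, prob (fun ω => ¬ Ok f H i ω) ≤ e := he
    rcases no_conflict (fun i a b => δ ≤ prob (Wp H i a b)) hn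
      (fun i j hij a b c d hab hcd hne1 hne2 hw1 hw2 =>
        conflict hk hH he0 he' hij hab hcd hne1 hne2 hδ h1 h2 hw1 hw2) with
      ⟨i, hi⟩ | ⟨a, b, hab, hi⟩
    · have hle : (n : ℝ) * (2 * e + (k : ℝ) ^ 2 * δ) + e
          ≤ 15 * (n : ℝ) ^ 2 * (4 * e + (k : ℝ) ^ 2 * δ) := by
        have hs : (n : ℝ) ≤ (n : ℝ) ^ 2 := by nlinarith
        have hkd : 0 ≤ (k : ℝ) ^ 2 * δ := by positivity
        have hne : (n : ℝ) * e ≤ (n : ℝ) ^ 2 * e := by gcongr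
        have hee : e ≤ (n : ℝ) * e := by nlinarith
        have hnd : (n : ℝ) * ((k : ℝ) ^ 2 * δ) ≤ (n : ℝ) ^ 2 * ((k : ℝ) ^ 2 * δ) := by gcongr
        have : 0 ≤ (n : ℝ) ^ 2 * ((k : ℝ) ^ 2 * δ) := by positivity
        nlinarith
      obtain ⟨g, hg, hgp⟩ := case_V hH he0 he' hδ.le i
        (fun j hj c d hcd => (not_le.1 (hi j hj c d hcd)).le) (by linarith)
      linarith [hD g hg]
    · obtain ⟨g, hg, hgp⟩ := case_P hn hH he0 he' hδ.le hab
        (fun j c d hcd hx hy => (not_le.1 (hi j c d hcd hx hy)).le)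
      linarith [hD g hg]
  refine ⟨main, main.trans (prob_mono ?_)⟩
  rintro σ ⟨σ', i, h, -⟩
  exact ⟨σ', i, h⟩
end

section
/- Let k ≥ 3 and 0 < ε ≤ 1, and let f : S_k → [k] be an SCF on n = 1 voter with D(f, NONMANIP(1,k)) ≥ ε. Then P(σ ∈ M_3(f)) ≥ ε^3 / (10^5 · k^16), where σ is chosen uniformly from S_k. -/
open Finset

/-- `σ` is a manipulation point of the one-voter SCF `f`. -/
def IsMPoint1 {k : ℕ} (f : Equiv.Perm (Fin k) → Fin k) (σ : Equiv.Perm (Fin k)) : Prop :=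
  ∃ σ', σ ≠ σ' ∧ Above σ (f σ') (f σ)

/-- `σ` is an `r`-manipulation point of the one-voter SCF `f`, i.e. `σ ∈ M_r(f)`. -/
def IsMPointR1 {k : ℕ} (r : ℕ) (f : Equiv.Perm (Fin k) → Fin k)
    (σ : Equiv.Perm (Fin k)) : Prop :=
  ∃ σ', σ ≠ σ' ∧ Above σ (f σ') (f σ) ∧ AgreeOutsideBlock r σ σ'

/-- `f = top_H`: `f` always elects the top alternative among `H`. -/
def IsTop1 {k : ℕ} (f : Equiv.Perm (Fin k) → Fin k) (H : Finset (Fin k)) : Prop :=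
  ∀ σ, f σ ∈ H ∧ ∀ b ∈ H, b ≠ f σ → Above σ (f σ) b

/-- `f` takes exactly two values. -/
def TakesExactlyTwoValues1 {k : ℕ} (f : Equiv.Perm (Fin k) → Fin k) : Prop :=
  ∃ a b : Fin k, a ≠ b ∧ (∀ σ, f σ = a ∨ f σ = b) ∧ (∃ σ, f σ = a) ∧ (∃ σ, f σ = b)

/-- `f` is monotone (one-voter version). -/
def IsMonotone1 {k : ℕ} (f : Equiv.Perm (Fin k) → Fin k) : Prop :=
  ∀ σ σ', f σ ≠ f σ' → Above σ' (f σ') (f σ)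

/-- The family `NONMANIP(1,k)` of nonmanipulable one-voter social choice functions. -/
def InNonManip1 {k : ℕ} (f : Equiv.Perm (Fin k) → Fin k) : Prop :=
  (∃ H : Finset (Fin k), H.Nonempty ∧ IsTop1 f H) ∨
  (TakesExactlyTwoValues1 f ∧ IsMonotone1 f)

/-- `[a:b]σ`: swap `a` and `b` in `σ` if they occupy adjacent positions,
and `σ` otherwise. -/
def adjSwap {k : ℕ} (a b : Fin k) (σ : Equiv.Perm (Fin k)) : Equiv.Perm (Fin k) :=
  if (σ.symm a : ℕ) + 1 = (σ.symm b : ℕ) ∨ (σ.symm b : ℕ) + 1 = (σ.symm a : ℕ)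
  then Equiv.swap a b * σ else σ

/-- `σ ∈ F̄`: `a` occupies the position directly above `b` in `σ`. -/
def Fbar {k : ℕ} (a b : Fin k) (σ : Equiv.Perm (Fin k)) : Prop :=
  (σ.symm a : ℕ) + 1 = (σ.symm b : ℕ)

/-- `σ ∈ B`: `f σ = a`, `f([a:b]σ) = b` and `a` is above `b` in `σ`. -/
def BSet {k : ℕ} (f : Equiv.Perm (Fin k) → Fin k) (a b : Fin k)
    (σ : Equiv.Perm (Fin k)) : Prop :=
  f σ = a ∧ f (adjSwap a b σ) = b ∧ Above σ a b

/-- Adjacency in the graph `G` on `F̄`: transposing two elements in adjacent positions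
when the adjacent pair `a,b` is treated as a single block element (either swapping two
elements neither of which is `a` or `b`, or moving the `a,b`-block up or down by one). -/
def GAdj {k : ℕ} (a b : Fin k) (σ π : Equiv.Perm (Fin k)) : Prop :=
  Fbar a b σ ∧ Fbar a b π ∧
    ((∃ p q : Fin k, (p : ℕ) + 1 = (q : ℕ) ∧ σ p ≠ a ∧ σ p ≠ b ∧ σ q ≠ a ∧ σ q ≠ b ∧
        π = σ * Equiv.swap p q) ∨
     (∃ p q r : Fin k, (p : ℕ) + 1 = (q : ℕ) ∧ (q : ℕ) + 1 = (r : ℕ) ∧ σ q = a ∧ σ r = b ∧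
        π = σ * (Equiv.swap p r * Equiv.swap p q)) ∨
     (∃ p q r : Fin k, (p : ℕ) + 1 = (q : ℕ) ∧ (q : ℕ) + 1 = (r : ℕ) ∧ σ p = a ∧ σ q = b ∧
        π = σ * (Equiv.swap p q * Equiv.swap p r)))

/-- `σ ∈ ∂(B)`: `σ ∈ B` and `σ` has a `G`-neighbor in `F̄ ∖ B`. -/
def InBdryB {k : ℕ} (f : Equiv.Perm (Fin k) → Fin k) (a b : Fin k)
    (σ : Equiv.Perm (Fin k)) : Prop :=
  BSet f a b σ ∧ ∃ π, GAdj a b σ π ∧ ¬ BSet f a b π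

/-- `σ ∈ LD^H`: `σ` is a local dictator on `H`: the alternatives of `H` occupy a block
of consecutive positions in `σ`, and for every `σ'` obtained from `σ` by permuting the
alternatives of `H` within this block, `f σ'` is the top-ranked alternative of `H` in `σ'`. -/
def IsLocalDict {k : ℕ} (f : Equiv.Perm (Fin k) → Fin k) (H : Finset (Fin k))
    (σ : Equiv.Perm (Fin k)) : Prop :=
  (∃ l : ℕ, ∀ x : Fin k, σ x ∈ H ↔ l ≤ (x : ℕ) ∧ (x : ℕ) < l + H.card) ∧
  ∀ σ' : Equiv.Perm (Fin k), (∀ x, σ x ∉ H → σ' x = σ x) →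
    f σ' ∈ H ∧ ∀ c ∈ H, c ≠ f σ' → Above σ' (f σ') c

/-- `σ ∈ LD(a,b) = ∪_{c ∉ {a,b}} LD^{{a,b,c}}`. -/
def InLD {k : ℕ} (f : Equiv.Perm (Fin k) → Fin k) (a b : Fin k)
    (σ : Equiv.Perm (Fin k)) : Prop :=
  ∃ c, c ≠ a ∧ c ≠ b ∧ IsLocalDict f ({a, b, c} : Finset (Fin k)) σ

/-- `τ'` is obtained from `τ` by moving only the alternative `c` (the relative order of
all other alternatives is unchanged). -/
def MovedOnly {k : ℕ} (c : Fin k) (τ τ' : Equiv.Perm (Fin k)) : Prop :=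
  ∀ x y, x ≠ c → y ≠ c → (Above τ x y ↔ Above τ' x y)

/-- `σ ∈ V_{(a,b,c)}`: the top three positions of `σ` hold `a`, `b`, `c` in this order. -/
def VSet {k : ℕ} (a b c : Fin k) (σ : Equiv.Perm (Fin k)) : Prop :=
  ∃ p q r : Fin k, (p : ℕ) = 0 ∧ (q : ℕ) = 1 ∧ (r : ℕ) = 2 ∧ σ p = a ∧ σ q = b ∧ σ r = c

/-- Adjacency in the graph `G_{(a,b,c)}`: both in `V_{(a,b,c)}` and differing by
transposing the alternatives in two adjacent positions. -/
def VAdj {k : ℕ} (a b c : Fin k) (σ π : Equiv.Perm (Fin k)) : Prop :=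
  VSet a b c σ ∧ VSet a b c π ∧ σ ≠ π ∧
    ∃ p q : Fin k, (p : ℕ) + 1 = (q : ℕ) ∧ π = σ * Equiv.swap p q

/-- `σ ∈ T(a,b,c) = V_{(a,b,c)} ∩ LD^{{a,b,c}}`. -/
def TSet {k : ℕ} (f : Equiv.Perm (Fin k) → Fin k) (a b c : Fin k)
    (σ : Equiv.Perm (Fin k)) : Prop :=
  VSet a b c σ ∧ IsLocalDict f ({a, b, c} : Finset (Fin k)) σ

/-- `σ ∈ ∂(T(a,b,c))`. -/
def InBdryT {k : ℕ} (f : Equiv.Perm (Fin k) → Fin k) (a b c : Fin k)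
    (σ : Equiv.Perm (Fin k)) : Prop :=
  TSet f a b c σ ∧ ∃ π, VAdj a b c σ π ∧ ¬ TSet f a b c π

open Classical in
/-- The number of permutations satisfying a predicate. -/
noncomputable def cnt {k : ℕ} (p : Equiv.Perm (Fin k) → Prop) : ℕ :=
  (Finset.univ.filter p).card

theorem cnt_mono {k : ℕ} {p q : Equiv.Perm (Fin k) → Prop} (h : ∀ σ, p σ → q σ) :
    cnt p ≤ cnt q := by
  classical
  unfold cnt
  apply Finset.card_le_card
  intro σ
  simpa using h σ

theorem cnt_or {k : ℕ} (p q : Equiv.Perm (Fin k) → Prop) :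
    cnt (fun σ => p σ ∨ q σ) ≤ cnt p + cnt q := by
  classical
  unfold cnt
  refine le_trans (Finset.card_le_card ?_) (Finset.card_union_le _ _)
  intro σ
  simp

theorem cnt_eq_zero {k : ℕ} {p : Equiv.Perm (Fin k) → Prop} (h : ∀ σ, ¬ p σ) : cnt p = 0 := by
  classical
  unfold cnt
  simp [h]

theorem cnt_eq_card {k : ℕ} {p : Equiv.Perm (Fin k) → Prop} (h : ∀ σ, p σ) :
    cnt p = Fintype.card (Equiv.Perm (Fin k)) := by
  classical
  unfold cnt
  simp [h, Finset.card_univ]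

theorem cnt_exists {k : ℕ} {ι : Type*} (s : Finset ι) (p : ι → Equiv.Perm (Fin k) → Prop) :
    cnt (fun σ => ∃ i ∈ s, p i σ) ≤ ∑ i ∈ s, cnt (p i) := by
  classical
  unfold cnt
  refine le_trans (Finset.card_le_card ?_) Finset.card_biUnion_le
  intro σ
  simp

theorem cnt_mul_right {k : ℕ} (p : Equiv.Perm (Fin k) → Prop) (g : Equiv.Perm (Fin k)) :
    cnt (fun σ => p (σ * g)) = cnt p := by
  classical
  unfold cnt
  apply Finset.card_bij (fun σ _ => σ * g)
  · intro σ; simp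
  · intro σ _ τ _ h; exact mul_right_cancel h
  · intro σ h; exact ⟨σ * g⁻¹, by simpa using h, by simp⟩

theorem key_swap {k : ℕ} (f : Equiv.Perm (Fin k) → Fin k) (σ : Equiv.Perm (Fin k))
    (p q : Fin k) (hpq : (p : ℕ) + 1 = q) (h1 : ¬ IsMPointR1 3 f σ)
    (h2 : ¬ IsMPointR1 3 f (σ * Equiv.swap p q)) :
    f (σ * Equiv.swap p q) = f σ ∨ f σ = σ p := by
  have hne : p ≠ q := by intro h; rw [h] at hpq; omega
  have hσ : σ ≠ σ * Equiv.swap p q := by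
    intro h
    have := congrArg (fun τ => τ p) h
    simp at this
    exact hne this
  have hag : ∀ x : Fin k, ((x : ℕ) < p ∨ (p : ℕ) + 3 ≤ x) → Equiv.swap p q x = x := by
    intro x hx
    apply Equiv.swap_apply_of_ne_of_ne
    · rintro rfl; omega
    · rintro rfl; omega
  have e1 : ¬ Above σ (f (σ * Equiv.swap p q)) (f σ) := fun h =>
    h1 ⟨_, hσ, h, p, fun x hx => by simp [hag x hx]⟩
  have e2 : ¬ Above (σ * Equiv.swap p q) (f σ) (f (σ * Equiv.swap p q)) := fun h =>
    h2 ⟨_, hσ.symm, h, p, fun x hx => by simp [hag x hx]⟩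
  by_contra hcon
  push Not at hcon
  obtain ⟨hc1, hc2⟩ := hcon
  unfold Above at e1 e2
  obtain ⟨u, hu⟩ := σ.surjective (f σ)
  obtain ⟨v, hv⟩ := σ.surjective (f (σ * Equiv.swap p q))
  rw [← hu, ← hv] at e1 e2 hc1
  rw [← hu] at hc2
  have hs : ∀ x, (σ * Equiv.swap p q).symm (σ x) = Equiv.swap p q x := by
    intro x
    rw [Equiv.symm_apply_eq]; simp
  rw [hs, hs] at e2
  simp only [Equiv.symm_apply_apply] at e1
  have huv : v ≠ u := fun h => hc1 (by rw [h])
  have hup : u ≠ p := fun h => hc2 (by rw [h])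
  rw [Equiv.swap_apply_def, Equiv.swap_apply_def] at e2
  simp only [Fin.lt_def, Fin.ext_iff, ne_eq] at *
  split_ifs at e2 <;> simp only [not_lt] at * <;> grind

/-- A predicate on rankings preserved (up to manipulation points) when `a` moves up. -/
theorem layer_bound {k : ℕ} (f : Equiv.Perm (Fin k) → Fin k) (a : Fin k)
    (P : Equiv.Perm (Fin k) → Prop)
    (hP : ∀ (σ : Equiv.Perm (Fin k)) (p q : Fin k), (p : ℕ) + 1 = (q : ℕ) → σ q = a → P σ → ¬ IsMPointR1 3 f σ →
      ¬ IsMPointR1 3 f (σ * Equiv.swap p q) → P (σ * Equiv.swap p q)) :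
    cnt P ≤ k * cnt (fun σ => P σ ∧ (σ.symm a : ℕ) = 0) +
      2 * k ^ 2 * cnt (IsMPointR1 3 f) := by
  have step : ∀ t : ℕ, cnt (fun σ => P σ ∧ (σ.symm a : ℕ) = t) ≤
      cnt (fun σ => P σ ∧ (σ.symm a : ℕ) = 0) + 2 * t * cnt (IsMPointR1 3 f) := by
    intro t
    induction t with
    | zero => simp
    | succ t ih =>
      by_cases ht : t + 1 < k
      · let p : Fin k := ⟨t, by omega⟩
        let q : Fin k := ⟨t + 1, ht⟩
        have : cnt (fun σ => P σ ∧ (σ.symm a : ℕ) = t + 1) ≤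
            cnt (fun σ => IsMPointR1 3 f σ ∨ (IsMPointR1 3 f (σ * Equiv.swap p q) ∨
              (fun τ : Equiv.Perm (Fin k) => P τ ∧ (τ.symm a : ℕ) = t)
                (σ * Equiv.swap p q))) := by
          apply cnt_mono
          rintro σ ⟨h1, h2⟩
          by_cases c1 : IsMPointR1 3 f σ
          · exact Or.inl c1
          by_cases c2 : IsMPointR1 3 f (σ * Equiv.swap p q)
          · exact Or.inr (Or.inl c2)
          have hq : σ q = a := by
            rw [← Equiv.eq_symm_apply]
            exact Fin.ext h2.symm
          refine Or.inr (Or.inr ⟨hP σ p q rfl hq h1 c1 c2, ?_⟩)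
          have : (σ * Equiv.swap p q).symm a = p := by
            rw [Equiv.symm_apply_eq]; simp [hq]
          rw [this]
        have h2 := cnt_or (IsMPointR1 3 f) (fun σ => IsMPointR1 3 f (σ * Equiv.swap p q) ∨
              (fun τ : Equiv.Perm (Fin k) => P τ ∧ (τ.symm a : ℕ) = t)
                (σ * Equiv.swap p q))
        have h3 := cnt_mul_right (fun σ => IsMPointR1 3 f σ ∨
              (fun τ : Equiv.Perm (Fin k) => P τ ∧ (τ.symm a : ℕ) = t) σ) (Equiv.swap p q)
        have h4 := cnt_or (IsMPointR1 3 f)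
          (fun τ : Equiv.Perm (Fin k) => P τ ∧ (τ.symm a : ℕ) = t)
        simp only [] at *
        linarith
      · have : cnt (fun σ => P σ ∧ (σ.symm a : ℕ) = t + 1) ≤
            cnt (fun σ => P σ ∧ (σ.symm a : ℕ) = t) := by
          apply cnt_mono
          rintro σ ⟨_, h⟩
          have := (σ.symm a).isLt
          omega
        linarith [Nat.zero_le (cnt (IsMPointR1 3 f))]
  have h1 : cnt P ≤ cnt (fun σ => ∃ t ∈ Finset.range k, P σ ∧ (σ.symm a : ℕ) = t) := by
    apply cnt_mono
    intro σ h
    exact ⟨_, Finset.mem_range.2 (σ.symm a).isLt, h, rfl⟩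
  refine h1.trans ((cnt_exists _ _).trans ?_)
  refine (Finset.sum_le_card_nsmul _ _ (cnt (fun σ => P σ ∧ (σ.symm a : ℕ) = 0) +
    2 * k * cnt (IsMPointR1 3 f)) ?_).trans ?_
  · intro t ht
    refine (step t).trans ?_
    have := Finset.mem_range.1 ht
    gcongr
  · simp only [Finset.card_range, smul_eq_mul]
    apply le_of_eq; ring

/-- Number of `σ` with `a` on top, `f σ = a` and `f (σ g) ≠ a`. -/
noncomputable def cross {k : ℕ} (f : Equiv.Perm (Fin k) → Fin k) (z a : Fin k)
    (g : Equiv.Perm (Fin k)) : ℕ :=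
  cnt (fun σ => (σ z = a ∧ f σ = a) ∧ f (σ * g) ≠ a)

theorem cross_mul {k : ℕ} (f : Equiv.Perm (Fin k) → Fin k) (z a : Fin k)
    (g h : Equiv.Perm (Fin k)) (hg : g z = z) :
    cross f z a (g * h) ≤ cross f z a g + cross f z a h := by
  unfold cross
  rw [← cnt_mul_right (fun σ => (σ z = a ∧ f σ = a) ∧ f (σ * h) ≠ a) g]
  refine le_trans (cnt_mono ?_) (cnt_or _ _)
  rintro σ ⟨⟨h1, h2⟩, h3⟩
  by_cases c : f (σ * g) = a
  · right
    refine ⟨⟨by simp [hg, h1], c⟩, ?_⟩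
    rwa [mul_assoc]
  · left
    exact ⟨⟨h1, h2⟩, c⟩

theorem cross_adj {k : ℕ} (f : Equiv.Perm (Fin k) → Fin k) (z a p q : Fin k)
    (hpz : p ≠ z) (hpq : (p : ℕ) + 1 = q) :
    cross f z a (Equiv.swap p q) ≤ 2 * cnt (IsMPointR1 3 f) := by
  have e := cnt_mul_right (IsMPointR1 3 f) (Equiv.swap p q)
  have e2 := cnt_or (IsMPointR1 3 f) (fun σ => IsMPointR1 3 f (σ * Equiv.swap p q))
  have : cross f z a (Equiv.swap p q) ≤
      cnt (fun σ => IsMPointR1 3 f σ ∨ IsMPointR1 3 f (σ * Equiv.swap p q)) := by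
    apply cnt_mono
    rintro σ ⟨⟨h1, h2⟩, h3⟩
    by_contra hc
    push Not at hc
    rcases key_swap f σ p q hpq hc.1 hc.2 with h | h
    · exact h3 (h.trans h2)
    · apply hpz
      apply σ.injective
      rw [← h, h2, h1]
  linarith

theorem cross_swap_lt {k : ℕ} (f : Equiv.Perm (Fin k) → Fin k) (z a : Fin k) (hz : (z : ℕ) = 0)
    (i : Fin k) (hi : i ≠ z) (d : ℕ) : ∀ j : Fin k, (i : ℕ) + d + 1 = j →
    cross f z a (Equiv.swap i j) ≤ (2 * d + 1) * (2 * cnt (IsMPointR1 3 f)) := by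
  have hi0 : (i : ℕ) ≠ 0 := fun h => hi (Fin.ext (h.trans hz.symm))
  induction d with
  | zero =>
    intro j hj
    simpa using cross_adj f z a i j hi (by omega)
  | succ d ih =>
    intro j hj
    let l : Fin k := ⟨i + d + 1, by have := j.isLt; omega⟩
    have hl : (l : ℕ) = i + d + 1 := rfl
    have hlz : l ≠ z := by intro h; rw [h] at hl; omega
    have hjz : j ≠ z := by rintro rfl; omega
    have hil : i ≠ l := by intro h; rw [← h] at hl; omega
    have hij : i ≠ j := by rintro rfl; omega
    have hlj : l ≠ j := by intro h; rw [h] at hl; omega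
    have e : Equiv.swap i j = Equiv.swap l j * (Equiv.swap i l * Equiv.swap l j) := by
      have := Equiv.swap_mul_swap_mul_swap (x := i) (y := l) (z := j) hil hij
      rw [← mul_assoc]
      rw [this, Equiv.swap_comm]
    rw [e]
    have h1 := ih l (by omega)
    have h2 := cross_adj f z a l j hlz (by omega)
    have h3 := cross_mul f z a (Equiv.swap l j) (Equiv.swap i l * Equiv.swap l j)
      (Equiv.swap_apply_of_ne_of_ne hlz.symm hjz.symm)
    have h4 := cross_mul f z a (Equiv.swap i l) (Equiv.swap l j)
      (Equiv.swap_apply_of_ne_of_ne hi.symm hlz.symm)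
    linarith

theorem cross_swap {k : ℕ} (f : Equiv.Perm (Fin k) → Fin k) (z a : Fin k) (hz : (z : ℕ) = 0)
    (i j : Fin k) (hi : i ≠ z) (hj : j ≠ z) (hij : i ≠ j) :
    cross f z a (Equiv.swap i j) ≤ 4 * k * cnt (IsMPointR1 3 f) := by
  have main : ∀ i j : Fin k, i ≠ z → i < j →
      cross f z a (Equiv.swap i j) ≤ 4 * k * cnt (IsMPointR1 3 f) := by
    intro i j hi hij
    have hij' : (i : ℕ) < j := hij
    have hj := j.isLt
    refine (cross_swap_lt f z a hz i hi ((j : ℕ) - i - 1) j (by omega)).trans ?_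
    rw [← mul_assoc]
    apply Nat.mul_le_mul_right
    omega
  rcases lt_or_gt_of_ne hij with h | h
  · exact main i j hi h
  · rw [Equiv.swap_comm]; exact main j i hj h

theorem cross_general {k : ℕ} (f : Equiv.Perm (Fin k) → Fin k) (z a : Fin k)
    (hz : (z : ℕ) = 0) (s : ℕ) : ∀ g : Equiv.Perm (Fin k), g z = z → g.support.card ≤ s →
    cross f z a g ≤ s * (4 * k * cnt (IsMPointR1 3 f)) := by
  have h1c : cross f z a 1 = 0 := by
    apply cnt_eq_zero
    rintro σ ⟨⟨_, h⟩, h'⟩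
    exact h' (by simpa using h)
  induction s with
  | zero =>
    intro g hg hs
    have : g = 1 := by simpa using hs
    rw [this, h1c]; simp
  | succ s ih =>
    intro g hg hs
    by_cases hg1 : g = 1
    · rw [hg1, h1c]; exact Nat.zero_le _
    obtain ⟨x, hx⟩ : ∃ x, g x ≠ x := by
      by_contra hcon
      push Not at hcon
      exact hg1 (Equiv.ext hcon)
    have hxz : x ≠ z := by rintro rfl; exact hx hg
    have hgxz : g x ≠ z := by
      intro h
      exact hxz (g.injective (h.trans hg.symm))
    have hfix : Equiv.swap x (g x) z = z :=
      Equiv.swap_apply_of_ne_of_ne hxz.symm hgxz.symm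
    have e : g = Equiv.swap x (g x) * (Equiv.swap x (g x) * g) := by
      rw [← mul_assoc, Equiv.swap_mul_self, one_mul]
    have hc := Equiv.Perm.card_support_swap_mul hx
    have h1 := ih (Equiv.swap x (g x) * g) (by simp [hg, hfix]) (by omega)
    have h2 := cross_swap f z a hz x (g x) hxz hgxz hx.symm
    have h3 := cross_mul f z a (Equiv.swap x (g x)) (Equiv.swap x (g x) * g) hfix
    rw [← e] at h3
    linarith

theorem product_bound {k : ℕ} (f : Equiv.Perm (Fin k) → Fin k) (z a : Fin k)
    (hz : (z : ℕ) = 0) :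
    cnt (fun σ => σ z = a ∧ f σ = a) * cnt (fun σ => σ z = a ∧ f σ ≠ a) ≤
      Fintype.card (Equiv.Perm (Fin k)) * (4 * k ^ 2 * cnt (IsMPointR1 3 f)) := by
  classical
  have hcross : ∀ g : Equiv.Perm (Fin k),
      cnt (fun σ => (σ z = a ∧ f σ = a) ∧ (σ * g) z = a ∧ f (σ * g) ≠ a) ≤
        4 * k ^ 2 * cnt (IsMPointR1 3 f) := by
    intro g
    by_cases hg : g z = z
    · have h := cross_general f z a hz k g hg
        ((Finset.card_le_univ _).trans (by simp))
      have h2 : cnt (fun σ => (σ z = a ∧ f σ = a) ∧ (σ * g) z = a ∧ f (σ * g) ≠ a) ≤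
          cross f z a g := cnt_mono (fun σ h => ⟨h.1, h.2.2⟩)
      refine h2.trans (h.trans (le_of_eq ?_))
      ring
    · have : cnt (fun σ => (σ z = a ∧ f σ = a) ∧ (σ * g) z = a ∧ f (σ * g) ≠ a) = 0 := by
        apply cnt_eq_zero
        rintro σ ⟨⟨h1, _⟩, h2, _⟩
        apply hg
        apply σ.injective
        rw [h1]; exact h2
      rw [this]; exact Nat.zero_le _
  calc cnt (fun σ => σ z = a ∧ f σ = a) * cnt (fun σ => σ z = a ∧ f σ ≠ a)
      ≤ ((Finset.univ : Finset (Equiv.Perm (Fin k))).sigma (fun g => Finset.univ.filter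
          (fun σ : Equiv.Perm (Fin k) =>
            (σ z = a ∧ f σ = a) ∧ (σ * g) z = a ∧ f (σ * g) ≠ a))).card := by
        unfold cnt
        rw [← Finset.card_product]
        apply Finset.card_le_card_of_injOn
          (fun x => (⟨x.1⁻¹ * x.2, x.1⟩ : Σ _ : Equiv.Perm (Fin k), Equiv.Perm (Fin k)))
        · rintro ⟨σ, τ⟩ h
          simp only [Finset.coe_product, Set.mem_prod, Finset.mem_coe, Finset.mem_filter,
            Finset.mem_univ, true_and] at h
          simp only [Finset.mem_coe, Finset.mem_sigma, Finset.mem_filter,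
            Finset.mem_univ, true_and, mul_inv_cancel_left]
          exact h
        · rintro ⟨σ, τ⟩ _ ⟨σ', τ'⟩ _ h
          simp only [Sigma.mk.injEq, heq_eq_eq] at h
          obtain ⟨h1, h2⟩ := h
          subst h2
          simpa using h1
    _ = ∑ g : Equiv.Perm (Fin k), cnt (fun σ =>
            (σ z = a ∧ f σ = a) ∧ (σ * g) z = a ∧ f (σ * g) ≠ a) := by
        rw [Finset.card_sigma]
        apply Finset.sum_congr rfl
        intro g _
        unfold cnt
        congr
    _ ≤ _ := by
        refine (Finset.sum_le_card_nsmul _ _ _ (fun g _ => hcross g)).trans ?_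
        simp

theorem layer_f {k : ℕ} (f : Equiv.Perm (Fin k) → Fin k) (z a : Fin k) (hz : (z : ℕ) = 0) :
    cnt (fun σ => f σ = a) ≤ k * cnt (fun σ => σ z = a ∧ f σ = a) +
      2 * k ^ 2 * cnt (IsMPointR1 3 f) := by
  refine (layer_bound f a (fun σ => f σ = a) ?_).trans ?_
  · intro σ p q hpq hq h c1 c2
    rcases key_swap f σ p q hpq c1 c2 with e | e
    · exact e.trans h
    · exfalso
      have : p = q := σ.injective (by rw [← e, h, hq])
      rw [this] at hpq; omega
  · gcongr
    apply cnt_mono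
    rintro σ ⟨h1, h2⟩
    refine ⟨?_, h1⟩
    rw [← Equiv.eq_symm_apply]
    exact Fin.ext (hz.trans h2.symm)

theorem layer_above {k : ℕ} (f : Equiv.Perm (Fin k) → Fin k) (z a : Fin k)
    (hz : (z : ℕ) = 0) :
    cnt (fun σ => Above σ a (f σ)) ≤ k * cnt (fun σ => σ z = a ∧ f σ ≠ a) +
      2 * k ^ 2 * cnt (IsMPointR1 3 f) := by
  refine (layer_bound f a (fun σ => Above σ a (f σ)) ?_).trans ?_
  · intro σ p q hpq hq h c1 c2
    unfold Above at h ⊢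
    have ha : σ.symm a = q := by rw [Equiv.symm_apply_eq, hq]
    rw [ha] at h
    rcases key_swap f σ p q hpq c1 c2 with e | e
    · have ha' : (σ * Equiv.swap p q).symm a = p := by
        rw [Equiv.symm_apply_eq]; simp [hq]
      rw [e, ha']
      obtain ⟨u, hu⟩ := σ.surjective (f σ)
      rw [← hu] at h ⊢
      rw [Equiv.symm_apply_apply] at h
      have h' : (q : ℕ) < u := h
      have hup : u ≠ p := by rintro rfl; omega
      have huq : u ≠ q := by rintro rfl; omega
      have : (σ * Equiv.swap p q).symm (σ u) = u := by
        rw [Equiv.symm_apply_eq]; simp [Equiv.swap_apply_of_ne_of_ne hup huq]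
      rw [this, Fin.lt_def]; omega
    · exfalso
      rw [e, Equiv.symm_apply_apply, Fin.lt_def] at h
      omega
  · gcongr
    apply cnt_mono
    rintro σ ⟨h1, h2⟩
    refine ⟨?_, ?_⟩
    · rw [← Equiv.eq_symm_apply]
      exact Fin.ext (hz.trans h2.symm)
    · intro h
      rw [h] at h1
      exact lt_irrefl _ h1

theorem prob_eq_s1 {k : ℕ} (p : Equiv.Perm (Fin k) → Prop) :
    prob p = (cnt p : ℝ) / (Fintype.card (Equiv.Perm (Fin k)) : ℝ) := rfl

theorem exists_top {k : ℕ} (H : Finset (Fin k)) (hH : H.Nonempty) :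
    ∃ g : Equiv.Perm (Fin k) → Fin k, IsTop1 g H := by
  have : ∀ σ : Equiv.Perm (Fin k), ∃ a ∈ H, ∀ b ∈ H, σ.symm a ≤ σ.symm b :=
    fun σ => Finset.exists_min_image H (fun x => σ.symm x) hH
  choose g hg1 hg2 using this
  refine ⟨g, fun σ => ⟨hg1 σ, fun b hb hne => ?_⟩⟩
  exact lt_of_le_of_ne (hg2 σ b hb) (fun h => hne (σ.symm.injective h).symm)

theorem stmt1 (k : ℕ) (hk : 3 ≤ k) (ε : ℝ) (hε0 : 0 < ε) (hε1 : ε ≤ 1)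
    (f : Equiv.Perm (Fin k) → Fin k)
    (hD : ∀ g : Equiv.Perm (Fin k) → Fin k, InNonManip1 g →
      ε ≤ prob (fun σ : Equiv.Perm (Fin k) => f σ ≠ g σ)) :
    ε ^ 3 / (10 ^ 5 * (k : ℝ) ^ 16) ≤
      prob (fun σ : Equiv.Perm (Fin k) => IsMPointR1 3 f σ) := by
  classical
  set N : ℝ := (Fintype.card (Equiv.Perm (Fin k)) : ℝ) with hN
  have hNpos : 0 < N := by
    rw [hN]; exact_mod_cast Fintype.card_pos
  have hk3 : (3 : ℝ) ≤ k := by exact_mod_cast hk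
  have hk0 : (0 : ℝ) < k := by linarith
  let z : Fin k := ⟨0, by omega⟩
  have hz : (z : ℕ) = 0 := rfl
  rw [prob_eq_s1, ← hN]
  set M : ℝ := (cnt (IsMPointR1 3 f) : ℝ) with hM
  change _ ≤ M / N
  have hM0 : 0 ≤ M := by rw [hM]; positivity
  rw [le_div_iff₀ hNpos]
  by_contra hcon
  push Not at hcon
  have hsmall : M < ε ^ 2 * N / (36 * k ^ 6) := by
    refine hcon.trans_le ?_
    rw [div_mul_eq_mul_div, div_le_div_iff₀ (by positivity) (by positivity)]
    have h1 : ε ^ 3 ≤ ε ^ 2 := pow_le_pow_of_le_one hε0.le hε1 (by norm_num)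
    have h2 : (k : ℝ) ^ 6 ≤ k ^ 16 := pow_le_pow_right₀ (by linarith) (by norm_num)
    have h3 : 36 * (k : ℝ) ^ 6 ≤ 10 ^ 5 * k ^ 16 := by
      have : (0 : ℝ) ≤ k ^ 16 := by positivity
      linarith
    gcongr
  have hM1 : 36 * k ^ 6 * M < ε ^ 2 * N := by
    rw [lt_div_iff₀ (by positivity)] at hsmall
    linarith
  have hM2 : 8 * k ^ 3 * M ≤ ε * N := by
    have h1 : (k : ℝ) ^ 3 ≤ k ^ 6 := pow_le_pow_right₀ (by linarith) (by norm_num)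
    have h2 : ε ^ 2 ≤ ε := by nlinarith
    have h3 : (k : ℝ) ^ 3 * M ≤ k ^ 6 * M := by gcongr
    have h4 : ε ^ 2 * N ≤ ε * N := by gcongr
    have h5 : 0 ≤ (k : ℝ) ^ 6 * M := by positivity
    linarith
  let H : Finset (Fin k) := Finset.univ.filter
    (fun a => ε * N ≤ 2 * k * (cnt (fun σ => f σ = a) : ℝ))
  have htot : N ≤ ∑ a : Fin k, (cnt (fun σ => f σ = a) : ℝ) := by
    have h := cnt_exists (Finset.univ : Finset (Fin k)) (fun a σ => f σ = a)
    have h2 : cnt (fun σ => ∃ a ∈ (Finset.univ : Finset (Fin k)), f σ = a) =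
        Fintype.card (Equiv.Perm (Fin k)) :=
      cnt_eq_card (fun σ => ⟨f σ, Finset.mem_univ _, rfl⟩)
    rw [h2] at h
    rw [hN]
    exact_mod_cast h
  have hH : H.Nonempty := by
    by_contra hne
    rw [Finset.not_nonempty_iff_eq_empty] at hne
    have hall : ∀ a : Fin k, (cnt (fun σ => f σ = a) : ℝ) ≤ ε * N / (2 * k) := by
      intro a
      have : a ∉ H := by rw [hne]; simp
      simp only [H, Finset.mem_filter, Finset.mem_univ, true_and, not_le] at this
      rw [le_div_iff₀ (by positivity)]
      linarith
    have h := Finset.sum_le_card_nsmul Finset.univ _ _ (fun a _ => hall a)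
    simp only [Finset.card_univ, Fintype.card_fin, nsmul_eq_mul] at h
    have e : (k : ℝ) * (ε * N / (2 * k)) = ε * N / 2 := by field_simp
    nlinarith
  obtain ⟨g, hg⟩ := exists_top H hH
  have hDg := hD g (Or.inl ⟨H, hH, hg⟩)
  rw [prob_eq_s1, ← hN, le_div_iff₀ hNpos] at hDg
  -- the disagreement set
  have hcov : cnt (fun σ => f σ ≠ g σ) ≤
      (∑ a ∈ Finset.univ.filter (fun a => a ∉ H), cnt (fun σ => f σ = a)) +
      ∑ a ∈ H, cnt (fun σ => Above σ a (f σ)) := by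
    have h1 := cnt_exists (Finset.univ.filter (fun a => a ∉ H)) (fun a σ => f σ = a)
    have h2 := cnt_exists H (fun a σ => Above σ a (f σ))
    refine le_trans ?_ (add_le_add h1 h2)
    refine le_trans (cnt_mono ?_) (cnt_or _ _)
    intro σ hσ
    by_cases hf : f σ ∈ H
    · right
      exact ⟨g σ, (hg σ).1, (hg σ).2 _ hf hσ⟩
    · left
      exact ⟨f σ, by simpa using hf, rfl⟩
  have hlow : ∀ a ∈ Finset.univ.filter (fun a => a ∉ H),
      (cnt (fun σ => f σ = a) : ℝ) ≤ ε * N / (2 * k) := by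
    intro a ha
    have : a ∉ H := by simpa using ha
    simp only [H, Finset.mem_filter, Finset.mem_univ, true_and, not_le] at this
    rw [le_div_iff₀ (by positivity)]
    linarith
  have hhigh : ∀ a ∈ H, (cnt (fun σ => Above σ a (f σ)) : ℝ) ≤ 18 * k ^ 5 * M / ε := by
    intro a ha
    simp only [H, Finset.mem_filter, Finset.mem_univ, true_and] at ha
    have h1 : (cnt (fun σ => f σ = a) : ℝ) ≤ k * (cnt (fun σ => σ z = a ∧ f σ = a) : ℝ) +
        2 * k ^ 2 * M := by rw [hM]; exact_mod_cast layer_f f z a hz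
    have h2 : (cnt (fun σ => Above σ a (f σ)) : ℝ) ≤
        k * (cnt (fun σ => σ z = a ∧ f σ ≠ a) : ℝ) + 2 * k ^ 2 * M := by
      rw [hM]; exact_mod_cast layer_above f z a hz
    have h3 : (cnt (fun σ => σ z = a ∧ f σ = a) : ℝ) * (cnt (fun σ => σ z = a ∧ f σ ≠ a) : ℝ) ≤
        N * (4 * k ^ 2 * M) := by rw [hM, hN]; exact_mod_cast product_bound f z a hz
    set A : ℝ := (cnt (fun σ => σ z = a ∧ f σ = a) : ℝ)
    set A' : ℝ := (cnt (fun σ => σ z = a ∧ f σ ≠ a) : ℝ)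
    set C : ℝ := (cnt (fun σ => f σ = a) : ℝ)
    have hA' : 0 ≤ A' := Nat.cast_nonneg _
    have hA : ε * N ≤ 4 * k ^ 2 * A := by
      have : 2 * k * C ≤ 2 * k * (k * A + 2 * k ^ 2 * M) := by gcongr
      nlinarith
    have h4 : ε * A' ≤ 16 * k ^ 4 * M := by
      have e1 : (ε * N) * A' ≤ (4 * k ^ 2 * A) * A' := by gcongr
      have e2 : 4 * (k : ℝ) ^ 2 * (A * A') ≤ 4 * k ^ 2 * (N * (4 * k ^ 2 * M)) := by gcongr
      have e3 : N * (ε * A') ≤ N * (16 * k ^ 4 * M) := by nlinarith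
      exact le_of_mul_le_mul_left e3 hNpos
    rw [le_div_iff₀ hε0]
    have h5 : ε * (cnt (fun σ => Above σ a (f σ)) : ℝ) ≤ ε * (k * A' + 2 * k ^ 2 * M) := by
      gcongr
    have h6 : k * (ε * A') ≤ k * (16 * k ^ 4 * M) := by gcongr
    have h7 : ε * (2 * k ^ 2 * M) ≤ 1 * (2 * k ^ 5 * M) := by
      have : (k : ℝ) ^ 2 ≤ k ^ 5 := pow_le_pow_right₀ (by linarith) (by norm_num)
      gcongr
    nlinarith
  have hcov' : (cnt (fun σ => f σ ≠ g σ) : ℝ) ≤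
      (∑ a ∈ Finset.univ.filter (fun a => a ∉ H), (cnt (fun σ => f σ = a) : ℝ)) +
      ∑ a ∈ H, (cnt (fun σ => Above σ a (f σ)) : ℝ) := by exact_mod_cast hcov
  have hs1 := Finset.sum_le_card_nsmul _ _ _ hlow
  have hs2 := Finset.sum_le_card_nsmul _ _ _ hhigh
  simp only [nsmul_eq_mul] at hs1 hs2
  have hc1 : ((Finset.univ.filter (fun a => a ∉ H)).card : ℝ) ≤ k := by
    exact_mod_cast (Finset.card_le_univ _).trans (by simp)
  have hc2 : (H.card : ℝ) ≤ k := by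
    exact_mod_cast (Finset.card_le_univ _).trans (by simp)
  have hb1 : ((Finset.univ.filter (fun a => a ∉ H)).card : ℝ) * (ε * N / (2 * k)) ≤
      ε * N / 2 := by
    calc _ ≤ (k : ℝ) * (ε * N / (2 * k)) := by gcongr
      _ = _ := by field_simp
  have hb2 : (H.card : ℝ) * (18 * k ^ 5 * M / ε) ≤ 18 * k ^ 6 * M / ε := by
    calc _ ≤ (k : ℝ) * (18 * k ^ 5 * M / ε) := by gcongr
      _ = _ := by ring
  have hb3 : 18 * k ^ 6 * M / ε < ε * N / 2 := by
    rw [div_lt_iff₀ hε0]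
    nlinarith
  linarith
end
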